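/- Let n ≥ 1 and q > 1. Let φ: ℝⁿ → (0,+∞] be an essentially continuous convex function such that ρ̄ := φ^{−(n+q)}·dx is a probability measure on ℝⁿ, and suppose that the pushforward μ := (∇φ)_# ρ̄ (well-defined since φ is differentiable Lebesgue-a.e. on the interior of {φ < +∞}) has finite first moment and is not supported on any affine hyperplane. Then ρ̄ ∈ P_1(ℝⁿ) and ρ̄ minimizes J(ρ) := F(ρ) + T(ρ,μ) over P_1(ℝⁿ): J(ρ̄) ≤ J(ρ) for every ρ ∈ P_1(ℝⁿ). -/

import Mathlib

open MeasureTheory Topology Filter Set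
open scoped ENNReal RealInnerProductSpace

noncomputable section

abbrev En (n : ℕ) : Type := EuclideanSpace ℝ (Fin n)

/-- The positive part of an extended real number, as an element of `ℝ≥0∞`. -/
def posPartNN (x : EReal) : ℝ≥0∞ := if x = ⊤ then ⊤ else ENNReal.ofReal x.toReal

/-- The integral of an `EReal`-valued function, with values in `EReal`
(defined as the integral of the positive part minus that of the negative part). -/
def eInt {X : Type*} [MeasurableSpace X] (ρ : Measure X) (g : X → EReal) : EReal :=
  ((∫⁻ x, posPartNN (g x) ∂ρ : ℝ≥0∞) : EReal) - ((∫⁻ x, posPartNN (-(g x)) ∂ρ : ℝ≥0∞) : EReal)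

/-- Transport plans between `ρ` and `μ`. -/
def Plans {n : ℕ} (ρ μ : Measure (En n)) : Set (Measure (En n × En n)) :=
  {γ | IsProbabilityMeasure γ ∧ γ.map Prod.fst = ρ ∧ γ.map Prod.snd = μ}

/-- The maximal correlation functional `T(ρ,μ)`. -/
def Tcorr {n : ℕ} (ρ μ : Measure (En n)) : EReal :=
  ⨆ γ ∈ Plans ρ μ, eInt γ (fun p => ((⟪p.1, p.2⟫ : ℝ) : EReal))

/-- The local functional `F(ρ) = ∫ f(ρ^ac) dx` with `f(t) = -t^α/α`, `α = 1 - 1/(n+q)`. -/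
def Ffun (n : ℕ) (q : ℝ) (ρ : Measure (En n)) : EReal :=
  - ((∫⁻ x, ENNReal.ofReal
      ((ρ.rnDeriv volume x).toReal ^ (1 - 1/((n : ℝ) + q)) / (1 - 1/((n : ℝ) + q)))
      ∂volume : ℝ≥0∞) : EReal)

/-- The functional `J(ρ) = F(ρ) + T(ρ,μ)`. -/
def Jfun (n : ℕ) (q : ℝ) (μ ρ : Measure (En n)) : EReal := Ffun n q ρ + Tcorr ρ μ

/-- Finite first moment. -/
def P1 {n : ℕ} (ρ : Measure (En n)) : Prop := Integrable (fun x : En n => ‖x‖) ρ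

/-- `μ` is not supported on any affine hyperplane. -/
def NotHyperplane {n : ℕ} (μ : Measure (En n)) : Prop :=
  ∀ (e : En n) (ℓ : ℝ), e ≠ 0 → μ {x | ⟪x, e⟫ = ℓ} ≠ 1


/-- A convex, lower semicontinuous function with values in `ℝ ∪ {+∞}`,
convexity being expressed through the epigraph. -/
def ConvexLSC {n : ℕ} (u : En n → EReal) : Prop :=
  LowerSemicontinuous u ∧ Convex ℝ {p : En n × ℝ | u p.1 ≤ (p.2 : EReal)}

/-- `φ` is essentially continuous: its set of discontinuity points (as a map to
`(0,+∞]`) is `H^{n-1}`-negligible. -/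
def EssCont {n : ℕ} (φ : En n → EReal) : Prop :=
  Measure.hausdorffMeasure ((n : ℝ) - 1) {x : En n | ¬ ContinuousAt φ x} = 0

/-- The weighted Young inequality dual to the power `t ↦ t ^ (1 - 1/β)`. -/
lemma young_power {β s m V : ℝ} (hβ : 1 < β) (hs : 0 < s) (hm : 0 ≤ m) (hV : 0 ≤ V) :
    (1 - 1 / β)⁻¹ * (m ^ (1 - 1 / β) * V ^ (1 / β)) ≤ s * m + (β - 1)⁻¹ * s ^ (1 - β) * V := by
  have hβ0 : 0 < β := by linarith
  have hα : 0 < 1 - 1 / β := by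
    rw [sub_pos, div_lt_one hβ0]; exact hβ
  set α := 1 - 1 / β with hαdef
  have h1 : 1 / β = 1 - α := by rw [hαdef]; ring
  have hα1 : 0 < 1 / β := by positivity
  have hp2 : 0 ≤ α⁻¹ * (s ^ (1 - β) * V) := by positivity
  have key := Real.geom_mean_le_arith_mean2_weighted hα.le hα1.le
    (by positivity : 0 ≤ α⁻¹ * (s * m)) hp2 (by rw [h1]; ring)
  have e1 : (α⁻¹ * (s * m)) ^ α * (α⁻¹ * (s ^ (1 - β) * V)) ^ (1 / β)
      = α⁻¹ * (m ^ α * V ^ (1 / β)) := by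
    rw [Real.mul_rpow (by positivity) (by positivity),
      Real.mul_rpow (by positivity) (by positivity),
      Real.mul_rpow (by positivity) (by positivity), Real.mul_rpow (by positivity) (by positivity),
      ← Real.rpow_mul hs.le]
    have e2 : (1 - β) * (1 / β) = -α := by rw [hαdef]; field_simp; ring
    have e3 : α⁻¹ ^ α * α⁻¹ ^ (1 / β) = α⁻¹ := by
      rw [← Real.rpow_add (by positivity), h1]; simp
    have e4 : s ^ α * s ^ (-α) = 1 := by
      rw [← Real.rpow_add hs]; simp
    rw [e2]
    calc _ = (α⁻¹ ^ α * α⁻¹ ^ (1 / β)) * (s ^ α * s ^ (-α)) * (m ^ α * V ^ (1 / β)) := by ring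
      _ = _ := by rw [e3, e4]; ring
  have e5 : 1 / β * α⁻¹ = (β - 1)⁻¹ := by
    rw [hαdef]; have : β - 1 ≠ 0 := by linarith
    field_simp
  calc _ = _ := e1.symm
    _ ≤ _ := key
    _ = (α * α⁻¹) * (s * m) + (1 / β * α⁻¹) * (s ^ (1 - β) * V) := by ring
    _ = _ := by rw [mul_inv_cancel₀ hα.ne', e5]; ring

/-- Concavity of `∏ ^ (1/β)` along segments (Brunn–Minkowski for boxes). -/
lemma prod_rpow_concave {n : ℕ} {β t : ℝ} (hn : 1 ≤ n) (hnβ : (n : ℝ) ≤ β)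
    (ht0 : 0 < t) (ht1 : t < 1)
    (a b : Fin n → ℝ) (ha : ∀ i, 0 ≤ a i) (hb : ∀ i, 0 ≤ b i) :
    (1 - t) * (∏ i, a i) ^ (1 / β) + t * (∏ i, b i) ^ (1 / β)
      ≤ (∏ i, ((1 - t) * a i + t * b i)) ^ (1 / β) := by
  have hn' : (1 : ℝ) ≤ n := by exact_mod_cast hn
  have hβ0 : 0 < β := by linarith
  have ht' : 0 < 1 - t := by linarith
  set c : Fin n → ℝ := fun i => (1 - t) * a i + t * b i with hc
  have hc0 : ∀ i, 0 ≤ c i := fun i => by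
    have := ha i; have := hb i; simp only [hc]; positivity
  by_cases hz : ∃ i, c i = 0
  · obtain ⟨i, hi⟩ := hz
    have h1 : a i = 0 := by
      have := mul_nonneg ht'.le (ha i); have := mul_nonneg ht0.le (hb i)
      simp only [hc] at hi
      have : (1 - t) * a i = 0 := by linarith
      rcases mul_eq_zero.1 this with h | h
      · linarith
      · exact h
    have h2 : b i = 0 := by
      simp only [hc] at hi
      rw [h1] at hi
      have : t * b i = 0 := by linarith
      rcases mul_eq_zero.1 this with h | h
      · linarith
      · exact h
    rw [Finset.prod_eq_zero (Finset.mem_univ i) h1, Finset.prod_eq_zero (Finset.mem_univ i) h2,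
      Finset.prod_eq_zero (Finset.mem_univ i) hi]
    rw [Real.zero_rpow (by positivity)]; simp
  · push Not at hz
    have hcp : ∀ i, 0 < c i := fun i => lt_of_le_of_ne (hc0 i) (hz i).symm
    have hP : 0 < ∏ i, c i := Finset.prod_pos fun i _ => hcp i
    have aux : ∀ d : Fin n → ℝ, (∀ i, 0 ≤ d i) →
        (∏ i, d i) ^ (1 / β) ≤ (∏ i, c i) ^ (1 / β) * (∑ i, 1 / β * (d i / c i) + (1 - n / β)) := by
      intro d hd
      have key := Real.geom_mean_le_arith_mean_weighted (Finset.univ : Finset (Option (Fin n)))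
        (fun o => o.elim (1 - n / β) (fun _ => 1 / β)) (fun o => o.elim 1 (fun i => d i / c i))
        (by
          rintro (_ | i) -
          · simp only [Option.elim]; rw [sub_nonneg, div_le_one hβ0]; exact hnβ
          · simp only [Option.elim]; positivity)
        (by simp; field_simp; ring)
        (by
          rintro (_ | i) -
          · simp
          · simp only [Option.elim]; exact div_nonneg (hd i) (hc0 i))
      simp only [Fintype.prod_option, Fintype.sum_option, Option.elim, Real.one_rpow, one_mul,
        mul_one] at key
      rw [Real.finsetProd_rpow _ _ (fun i _ => div_nonneg (hd i) (hc0 i)), Finset.prod_div_distrib,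
        Real.div_rpow (Finset.prod_nonneg fun i _ => hd i) hP.le,
        div_le_iff₀ (by positivity)] at key
      calc _ ≤ _ := key
        _ = _ := by ring
    have h1 := mul_le_mul_of_nonneg_left (aux a ha) ht'.le
    have h2 := mul_le_mul_of_nonneg_left (aux b hb) ht0.le
    have e : (1 - t) * (∑ i, 1 / β * (a i / c i) + (1 - n / β))
        + t * (∑ i, 1 / β * (b i / c i) + (1 - n / β)) = 1 := by
      have : ∑ i, ((1 - t) * (1 / β * (a i / c i)) + t * (1 / β * (b i / c i))) = n / β := by
        have : ∀ i, ((1 - t) * (1 / β * (a i / c i)) + t * (1 / β * (b i / c i))) = 1 / β := by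
          intro i
          have := (hcp i).ne'
          calc _ = 1 / β * (c i / c i) := by simp only [hc]; ring
            _ = _ := by rw [div_self this]; ring
        rw [Finset.sum_congr rfl fun i _ => this i]; simp; ring
      rw [Finset.sum_add_distrib, ← Finset.mul_sum (a := 1 - t), ← Finset.mul_sum (a := t)] at this
      linarith
    calc _ ≤ _ := add_le_add h1 h2
      _ = (∏ i, c i) ^ (1 / β) * ((1 - t) * (∑ i, 1 / β * (a i / c i) + (1 - n / β))
        + t * (∑ i, 1 / β * (b i / c i) + (1 - n / β))) := by ring
      _ = _ := by rw [e, mul_one]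

/-- Closed coordinate boxes. -/
def cbox {n : ℕ} (l u : Fin n → ℝ) : Set (En n) := {x | ∀ i, l i ≤ x i ∧ x i ≤ u i}

/-- Open coordinate boxes. -/
def obox {n : ℕ} (l u : Fin n → ℝ) : Set (En n) := {x | ∀ i, l i < x i ∧ x i < u i}

lemma measurable_coord {n : ℕ} (i : Fin n) : Measurable fun x : En n => x i := by fun_prop

lemma measurableSet_cbox {n : ℕ} (l u : Fin n → ℝ) : MeasurableSet (cbox l u) := by
  simp only [cbox, ofPred_forall]
  refine MeasurableSet.iInter fun i => ?_
  exact (measurableSet_le measurable_const (measurable_coord i)).inter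
    (measurableSet_le (measurable_coord i) measurable_const)

lemma measurableSet_obox {n : ℕ} (l u : Fin n → ℝ) : MeasurableSet (obox l u) := by
  simp only [obox, ofPred_forall]
  refine MeasurableSet.iInter fun i => ?_
  exact (measurableSet_lt measurable_const (measurable_coord i)).inter
    (measurableSet_lt (measurable_coord i) measurable_const)

lemma volume_cbox {n : ℕ} (l u : Fin n → ℝ) (h : ∀ i, l i ≤ u i) :
    volume (cbox l u) = ENNReal.ofReal (∏ i, (u i - l i)) := by
  rw [ENNReal.ofReal_prod_of_nonneg fun i _ => sub_nonneg.2 (h i), ← Real.volume_Icc_pi,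
    ← (PiLp.volume_preserving_ofLp (Fin n)).measure_preimage measurableSet_Icc.nullMeasurableSet]
  congr 1
  ext x
  simp [cbox, Pi.le_def, forall_and]

lemma volume_obox {n : ℕ} (l u : Fin n → ℝ) (h : ∀ i, l i ≤ u i) :
    volume (obox l u) = ENNReal.ofReal (∏ i, (u i - l i)) := by
  rw [ENNReal.ofReal_prod_of_nonneg fun i _ => sub_nonneg.2 (h i), ← Real.volume_pi_Ioo,
    ← (PiLp.volume_preserving_ofLp (Fin n)).measure_preimage
      (MeasurableSet.univ_pi fun i => measurableSet_Ioo).nullMeasurableSet]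
  congr 1
  ext x
  simp [obox]

lemma volume_coord_eq {n : ℕ} (i : Fin n) (b : ℝ) : volume {x : En n | x i = b} = 0 := by
  have h : {x : En n | x i = b} = (WithLp.ofLp) ⁻¹' {y : Fin n → ℝ | y i = b} := by ext; simp
  have hm : MeasurableSet {y : Fin n → ℝ | y i = b} :=
    (measurableSet_singleton b).preimage (measurable_pi_apply i)
  rw [h, (PiLp.volume_preserving_ofLp (Fin n)).measure_preimage hm.nullMeasurableSet]
  exact Measure.pi_hyperplane (fun _ : Fin n => (volume : Measure ℝ)) i b

lemma lintegral_rpow_le_holder {n : ℕ} {α : ℝ} (hα0 : 0 < α) (hα1 : α ≤ 1) {r : En n → ℝ≥0∞}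
    (hr : Measurable r) {A : Set (En n)} (hA : MeasurableSet A) {f : Measure (En n)}
    (hrf : volume.withDensity r ≤ f) (hfA : f Aᶜ = 0) :
    ∫⁻ x, r x ^ α ≤ f univ ^ α * volume A ^ (1 - α) := by
  have h0 : ∫⁻ x in Aᶜ, r x = 0 := by
    rw [← withDensity_apply _ hA.compl]
    exact le_antisymm ((hrf _).trans hfA.le) zero_le
  have h0' : ∫⁻ x in Aᶜ, r x ^ α = 0 := by
    rw [lintegral_eq_zero_iff hr] at h0
    rw [lintegral_eq_zero_iff (hr.pow_const _)]
    filter_upwards [h0] with x hx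
    simp only [Pi.zero_apply] at hx ⊢
    rw [hx, ENNReal.zero_rpow_of_pos hα0]
  rw [← lintegral_add_compl _ hA, h0', add_zero]
  have := ENNReal.lintegral_mul_norm_pow_le (μ := volume.restrict A) (f := r) (g := fun _ => 1)
    hr.aemeasurable aemeasurable_const hα0.le (sub_nonneg.2 hα1) (by ring)
  simp only [ENNReal.one_rpow, mul_one, lintegral_const, one_mul,
    Measure.restrict_apply_univ] at this
  refine this.trans ?_
  gcongr
  rw [← withDensity_apply _ hA]
  exact (hrf _).trans (measure_mono (subset_univ _))

lemma exists_coord_quantile {n : ℕ} (g : Measure (En n)) [IsFiniteMeasure g] {l u : Fin n → ℝ}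
    (hg : g (cbox l u)ᶜ = 0) (i : Fin n) (hlu : l i ≤ u i) {m : ℝ≥0∞} (hm : m ≤ g univ) :
    ∃ b ∈ Icc (l i) (u i), g {x | x i < b} ≤ m ∧ m ≤ g {x | x i ≤ b} := by
  set S : Set ℝ := {s | s ∈ Icc (l i) (u i) ∧ m ≤ g {x | x i ≤ s}} with hS
  have hu : u i ∈ S := by
    refine ⟨⟨hlu, le_rfl⟩, hm.trans ?_⟩
    rw [← measure_add_measure_compl (measurableSet_cbox l u), hg, add_zero]
    exact measure_mono fun x hx => (hx i).2
  have hbdd : BddBelow S := ⟨l i, fun s hs => hs.1.1⟩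
  have hmeas : ∀ s : ℝ, MeasurableSet {x : En n | x i ≤ s} := fun s =>
    measurableSet_le (measurable_coord i) measurable_const
  have hpos : ∀ k : ℕ, (0 : ℝ) < 1 / ((k : ℝ) + 1) := fun k => by positivity
  refine ⟨sInf S, ⟨le_csInf ⟨_, hu⟩ fun s hs => hs.1.1, csInf_le hbdd hu⟩, ?_, ?_⟩
  · have h1 : {x : En n | x i < sInf S} = ⋃ k : ℕ, {x | x i ≤ sInf S - 1 / ((k : ℝ) + 1)} := by
      ext x
      simp only [mem_ofPred_eq, mem_iUnion]
      constructor
      · intro h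
        obtain ⟨k, hk⟩ := exists_nat_one_div_lt (sub_pos.2 h)
        exact ⟨k, by linarith⟩
      · rintro ⟨k, hk⟩
        linarith [hpos k]
    have hmono : Monotone fun k : ℕ => {x : En n | x i ≤ sInf S - 1 / ((k : ℝ) + 1)} := by
      intro j k hjk x hx
      simp only [mem_ofPred_eq] at hx ⊢
      have := Nat.one_div_le_one_div (α := ℝ) hjk
      linarith
    rw [h1, hmono.measure_iUnion]
    refine iSup_le fun k => ?_
    by_contra hlt
    push Not at hlt
    by_cases hl : l i ≤ sInf S - 1 / ((k : ℝ) + 1)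
    · have : sInf S - 1 / ((k : ℝ) + 1) ∈ S :=
        ⟨⟨hl, by linarith [hpos k, csInf_le hbdd hu]⟩, hlt.le⟩
      linarith [csInf_le hbdd this, hpos k]
    · have : g {x : En n | x i ≤ sInf S - 1 / ((k : ℝ) + 1)} = 0 := by
        refine measure_mono_null (t := (cbox l u)ᶜ) (fun x hx hx' => ?_) hg
        have := (hx' i).1
        simp only [mem_ofPred_eq] at hx
        linarith
      rw [this] at hlt
      exact absurd hlt (by simp)
  · have h1 : {x : En n | x i ≤ sInf S} = ⋂ k : ℕ, {x | x i ≤ sInf S + 1 / ((k : ℝ) + 1)} := by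
      ext x
      simp only [mem_ofPred_eq, mem_iInter]
      constructor
      · intro h k
        linarith [hpos k]
      · intro h
        by_contra hlt
        push Not at hlt
        obtain ⟨k, hk⟩ := exists_nat_one_div_lt (sub_pos.2 hlt)
        linarith [h k]
    have hanti : Antitone fun k : ℕ => {x : En n | x i ≤ sInf S + 1 / ((k : ℝ) + 1)} := by
      intro j k hjk x hx
      simp only [mem_ofPred_eq] at hx ⊢
      have := Nat.one_div_le_one_div (α := ℝ) hjk
      linarith
    rw [h1, hanti.measure_iInter (fun k => (hmeas _).nullMeasurableSet) ⟨0, measure_ne_top _ _⟩]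
    refine le_iInf fun k => ?_
    obtain ⟨s, hs, hsk⟩ := exists_lt_of_csInf_lt ⟨_, hu⟩
      (show sInf S < sInf S + 1 / ((k : ℝ) + 1) by linarith [hpos k])
    refine hs.2.trans (measure_mono fun x hx => ?_)
    simp only [mem_ofPred_eq] at hx ⊢
    linarith

/-- Splitting a measure on a box by a coordinate hyperplane, sharing the mass of the hyperplane. -/
lemma exists_split {n : ℕ} {α : ℝ} (hα : 0 < α) (g : Measure (En n)) [IsFiniteMeasure g]
    {r : En n → ℝ≥0∞} (hr : Measurable r) (hrg : volume.withDensity r ≤ g) {l u : Fin n → ℝ}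
    (hg : g (cbox l u)ᶜ = 0) (i : Fin n) (b : ℝ) {m : ℝ≥0∞}
    (hm1 : g {x | x i < b} ≤ m) (hm2 : m ≤ g {x | x i ≤ b}) :
    ∃ (g₁ g₂ : Measure (En n)) (r₁ r₂ : En n → ℝ≥0∞), g = g₁ + g₂ ∧ g₁ univ = m ∧
      Measurable r₁ ∧ Measurable r₂ ∧ volume.withDensity r₁ ≤ g₁ ∧ volume.withDensity r₂ ≤ g₂ ∧
      g₁ (cbox l (Function.update u i b))ᶜ = 0 ∧ g₂ (cbox (Function.update l i b) u)ᶜ = 0 ∧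
      (∫⁻ x, r x ^ α) = (∫⁻ x, r₁ x ^ α) + ∫⁻ x, r₂ x ^ α := by
  have hL : MeasurableSet {x : En n | x i < b} :=
    measurableSet_lt (measurable_coord i) measurable_const
  have hE : MeasurableSet {x : En n | x i = b} :=
    (measurableSet_singleton b).preimage (measurable_coord i)
  have hG : MeasurableSet {x : En n | b < x i} :=
    measurableSet_lt measurable_const (measurable_coord i)
  have hle : {x : En n | x i ≤ b} = {x | x i < b} ∪ {x | x i = b} := by
    ext x; simp [le_iff_lt_or_eq]
  have hdisj : Disjoint {x : En n | x i < b} {x | x i = b} :=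
    Set.disjoint_left.2 fun x h1 h2 => h1.ne h2
  have hcompl : {x : En n | x i < b}ᶜ = {x | x i = b} ∪ {x | b < x i} := by
    ext x; simp [le_iff_lt_or_eq, eq_comm, or_comm]
  have hdisj2 : Disjoint {x : En n | x i = b} {x | b < x i} :=
    Set.disjoint_left.2 fun x h1 h2 => h2.ne' h1
  have hmle : g {x | x i ≤ b} = g {x | x i < b} + g {x | x i = b} := by
    rw [hle, measure_union hdisj hE]
  set θ : ℝ≥0∞ := (m - g {x | x i < b}) / g {x | x i = b} with hθ
  have hθE : θ * g {x | x i = b} = m - g {x | x i < b} := by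
    by_cases h0 : g {x | x i = b} = 0
    · rw [h0, mul_zero, eq_comm, tsub_eq_zero_iff_le]
      rw [hmle, h0, add_zero] at hm2
      exact hm2
    · exact ENNReal.div_mul_cancel h0 (measure_ne_top _ _)
  have hθ1 : θ ≤ 1 := by
    refine ENNReal.div_le_of_le_mul ?_
    rw [one_mul, tsub_le_iff_left, ← hmle]
    exact hm2
  refine ⟨g.restrict {x | x i < b} + θ • g.restrict {x | x i = b},
    g.restrict {x | b < x i} + (1 - θ) • g.restrict {x | x i = b},
    indicator {x | x i < b} r, indicator {x | x i < b}ᶜ r, ?_, ?_, hr.indicator hL,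
    hr.indicator hL.compl, ?_, ?_, ?_, ?_, ?_⟩
  · have h1 : θ • g.restrict {x | x i = b} + (1 - θ) • g.restrict {x | x i = b}
        = g.restrict {x | x i = b} := by
      rw [← add_smul, add_tsub_cancel_of_le hθ1, one_smul]
    calc g = g.restrict {x | x i < b} + g.restrict {x | x i < b}ᶜ :=
          (Measure.restrict_add_restrict_compl hL).symm
      _ = g.restrict {x | x i < b} + (θ • g.restrict {x | x i = b}
          + (1 - θ) • g.restrict {x | x i = b} + g.restrict {x | b < x i}) := by
          rw [hcompl, Measure.restrict_union hdisj2 hG, h1]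
      _ = _ := by abel
  · simp only [Measure.add_apply, Measure.smul_apply, Measure.restrict_apply_univ, smul_eq_mul]
    rw [hθE, add_tsub_cancel_of_le hm1]
  · rw [withDensity_indicator hL, ← restrict_withDensity hL]
    exact (Measure.restrict_mono le_rfl hrg).trans (Measure.le_add_right le_rfl)
  · rw [withDensity_indicator hL.compl, ← restrict_withDensity hL.compl, hcompl,
      Measure.restrict_union hdisj2 hG]
    have : (volume.withDensity r).restrict {x : En n | x i = b} = 0 := by
      rw [Measure.restrict_eq_zero]
      exact withDensity_absolutelyContinuous _ _ (volume_coord_eq i b)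
    rw [this, zero_add]
    exact (Measure.restrict_mono le_rfl hrg).trans (Measure.le_add_right le_rfl)
  · have aux : ∀ s : Set (En n), MeasurableSet s → s ⊆ {x | x i ≤ b} →
        g.restrict s (cbox l (Function.update u i b))ᶜ = 0 := by
      intro s hs hsub
      rw [Measure.restrict_apply (measurableSet_cbox _ _).compl]
      refine measure_mono_null (t := (cbox l u)ᶜ) ?_ hg
      rintro x ⟨hx1, hx2⟩ hx3
      refine hx1 fun j => ⟨(hx3 j).1, ?_⟩
      by_cases hj : j = i
      · subst hj; simpa using hsub hx2
      · simpa [hj] using (hx3 j).2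
    simp only [Measure.add_apply, Measure.smul_apply, smul_eq_mul]
    rw [aux _ hL (fun x (hx : x i < b) => hx.le), aux _ hE (fun x (hx : x i = b) => hx.le)]
    simp
  · have aux : ∀ s : Set (En n), MeasurableSet s → s ⊆ {x | b ≤ x i} →
        g.restrict s (cbox (Function.update l i b) u)ᶜ = 0 := by
      intro s hs hsub
      rw [Measure.restrict_apply (measurableSet_cbox _ _).compl]
      refine measure_mono_null (t := (cbox l u)ᶜ) ?_ hg
      rintro x ⟨hx1, hx2⟩ hx3
      refine hx1 fun j => ⟨?_, (hx3 j).2⟩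
      by_cases hj : j = i
      · subst hj; simpa using hsub hx2
      · simpa [hj] using (hx3 j).1
    simp only [Measure.add_apply, Measure.smul_apply, smul_eq_mul]
    rw [aux _ hG (fun x (hx : b < x i) => hx.le), aux _ hE (fun x (hx : x i = b) => hx.ge)]
    simp
  · rw [← lintegral_add_left ((hr.indicator hL).pow_const _)]
    refine lintegral_congr fun x => ?_
    by_cases hx : x ∈ {x : En n | x i < b}
    · rw [indicator_of_mem hx, indicator_of_notMem (by simpa using hx), ENNReal.zero_rpow_of_pos hα,
        add_zero]
    · rw [indicator_of_notMem hx, indicator_of_mem (by simpa using hx), ENNReal.zero_rpow_of_pos hα,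
        zero_add]

/-- The discrete displacement inequality on a pair of boxes. -/
def BoxTransport {n : ℕ} (β t E : ℝ) (ψ : En n → ℝ) (la ua lb ub : Fin n → ℝ) : Prop :=
  ∀ (f g : Measure (En n)) (rf rg : En n → ℝ≥0∞), IsFiniteMeasure f → IsFiniteMeasure g →
    Measurable rf → Measurable rg → volume.withDensity rf ≤ f → volume.withDensity rg ≤ g →
    f (cbox la ua)ᶜ = 0 → g (cbox lb ub)ᶜ = 0 → f univ = g univ →
    ∃ γ : Measure (En n × En n), γ.map Prod.fst = f ∧ γ.map Prod.snd = g ∧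
      ENNReal.ofReal (1 - 1 / β)⁻¹ * (ENNReal.ofReal (1 - t) * (∫⁻ x, rf x ^ (1 - 1 / β))
        + ENNReal.ofReal t * ∫⁻ x, rg x ^ (1 - 1 / β))
      ≤ (∫⁻ p, ENNReal.ofReal (ψ ((1 - t) • p.1 + t • p.2)) ∂γ)
        + (∫⁻ z in obox (fun i => (1 - t) * la i + t * lb i) (fun i => (1 - t) * ua i + t * ub i),
            ENNReal.ofReal ((β - 1)⁻¹ * ψ z ^ (1 - β)))
        + ENNReal.ofReal E * f univ

lemma obox_split {n : ℕ} (F : En n → ℝ≥0∞) (l u : Fin n → ℝ) (i : Fin n) (b : ℝ)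
    (hb1 : l i ≤ b) (hb2 : b ≤ u i) :
    (∫⁻ z in obox l (Function.update u i b), F z) + ∫⁻ z in obox (Function.update l i b) u, F z
      ≤ ∫⁻ z in obox l u, F z := by
  have hd : Disjoint (obox l (Function.update u i b)) (obox (Function.update l i b) u) := by
    refine Set.disjoint_left.2 fun x h1 h2 => ?_
    have h3 := (h1 i).2
    have h4 := (h2 i).1
    simp only [Function.update_self] at h3 h4
    exact lt_asymm h3 h4
  rw [← lintegral_union (measurableSet_obox _ _) hd]
  refine lintegral_mono_set (union_subset ?_ ?_)
  · intro x hx j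
    refine ⟨(hx j).1, ?_⟩
    have := (hx j).2
    by_cases hj : j = i
    · subst hj; simp only [Function.update_self] at this; exact this.trans_le hb2
    · simpa [hj] using this
  · intro x hx j
    refine ⟨?_, (hx j).2⟩
    have := (hx j).1
    by_cases hj : j = i
    · subst hj; simp only [Function.update_self] at this; exact hb1.trans_lt this
    · simpa [hj] using this

lemma BoxTransport.combine {n : ℕ} {β t E : ℝ} (hβ : 1 < β) (ht0 : 0 < t) (ht1 : t < 1)
    {ψ : En n → ℝ} {la ua lb ub : Fin n → ℝ} (i : Fin n)
    (hab : la i ≤ ua i) (hbb : lb i ≤ ub i)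
    (h : (∃ s ∈ Icc (la i) (ua i), ∀ b ∈ Icc (lb i) (ub i),
      BoxTransport β t E ψ la (Function.update ua i s) lb (Function.update ub i b) ∧
      BoxTransport β t E ψ (Function.update la i s) ua (Function.update lb i b) ub) ∨
      (∃ b ∈ Icc (lb i) (ub i), ∀ s ∈ Icc (la i) (ua i),
      BoxTransport β t E ψ la (Function.update ua i s) lb (Function.update ub i b) ∧
      BoxTransport β t E ψ (Function.update la i s) ua (Function.update lb i b) ub)) :
    BoxTransport β t E ψ la ua lb ub := by
  intro f g rf rg hff hgf hrf hrg hrff hrgg hfA hgB hmass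
  have hα : 0 < 1 - 1 / β := by
    rw [sub_pos, div_lt_one (by linarith)]; exact hβ
  obtain ⟨s, hs, b, hb, m, hm1, hm2, hm3, hm4, h1, h2⟩ : ∃ s ∈ Icc (la i) (ua i),
      ∃ b ∈ Icc (lb i) (ub i), ∃ m : ℝ≥0∞, f {x | x i < s} ≤ m ∧ m ≤ f {x | x i ≤ s} ∧
      g {x | x i < b} ≤ m ∧ m ≤ g {x | x i ≤ b} ∧
      BoxTransport β t E ψ la (Function.update ua i s) lb (Function.update ub i b) ∧
      BoxTransport β t E ψ (Function.update la i s) ua (Function.update lb i b) ub := by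
    rcases h with ⟨s, hs, h⟩ | ⟨b, hb, h⟩
    · obtain ⟨b, hb, h1, h2⟩ := exists_coord_quantile g hgB i hbb
        (m := f {x | x i ≤ s}) (by rw [← hmass]; exact measure_mono (subset_univ _))
      exact ⟨s, hs, b, hb, f {x | x i ≤ s}, measure_mono fun x (hx : x i < s) => hx.le, le_rfl,
        h1, h2, h b hb⟩
    · obtain ⟨s, hs, h1, h2⟩ := exists_coord_quantile f hfA i hab
        (m := g {x | x i ≤ b}) (by rw [hmass]; exact measure_mono (subset_univ _))
      exact ⟨s, hs, b, hb, g {x | x i ≤ b}, h1, h2,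
        measure_mono fun x (hx : x i < b) => hx.le, le_rfl, h s hs⟩
  obtain ⟨f₁, f₂, rf₁, rf₂, hf, hf1m, hrf1, hrf2, hrf1', hrf2', hf1s, hf2s, hfI⟩ :=
    exists_split hα f hrf hrff hfA i s hm1 hm2
  obtain ⟨g₁, g₂, rg₁, rg₂, hg, hg1m, hrg1, hrg2, hrg1', hrg2', hg1s, hg2s, hgI⟩ :=
    exists_split hα g hrg hrgg hgB i b hm3 hm4
  have hf1 : IsFiniteMeasure f₁ := isFiniteMeasure_of_le f (hf ▸ Measure.le_add_right le_rfl)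
  have hf2 : IsFiniteMeasure f₂ := isFiniteMeasure_of_le f (hf ▸ Measure.le_add_left le_rfl)
  have hg1 : IsFiniteMeasure g₁ := isFiniteMeasure_of_le g (hg ▸ Measure.le_add_right le_rfl)
  have hg2 : IsFiniteMeasure g₂ := isFiniteMeasure_of_le g (hg ▸ Measure.le_add_left le_rfl)
  have hfu : f univ = f₁ univ + f₂ univ := by rw [hf]; rfl
  have hgu : g univ = g₁ univ + g₂ univ := by rw [hg]; rfl
  have hmass2 : f₂ univ = g₂ univ := by
    rw [hfu, hgu, hf1m, hg1m] at hmass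
    refine (ENNReal.add_right_inj ?_).1 hmass
    rw [← hf1m]; exact measure_ne_top _ _
  obtain ⟨γ₁, hγ1f, hγ1g, hγ1⟩ := h1 f₁ g₁ rf₁ rg₁ hf1 hg1 hrf1 hrg1 hrf1' hrg1' hf1s hg1s
    (hf1m.trans hg1m.symm)
  obtain ⟨γ₂, hγ2f, hγ2g, hγ2⟩ := h2 f₂ g₂ rf₂ rg₂ hf2 hg2 hrf2 hrg2 hrf2' hrg2' hf2s hg2s hmass2
  refine ⟨γ₁ + γ₂, ?_, ?_, ?_⟩
  · rw [Measure.map_add _ _ measurable_fst, hγ1f, hγ2f, hf]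
  · rw [Measure.map_add _ _ measurable_snd, hγ1g, hγ2g, hg]
  have hO := obox_split (fun z => ENNReal.ofReal ((β - 1)⁻¹ * ψ z ^ (1 - β)))
    (fun i => (1 - t) * la i + t * lb i) (fun i => (1 - t) * ua i + t * ub i) i
    ((1 - t) * s + t * b)
    (by have := mul_le_mul_of_nonneg_left hs.1 (sub_pos.2 ht1).le
        have := mul_le_mul_of_nonneg_left hb.1 ht0.le
        linarith)
    (by have := mul_le_mul_of_nonneg_left hs.2 (sub_pos.2 ht1).le
        have := mul_le_mul_of_nonneg_left hb.2 ht0.le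
        linarith)
  have e1 : ∀ v w : Fin n → ℝ, (fun j => (1 - t) * Function.update v i s j
      + t * Function.update w i b j)
      = Function.update (fun j => (1 - t) * v j + t * w j) i ((1 - t) * s + t * b) := by
    intro v w
    ext j
    by_cases hj : j = i
    · subst hj; simp
    · simp [hj]
  rw [e1] at hγ1 hγ2
  rw [hfI, hgI, lintegral_add_measure, hfu]
  refine le_trans (le_of_eq (by ring)) ((add_le_add hγ1 hγ2).trans ?_)
  have key : ∀ a b o₁ o₂ o e v₁ v₂ : ℝ≥0∞, o₁ + o₂ ≤ o →
      a + o₁ + e * v₁ + (b + o₂ + e * v₂) ≤ a + b + o + e * (v₁ + v₂) := by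
    intro a b o₁ o₂ o e v₁ v₂ ho
    calc _ = a + b + (o₁ + o₂) + e * (v₁ + v₂) := by ring
      _ ≤ _ := by gcongr
  exact key _ _ _ _ _ _ _ _ hO

lemma ae_of_map_fst {X Y : Type*} [MeasurableSpace X] [MeasurableSpace Y] {γ : Measure (X × Y)}
    {f : Measure X} (h : γ.map Prod.fst = f) {A : Set X} (hA : MeasurableSet A) (hf : f Aᶜ = 0) :
    ∀ᵐ p ∂γ, p.1 ∈ A := by
  rw [← h, Measure.map_apply measurable_fst hA.compl] at hf
  exact hf

lemma ae_of_map_snd {X Y : Type*} [MeasurableSpace X] [MeasurableSpace Y] {γ : Measure (X × Y)}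
    {f : Measure Y} (h : γ.map Prod.snd = f) {A : Set Y} (hA : MeasurableSet A) (hf : f Aᶜ = 0) :
    ∀ᵐ p ∂γ, p.2 ∈ A := by
  rw [← h, Measure.map_apply measurable_snd hA.compl] at hf
  exact hf

lemma univ_of_map_fst {X Y : Type*} [MeasurableSpace X] [MeasurableSpace Y] {γ : Measure (X × Y)}
    {f : Measure X} (h : γ.map Prod.fst = f) : γ univ = f univ := by
  rw [← h, Measure.map_apply measurable_fst MeasurableSet.univ, preimage_univ]

lemma exists_coupling {X Y : Type*} [MeasurableSpace X] [MeasurableSpace Y] (f : Measure X)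
    (g : Measure Y) [IsFiniteMeasure f] [IsFiniteMeasure g] (h : f univ = g univ) :
    ∃ γ : Measure (X × Y), γ.map Prod.fst = f ∧ γ.map Prod.snd = g := by
  by_cases h0 : f univ = 0
  · refine ⟨0, ?_, ?_⟩
    · have hf : f = 0 := Measure.measure_univ_eq_zero.1 h0
      simp [hf]
    · have hg : g = 0 := Measure.measure_univ_eq_zero.1 (h ▸ h0)
      simp [hg]
  · refine ⟨(f univ)⁻¹ • f.prod g, ?_, ?_⟩
    · rw [Measure.map_smul, Measure.map_fst_prod, ← h, smul_smul,
        ENNReal.inv_mul_cancel h0 (measure_ne_top _ _), one_smul]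
    · rw [Measure.map_smul, Measure.map_snd_prod, smul_smul,
        ENNReal.inv_mul_cancel h0 (measure_ne_top _ _), one_smul]

lemma boxTransport_of_small {n : ℕ} {β t δ K : ℝ} (hn : 1 ≤ n) (hnβ : (n : ℝ) ≤ β) (hβ : 1 < β)
    (ht0 : 0 < t) (ht1 : t < 1) (hδ : 0 ≤ δ) (hK : 0 ≤ K) {ψ : En n → ℝ} (hψ0 : ∀ x, 0 < ψ x)
    (hψ : ∀ x y, (∀ i, |x i - y i| ≤ δ) → ψ x ≤ ψ y + K * δ)
    {la ua lb ub : Fin n → ℝ} (ha : ∀ i, la i ≤ ua i) (hb : ∀ i, lb i ≤ ub i)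
    (ha' : ∀ i, ua i ≤ la i + δ) (hb' : ∀ i, ub i ≤ lb i + δ) :
    BoxTransport β t (2 * K * δ) ψ la ua lb ub := by
  intro f g rf rg hff hgf hrf hrg hrff hrgg hfA hgB hmass
  have hβ0 : 0 < β := by linarith
  have hα : 0 < 1 - 1 / β := by
    rw [sub_pos, div_lt_one hβ0]; exact hβ
  have hα1 : 1 - 1 / β ≤ 1 := by
    have : 0 < 1 / β := by positivity
    linarith
  have h1α : 1 - (1 - 1 / β) = 1 / β := by ring
  have ht' : 0 < 1 - t := by linarith
  obtain ⟨γ, h1, h2⟩ := exists_coupling f g hmass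
  refine ⟨γ, h1, h2, ?_⟩
  set m := (f univ).toReal with hm
  have hm0 : 0 ≤ m := ENNReal.toReal_nonneg
  have hmf : f univ = ENNReal.ofReal m := (ENNReal.ofReal_toReal (measure_ne_top _ _)).symm
  have hmg : g univ = ENNReal.ofReal m := by rw [← hmass, hmf]
  set VA := ∏ i, (ua i - la i)
  set VB := ∏ i, (ub i - lb i)
  have hVA : 0 ≤ VA := Finset.prod_nonneg fun i _ => sub_nonneg.2 (ha i)
  have hVB : 0 ≤ VB := Finset.prod_nonneg fun i _ => sub_nonneg.2 (hb i)
  have hIf : ∫⁻ x, rf x ^ (1 - 1 / β) ≤ ENNReal.ofReal (m ^ (1 - 1 / β) * VA ^ (1 / β)) := by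
    refine (lintegral_rpow_le_holder hα hα1 hrf (measurableSet_cbox la ua) hrff hfA).trans ?_
    rw [hmf, volume_cbox _ _ ha, h1α, ENNReal.ofReal_rpow_of_nonneg hm0 hα.le,
      ENNReal.ofReal_rpow_of_nonneg hVA (by positivity), ENNReal.ofReal_mul (by positivity)]
  have hIg : ∫⁻ x, rg x ^ (1 - 1 / β) ≤ ENNReal.ofReal (m ^ (1 - 1 / β) * VB ^ (1 / β)) := by
    refine (lintegral_rpow_le_holder hα hα1 hrg (measurableSet_cbox lb ub) hrgg hgB).trans ?_
    rw [hmg, volume_cbox _ _ hb, h1α, ENNReal.ofReal_rpow_of_nonneg hm0 hα.le,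
      ENNReal.ofReal_rpow_of_nonneg hVB (by positivity), ENNReal.ofReal_mul (by positivity)]
  set lc : Fin n → ℝ := fun i => (1 - t) * la i + t * lb i with hlc
  set uc : Fin n → ℝ := fun i => (1 - t) * ua i + t * ub i with huc
  have hc : ∀ i, lc i ≤ uc i := fun i => by
    have := ha i; have := hb i; simp only [hlc, huc]; gcongr
  have hc' : ∀ i, uc i ≤ lc i + δ := fun i => by
    have h1 := mul_le_mul_of_nonneg_left (ha' i) ht'.le
    have h2 := mul_le_mul_of_nonneg_left (hb' i) ht0.le
    simp only [hlc, huc]; nlinarith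
  set VC := ∏ i, (uc i - lc i) with hVC
  have hVC0 : 0 ≤ VC := Finset.prod_nonneg fun i _ => sub_nonneg.2 (hc i)
  have hBM : (1 - t) * VA ^ (1 / β) + t * VB ^ (1 / β) ≤ VC ^ (1 / β) := by
    refine (prod_rpow_concave hn hnβ ht0 ht1 _ _ (fun i => sub_nonneg.2 (ha i))
      (fun i => sub_nonneg.2 (hb i))).trans (le_of_eq ?_)
    congr 1
    exact Finset.prod_congr rfl fun i _ => by simp only [hlc, huc]; ring
  set z₀ : En n := WithLp.toLp 2 lc
  set s := ψ z₀ + K * δ with hs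
  have hs0 : 0 < s := by have := hψ0 z₀; positivity
  have hVol : ENNReal.ofReal ((β - 1)⁻¹ * s ^ (1 - β) * VC)
      ≤ ∫⁻ z in obox lc uc, ENNReal.ofReal ((β - 1)⁻¹ * ψ z ^ (1 - β)) := by
    have hβ' : 0 < (β - 1)⁻¹ := inv_pos.2 (by linarith)
    rw [ENNReal.ofReal_mul (by positivity), ← volume_obox _ _ hc, ← setLIntegral_const]
    refine setLIntegral_mono' (measurableSet_obox _ _) fun z hz => ENNReal.ofReal_le_ofReal ?_
    refine mul_le_mul_of_nonneg_left ?_ hβ'.le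
    refine Real.rpow_le_rpow_of_nonpos (hψ0 z) (hψ z z₀ fun i => ?_) (by linarith)
    have h3 := (hz i).1
    have h4 := (hz i).2
    have h5 := hc' i
    rw [abs_le]
    constructor <;> simp only [z₀] <;> linarith
  have hInt : ENNReal.ofReal (s * m) ≤ (∫⁻ p, ENNReal.ofReal (ψ ((1 - t) • p.1 + t • p.2)) ∂γ)
      + ENNReal.ofReal (2 * K * δ) * f univ := by
    rw [ENNReal.ofReal_mul hs0.le, ← hmf, ← univ_of_map_fst h1, ← lintegral_const,
      ← lintegral_const, ← lintegral_add_right _ measurable_const]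
    refine lintegral_mono_ae ?_
    filter_upwards [ae_of_map_fst h1 (measurableSet_cbox la ua) hfA,
      ae_of_map_snd h2 (measurableSet_cbox lb ub) hgB] with p hp1 hp2
    rw [← ENNReal.ofReal_add (hψ0 _).le (by positivity)]
    refine ENNReal.ofReal_le_ofReal ?_
    have := hψ z₀ ((1 - t) • p.1 + t • p.2) fun i => ?_
    · rw [hs]; linarith
    have h3 := hc' i
    have h4 := mul_le_mul_of_nonneg_left (hp1 i).1 ht'.le
    have h5 := mul_le_mul_of_nonneg_left (hp2 i).1 ht0.le
    have h6 := mul_le_mul_of_nonneg_left (hp1 i).2 ht'.le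
    have h7 := mul_le_mul_of_nonneg_left (hp2 i).2 ht0.le
    simp only [hlc, huc] at h3
    rw [abs_le]
    constructor <;> simp only [z₀, hlc, PiLp.add_apply, PiLp.smul_apply, smul_eq_mul] <;> linarith
  calc _ ≤ ENNReal.ofReal (1 - 1 / β)⁻¹ * (ENNReal.ofReal (1 - t) *
        ENNReal.ofReal (m ^ (1 - 1 / β) * VA ^ (1 / β)) + ENNReal.ofReal t *
        ENNReal.ofReal (m ^ (1 - 1 / β) * VB ^ (1 / β))) := by gcongr
    _ = ENNReal.ofReal ((1 - 1 / β)⁻¹ * (m ^ (1 - 1 / β) *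
        ((1 - t) * VA ^ (1 / β) + t * VB ^ (1 / β)))) := by
      rw [← ENNReal.ofReal_mul ht'.le, ← ENNReal.ofReal_mul ht0.le,
        ← ENNReal.ofReal_add (by positivity) (by positivity),
        ← ENNReal.ofReal_mul (by positivity)]
      congr 1; ring
    _ ≤ ENNReal.ofReal ((1 - 1 / β)⁻¹ * (m ^ (1 - 1 / β) * VC ^ (1 / β))) := by gcongr
    _ ≤ ENNReal.ofReal (s * m + (β - 1)⁻¹ * s ^ (1 - β) * VC) :=
      ENNReal.ofReal_le_ofReal (young_power hβ hs0 hm0 hVC0)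
    _ ≤ ENNReal.ofReal (s * m) + ENNReal.ofReal ((β - 1)⁻¹ * s ^ (1 - β) * VC) :=
      ENNReal.ofReal_add_le
    _ ≤ _ := add_le_add hInt hVol
    _ = _ := by rw [add_right_comm]

lemma boxTransport_of_pow {n : ℕ} {β t δ K : ℝ} (hn : 1 ≤ n) (hnβ : (n : ℝ) ≤ β) (hβ : 1 < β)
    (ht0 : 0 < t) (ht1 : t < 1) (hδ : 0 ≤ δ) (hK : 0 ≤ K) {ψ : En n → ℝ} (hψ0 : ∀ x, 0 < ψ x)
    (hψ : ∀ x y, (∀ i, |x i - y i| ≤ δ) → ψ x ≤ ψ y + K * δ) (N : ℕ) :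
    ∀ (a b : Fin n → ℕ) (la ua lb ub : Fin n → ℝ), (∑ i, a i) + (∑ i, b i) = N →
      (∀ i, la i ≤ ua i) → (∀ i, lb i ≤ ub i) →
      (∀ i, ua i ≤ la i + 2 ^ a i * δ) → (∀ i, ub i ≤ lb i + 2 ^ b i * δ) →
      BoxTransport β t (2 * K * δ) ψ la ua lb ub := by
  have side : ∀ (i : Fin n) (l u : Fin n → ℝ) (v : ℝ), v ∈ Icc (l i) (u i) → (∀ j, l j ≤ u j) →
      (∀ j, l j ≤ Function.update u i v j) ∧ (∀ j, Function.update l i v j ≤ u j) := by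
    intro i l u v hv h
    refine ⟨fun j => ?_, fun j => ?_⟩
    · by_cases hj : j = i
      · subst hj; simpa using hv.1
      · simpa [hj] using h j
    · by_cases hj : j = i
      · subst hj; simpa using hv.2
      · simpa [hj] using h j
  have mid : ∀ (a : Fin n → ℕ) (i : Fin n) (k : ℕ) (l u : Fin n → ℝ), a i = k + 1 →
      (∀ j, u j ≤ l j + 2 ^ a j * δ) →
      (∀ j, Function.update u i ((l i + u i) / 2) j ≤ l j + 2 ^ Function.update a i k j * δ) ∧
      (∀ j, u j ≤ Function.update l i ((l i + u i) / 2) j + 2 ^ Function.update a i k j * δ) := by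
    intro a i k l u hk h
    have hi := h i
    rw [hk, pow_succ] at hi
    refine ⟨fun j => ?_, fun j => ?_⟩
    · by_cases hj : j = i
      · subst hj; simp only [Function.update_self]; linarith
      · simpa [hj] using h j
    · by_cases hj : j = i
      · subst hj; simp only [Function.update_self]; linarith
      · simpa [hj] using h j
  have trivb : ∀ (a : Fin n → ℕ) (i : Fin n) (l u : Fin n → ℝ) (v : ℝ), v ∈ Icc (l i) (u i) →
      (∀ j, u j ≤ l j + 2 ^ a j * δ) →
      (∀ j, Function.update u i v j ≤ l j + 2 ^ a j * δ) ∧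
      (∀ j, u j ≤ Function.update l i v j + 2 ^ a j * δ) := by
    intro a i l u v hv h
    refine ⟨fun j => ?_, fun j => ?_⟩
    · by_cases hj : j = i
      · subst hj; simpa using hv.2.trans (h j)
      · simpa [hj] using h j
    · by_cases hj : j = i
      · subst hj; simp only [Function.update_self]; linarith [h j, hv.1]
      · simpa [hj] using h j
  have hsum : ∀ (a : Fin n → ℕ) (i : Fin n) (k : ℕ), a i = k + 1 →
      ∑ j, a j = ∑ j, Function.update a i k j + 1 := by
    intro a i k h
    rw [← Finset.add_sum_erase _ _ (Finset.mem_univ i),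
      ← Finset.add_sum_erase _ (Function.update a i k) (Finset.mem_univ i), h]
    have : ∑ x ∈ Finset.univ.erase i, Function.update a i k x = ∑ x ∈ Finset.univ.erase i, a x :=
      Finset.sum_congr rfl fun x hx => by simp [Finset.ne_of_mem_erase hx]
    rw [this]; simp; ring
  induction N with
  | zero =>
    intro a b la ua lb ub hN ha hb ha' hb'
    have h0 : (∀ i, a i = 0) ∧ ∀ i, b i = 0 := by
      simpa using hN
    refine boxTransport_of_small hn hnβ hβ ht0 ht1 hδ hK hψ0 hψ ha hb (fun i => ?_) fun i => ?_
    · simpa [h0.1 i] using ha' i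
    · simpa [h0.2 i] using hb' i
  | succ N ih =>
    intro a b la ua lb ub hN ha hb ha' hb'
    by_cases hA : ∃ i, a i ≠ 0
    · obtain ⟨i, hi⟩ := hA
      obtain ⟨k, hk⟩ := Nat.exists_eq_succ_of_ne_zero hi
      have hs : (la i + ua i) / 2 ∈ Icc (la i) (ua i) := by
        constructor <;> linarith [ha i]
      refine BoxTransport.combine hβ ht0 ht1 i (ha i) (hb i) (Or.inl ⟨_, hs, fun v hv => ?_⟩)
      have hS : (∑ j, Function.update a i k j) + ∑ j, b j = N := by
        have := hsum a i k hk; omega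
      exact ⟨ih _ _ _ _ _ _ hS (side i _ _ _ hs ha).1 (side i _ _ _ hv hb).1
          (mid a i k _ _ hk ha').1 (trivb b i _ _ _ hv hb').1,
        ih _ _ _ _ _ _ hS (side i _ _ _ hs ha).2 (side i _ _ _ hv hb).2
          (mid a i k _ _ hk ha').2 (trivb b i _ _ _ hv hb').2⟩
    · by_cases hB : ∃ i, b i ≠ 0
      · obtain ⟨i, hi⟩ := hB
        obtain ⟨k, hk⟩ := Nat.exists_eq_succ_of_ne_zero hi
        have hs : (lb i + ub i) / 2 ∈ Icc (lb i) (ub i) := by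
          constructor <;> linarith [hb i]
        refine BoxTransport.combine hβ ht0 ht1 i (ha i) (hb i) (Or.inr ⟨_, hs, fun v hv => ?_⟩)
        have hS : (∑ j, a j) + ∑ j, Function.update b i k j = N := by
          have := hsum b i k hk; omega
        exact ⟨ih _ _ _ _ _ _ hS (side i _ _ _ hv ha).1 (side i _ _ _ hs hb).1
            (trivb a i _ _ _ hv ha').1 (mid b i k _ _ hk hb').1,
          ih _ _ _ _ _ _ hS (side i _ _ _ hv ha).2 (side i _ _ _ hs hb).2
            (trivb a i _ _ _ hv ha').2 (mid b i k _ _ hk hb').2⟩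
      · push Not at hA hB
        simp [hA, hB] at hN

/-- The discrete displacement inequality with an error controlled by the mesh `δ`. -/
lemma boxTransport {n : ℕ} {β t δ K : ℝ} (hn : 1 ≤ n) (hnβ : (n : ℝ) ≤ β) (hβ : 1 < β)
    (ht0 : 0 < t) (ht1 : t < 1) (hδ : 0 < δ) (hK : 0 ≤ K) {ψ : En n → ℝ} (hψ0 : ∀ x, 0 < ψ x)
    (hψ : ∀ x y, (∀ i, |x i - y i| ≤ δ) → ψ x ≤ ψ y + K * δ)
    {la ua lb ub : Fin n → ℝ} (ha : ∀ i, la i ≤ ua i) (hb : ∀ i, lb i ≤ ub i) :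
    BoxTransport β t (2 * K * δ) ψ la ua lb ub := by
  have key : ∀ r : ℝ, ∃ k : ℕ, r ≤ 2 ^ k * δ := by
    intro r
    obtain ⟨k, hk⟩ := pow_unbounded_of_one_lt (r / δ) (one_lt_two)
    exact ⟨k, (div_le_iff₀ hδ).1 hk.le⟩
  choose a ha' using fun i => key (ua i - la i)
  choose b hb' using fun i => key (ub i - lb i)
  exact boxTransport_of_pow hn hnβ hβ ht0 ht1 hδ.le hK hψ0 hψ _ a b _ _ _ _ rfl ha hb
    (fun i => by linarith [ha' i]) fun i => by linarith [hb' i]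

lemma integrable_rpow_of_growth {n : ℕ} {a s : ℝ} (ha : 0 < a) (hs : (n : ℝ) < s) {ψ : En n → ℝ}
    (hψm : Measurable ψ) (hψ : ∀ x, a * (1 + ‖x‖) ≤ ψ x) :
    Integrable (fun x => ψ x ^ (-s)) := by
  have h := integrable_one_add_norm (E := En n) (μ := volume) (r := s) (by simpa using hs)
  refine (h.const_mul (a ^ (-s))).mono' (hψm.pow_const _).aestronglyMeasurable
    (ae_of_all _ fun x => ?_)
  have h0 : 0 < a * (1 + ‖x‖) := by positivity
  have hs0 : 0 ≤ s := le_trans (Nat.cast_nonneg n) hs.le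
  rw [Real.norm_of_nonneg (Real.rpow_nonneg (h0.le.trans (hψ x)) _),
    ← Real.mul_rpow ha.le (by positivity)]
  exact Real.rpow_le_rpow_of_nonpos h0 (hψ x) (by linarith)

/-- Uniform first order expansion of a Lipschitz function, in an integrated sense. -/
lemma exists_difference_quotient_error {n : ℕ} {ψ : En n → ℝ} {L : NNReal}
    (hL : LipschitzWith L ψ) {p : En n → En n} (hpm : Measurable p) (hpL : ∀ x, ‖p x‖ ≤ L)
    (hp : ∀ᵐ x, HasGradientAt ψ (p x) x) {R : ℝ} (hR : 0 ≤ R) {w : En n → ℝ≥0∞}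
    (hw : Measurable w) (hwi : ∫⁻ x, ENNReal.ofReal (2 * L * (‖x‖ + R)) * w x ≠ ∞) {ε : ℝ≥0∞}
    (hε : 0 < ε) :
    ∃ t : ℝ, 0 < t ∧ t < 1 ∧ ∃ e : En n → ℝ≥0∞, Measurable e ∧
      (∀ x y, ‖y‖ ≤ R →
        ENNReal.ofReal ((ψ ((1 - t) • x + t • y) - ψ x) / t - ⟪p x, y - x⟫) ≤ e x) ∧
      (∀ x, e x ≤ ENNReal.ofReal (2 * L * (‖x‖ + R))) ∧ ∫⁻ x, e x * w x ≤ ε := by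
  have : Nonempty (Metric.closedBall (0 : En n) R) := ⟨⟨0, by simpa using hR⟩⟩
  set d : ℕ → Metric.closedBall (0 : En n) R := TopologicalSpace.denseSeq _ with hd
  set q : ℝ → En n → En n → ℝ := fun t x y =>
    (ψ ((1 - t) • x + t • y) - ψ x) / t - ⟪p x, y - x⟫ with hq
  set e : ℝ → En n → ℝ≥0∞ := fun t x => ⨆ j, ENNReal.ofReal (q t x (d j)) with he
  have hψm : Measurable ψ := hL.continuous.measurable
  have hem : ∀ t, Measurable (e t) := fun t => by
    refine Measurable.iSup fun j => ENNReal.measurable_ofReal.comp ?_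
    simp only [hq]
    refine Measurable.sub (((hψm.comp (by fun_prop)).sub hψm).div_const _) ?_
    exact hpm.inner (by fun_prop)
  have hnorm : ∀ (x y : En n), ‖y‖ ≤ R → ‖y - x‖ ≤ ‖x‖ + R := fun x y hy =>
    (norm_sub_le _ _).trans (by linarith)
  have hZ : ∀ (t : ℝ) (x y : En n), (1 - t) • x + t • y = x + t • (y - x) := fun t x y => by
    module
  have hqle : ∀ t, 0 < t → ∀ x y, ‖y‖ ≤ R → q t x y ≤ 2 * L * (‖x‖ + R) := by
    intro t ht x y hy
    have h1 : (ψ ((1 - t) • x + t • y) - ψ x) / t ≤ L * ‖y - x‖ := by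
      rw [div_le_iff₀ ht, hZ]
      have := hL.dist_le_mul (x + t • (y - x)) x
      rw [Real.dist_eq, dist_eq_norm, add_sub_cancel_left, norm_smul, Real.norm_of_nonneg ht.le]
        at this
      linarith [le_abs_self (ψ (x + t • (y - x)) - ψ x)]
    have h2 : -⟪p x, y - x⟫ ≤ L * ‖y - x‖ := by
      refine (neg_le_abs _).trans ((abs_real_inner_le_norm _ _).trans ?_)
      exact mul_le_mul_of_nonneg_right (hpL x) (norm_nonneg _)
    have h3 : (L : ℝ) * ‖y - x‖ ≤ L * (‖x‖ + R) :=
      mul_le_mul_of_nonneg_left (hnorm x y hy) L.2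
    simp only [hq]; linarith
  have hele : ∀ t, 0 < t → ∀ x, e t x ≤ ENNReal.ofReal (2 * L * (‖x‖ + R)) := fun t ht x =>
    iSup_le fun j => ENNReal.ofReal_le_ofReal
      (hqle t ht x _ (mem_closedBall_zero_iff.1 (d j).2))
  have hsup : ∀ t x y, ‖y‖ ≤ R → ENNReal.ofReal (q t x y) ≤ e t x := by
    intro t x y hy
    have hcont : Continuous fun y : Metric.closedBall (0 : En n) R => ENNReal.ofReal (q t x y) := by
      refine ENNReal.continuous_ofReal.comp ?_
      simp only [hq]
      have := hL.continuous
      fun_prop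
    exact (TopologicalSpace.denseRange_denseSeq (Metric.closedBall (0 : En n) R)).induction_on
      (p := fun y => ENNReal.ofReal (q t x y) ≤ e t x) ⟨y, mem_closedBall_zero_iff.2 hy⟩
      (isClosed_le hcont continuous_const) fun j =>
        le_iSup (fun j => ENNReal.ofReal (q t x (d j))) j
  set τ : ℕ → ℝ := fun k => 1 / ((k : ℝ) + 2) with hτ
  have hτ0 : ∀ k, 0 < τ k := fun k => by simp only [hτ]; positivity
  have hτ1 : ∀ k, τ k < 1 := fun k => by
    simp only [hτ]; rw [div_lt_one (by positivity)]; linarith [(Nat.cast_nonneg k : (0:ℝ) ≤ k)]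
  have hτt : Tendsto τ atTop (𝓝 0) := by
    have := tendsto_one_div_add_atTop_nhds_zero_nat (𝕜 := ℝ)
    have h2 := (tendsto_add_atTop_iff_nat 1).2 this
    refine h2.congr fun k => ?_
    simp only [hτ]; push_cast; ring_nf
  have hlim : ∀ x, HasGradientAt ψ (p x) x → Tendsto (fun k => e (τ k) x) atTop (𝓝 0) := by
    intro x hx
    rw [ENNReal.tendsto_nhds_zero]
    intro ε' hε'
    obtain ⟨η, hη0, hη⟩ : ∃ η : ℝ, 0 < η ∧ ENNReal.ofReal (η * (‖x‖ + R)) ≤ ε' := by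
      by_cases hT : ε' = ∞
      · exact ⟨1, one_pos, by simp [hT]⟩
      · have h0 : 0 < ε'.toReal := ENNReal.toReal_pos hε'.ne' hT
        refine ⟨ε'.toReal / (‖x‖ + R + 1), by positivity, ?_⟩
        rw [← ENNReal.ofReal_toReal hT, ENNReal.toReal_ofReal h0.le]
        refine ENNReal.ofReal_le_ofReal ?_
        rw [div_mul_eq_mul_div, div_le_iff₀ (by positivity)]
        exact mul_le_mul_of_nonneg_left (by linarith) h0.le
    have h1 := (hasGradientAt_iff_isLittleO.1 hx).def hη0
    rw [Metric.eventually_nhds_iff] at h1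
    obtain ⟨r, hr0, hr⟩ := h1
    have h2 : ∀ᶠ k in atTop, τ k * (‖x‖ + R) < r := by
      have := hτt.mul_const (‖x‖ + R)
      rw [zero_mul] at this
      exact this.eventually_lt_const hr0
    filter_upwards [h2] with k hk
    refine iSup_le fun j => (ENNReal.ofReal_le_ofReal ?_).trans hη
    have hj : ‖(d j : En n)‖ ≤ R := mem_closedBall_zero_iff.1 (d j).2
    have hn1 : ‖τ k • ((d j : En n) - x)‖ ≤ τ k * (‖x‖ + R) := by
      rw [norm_smul, Real.norm_of_nonneg (hτ0 k).le]
      exact mul_le_mul_of_nonneg_left (hnorm x _ hj) (hτ0 k).le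
    have h3 := hr (y := x + τ k • ((d j : En n) - x)) (by
      rw [dist_eq_norm, add_sub_cancel_left]; exact hn1.trans_lt hk)
    rw [add_sub_cancel_left, Real.norm_eq_abs] at h3
    have h4 := (le_abs_self _).trans (h3.trans (mul_le_mul_of_nonneg_left hn1 hη0.le))
    rw [inner_smul_right] at h4
    simp only [hq]
    rw [hZ, sub_le_iff_le_add, div_le_iff₀ (hτ0 k)]
    nlinarith
  have hconv := tendsto_lintegral_of_dominated_convergence
    (F := fun k x => e (τ k) x * w x) (f := fun _ => 0) (μ := volume)
    (fun x => ENNReal.ofReal (2 * L * (‖x‖ + R)) * w x) (fun k => (hem _).mul hw)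
    (fun k => ae_of_all _ fun x => mul_le_mul_left (hele _ (hτ0 k) x) _) hwi (by
      have hwt : ∀ᵐ x, ENNReal.ofReal (2 * L * (‖x‖ + R)) * w x < ∞ := 
        ae_lt_top (by fun_prop) hwi
      filter_upwards [hp, hwt] with x hx hx2
      by_cases h0 : w x = ∞
      · rw [h0] at hx2
        have h00 : ENNReal.ofReal (2 * L * (‖x‖ + R)) = 0 := by
          by_contra hne
          rw [ENNReal.mul_top hne] at hx2
          exact lt_irrefl _ hx2
        have : ∀ k, e (τ k) x = 0 := fun k => by
          have := hele _ (hτ0 k) x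
          rw [h00] at this
          exact le_antisymm this zero_le
        simp [this]
      · have := ENNReal.Tendsto.mul_const (hlim x hx) (b := w x) (Or.inr h0)
        simpa using this)
  rw [lintegral_zero] at hconv
  obtain ⟨k, hk⟩ := ((ENNReal.tendsto_nhds_zero.1 hconv) ε hε).exists
  exact ⟨τ k, hτ0 k, hτ1 k, e (τ k), hem _, fun x y hy => hsup _ x y hy, hele _ (hτ0 k), hk⟩

lemma norm_le_sqrt_mul_of_abs_le {n : ℕ} {x : En n} {c : ℝ} (hc : 0 ≤ c) (h : ∀ i, |x i| ≤ c) :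
    ‖x‖ ≤ √n * c := by
  rw [EuclideanSpace.norm_eq, ← Real.sqrt_sq hc, ← Real.sqrt_mul (Nat.cast_nonneg n)]
  refine Real.sqrt_le_sqrt ?_
  calc ∑ i, ‖x i‖ ^ 2 ≤ ∑ _i : Fin n, c ^ 2 :=
        Finset.sum_le_sum fun i _ => pow_le_pow_left₀ (norm_nonneg _) (h i) 2
    _ = n * c ^ 2 := by simp

/-- The cube of half-side `N` centered at the origin. -/
def cube (n : ℕ) (N : ℝ) : Set (En n) := cbox (fun _ => -N) fun _ => N

lemma measurableSet_cube (n : ℕ) (N : ℝ) : MeasurableSet (cube n N) := measurableSet_cbox _ _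

lemma mem_cube {n : ℕ} {N : ℝ} {x : En n} : x ∈ cube n N ↔ ∀ i, |x i| ≤ N := by
  simp only [cube, cbox, mem_ofPred_eq, abs_le]

lemma monotone_cube (n : ℕ) : Monotone (cube n) := fun _ _ h _ hx =>
  mem_cube.2 fun i => (mem_cube.1 hx i).trans h

lemma iUnion_cube (n : ℕ) : ⋃ k : ℕ, cube n k = univ := by
  refine eq_univ_of_forall fun x => mem_iUnion.2 ?_
  obtain ⟨k, hk⟩ := exists_nat_ge ‖x‖
  exact ⟨k, mem_cube.2 fun i => (PiLp.norm_apply_le x i).trans hk⟩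

lemma norm_le_of_mem_cube {n : ℕ} {N : ℝ} (hN : 0 ≤ N) {x : En n} (hx : x ∈ cube n N) :
    ‖x‖ ≤ √n * N := norm_le_sqrt_mul_of_abs_le hN (mem_cube.1 hx)

/-- The measure with density `ψ ^ (-β)`. -/
def powMeasure {n : ℕ} (β : ℝ) (ψ : En n → ℝ) : Measure (En n) :=
  volume.withDensity fun x => ENNReal.ofReal (ψ x ^ (-β))

lemma isFiniteMeasure_powMeasure {n : ℕ} {a β : ℝ} (ha : 0 < a) (hβ : (n : ℝ) < β) {ψ : En n → ℝ}
    (hψm : Measurable ψ) (hψ : ∀ x, a * (1 + ‖x‖) ≤ ψ x) : IsFiniteMeasure (powMeasure β ψ) :=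
  isFiniteMeasure_withDensity_ofReal (integrable_rpow_of_growth ha hβ hψm hψ).2

lemma lipschitz_plan {n : ℕ} {β a R ε : ℝ} (hn : 1 ≤ n) (hβ : (n : ℝ) + 1 < β) (ha : 0 < a)
    (hR : 0 ≤ R) (hε : 0 < ε) {ψ : En n → ℝ} {L : NNReal} (hL : LipschitzWith L ψ)
    (hψ : ∀ x, a * (1 + ‖x‖) ≤ ψ x) {p : En n → En n} (hpm : Measurable p) (hpL : ∀ x, ‖p x‖ ≤ L)
    (hp : ∀ᵐ x, HasGradientAt ψ (p x) x) (ρ : Measure (En n)) [IsProbabilityMeasure ρ]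
    (hρ : ρ (cube n R)ᶜ = 0) {r : En n → ℝ≥0∞} (hr : Measurable r)
    (hrρ : volume.withDensity r ≤ ρ) (N₀ : ℕ) :
    ∃ N ≥ N₀, ∃ γ : Measure (En n × En n),
      γ.map Prod.fst = (powMeasure β ψ).restrict (cube n N) ∧
      γ.map Prod.snd = powMeasure β ψ (cube n N) • ρ ∧
      Integrable (fun z : En n × En n => ⟪p z.1, z.2 - z.1⟫) γ ∧
      (1 - 1 / β)⁻¹ * ((powMeasure β ψ (cube n N)).toReal ^ (1 - 1 / β) *
        (∫⁻ x, r x ^ (1 - 1 / β)).toReal - ∫ x, ψ x ^ (1 - β))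
        ≤ (∫ z, ⟪p z.1, z.2 - z.1⟫ ∂γ) + ε := by
  have hn' : (1 : ℝ) ≤ n := by exact_mod_cast hn
  have hβ1 : 1 < β := by linarith
  have hβ0 : 0 < β := by linarith
  have hα : 0 < 1 - 1 / β := by
    rw [sub_pos, div_lt_one hβ0]; exact hβ1
  have hψm : Measurable ψ := hL.continuous.measurable
  have hψ0 : ∀ x, 0 < ψ x := fun x => lt_of_lt_of_le (by positivity) (hψ x)
  have hW : Integrable (fun x => ψ x ^ (1 - β)) := by
    have := integrable_rpow_of_growth (s := β - 1) ha (by linarith) hψm hψ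
    simpa using this
  have hfin : IsFiniteMeasure (powMeasure β ψ) :=
    isFiniteMeasure_powMeasure ha (by linarith) hψm hψ
  set R' := √n * R with hR'
  have hR'0 : 0 ≤ R' := by positivity
  have hdens : Measurable fun x => ENNReal.ofReal (ψ x ^ (-β)) := (hψm.pow_const _).ennreal_ofReal
  have hmul : ∀ x, ψ x * ψ x ^ (-β) = ψ x ^ (1 - β) := fun x => by
    rw [sub_eq_add_neg, Real.rpow_add (hψ0 x), Real.rpow_one]
  have hwi : ∫⁻ x, ENNReal.ofReal (2 * L * (‖x‖ + R')) * ENNReal.ofReal (ψ x ^ (-β)) ≠ ∞ := by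
    refine ne_top_of_le_ne_top (hW.const_mul (2 * L * (1 + R') / a)).lintegral_lt_top.ne
      (lintegral_mono fun x => ?_)
    rw [← ENNReal.ofReal_mul (by positivity)]
    refine ENNReal.ofReal_le_ofReal ?_
    rw [← hmul, ← mul_assoc]
    refine mul_le_mul_of_nonneg_right ?_ (Real.rpow_nonneg (hψ0 x).le _)
    calc 2 * (L : ℝ) * (‖x‖ + R') ≤ 2 * L * ((1 + R') / a * (a * (1 + ‖x‖))) := by
          refine mul_le_mul_of_nonneg_left ?_ (by positivity)
          rw [← mul_assoc, div_mul_cancel₀ _ ha.ne']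
          nlinarith [norm_nonneg x, mul_nonneg hR'0 (norm_nonneg x)]
      _ ≤ 2 * L * ((1 + R') / a * ψ x) := by gcongr; exact hψ x
      _ = _ := by ring
  obtain ⟨t, ht0, ht1, e, hem, hesup, heb, heI⟩ := exists_difference_quotient_error hL hpm hpL hp
    hR'0 hdens hwi (ε := ENNReal.ofReal (ε / 3)) (by simpa using hε)
  have ht' : 0 < 1 - t := by linarith
  set W := ∫ x, ψ x ^ (1 - β) with hWdef
  obtain ⟨N, hNN, hN⟩ : ∃ N ≥ N₀, (β - 1)⁻¹ * (W - ∫ x in cube n N, ψ x ^ (1 - β)) ≤ t * ε / 3 := by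
    have h1 := tendsto_setIntegral_of_monotone (μ := volume) (s := fun k : ℕ => cube n k)
      (f := fun x => ψ x ^ (1 - β)) (fun k => measurableSet_cube n _)
      (fun i j h => monotone_cube n (by exact_mod_cast h)) hW.integrableOn
    rw [iUnion_cube, setIntegral_univ] at h1
    have h2 := (h1.const_sub W).const_mul (β - 1)⁻¹
    rw [sub_self, mul_zero] at h2
    have h3 := (h2.eventually_lt_const (by positivity : 0 < t * ε / 3)).and (eventually_ge_atTop N₀)
    obtain ⟨N, h4, h5⟩ := h3.exists
    exact ⟨N, h5, h4.le⟩
  set WN := ∫ x in cube n N, ψ x ^ (1 - β) with hWN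
  set M := (powMeasure β ψ (cube n N)).toReal with hM
  have hM0 : 0 ≤ M := ENNReal.toReal_nonneg
  have hMof : powMeasure β ψ (cube n N) = ENNReal.ofReal M :=
    (ENNReal.ofReal_toReal (measure_ne_top _ _)).symm
  set K : ℝ := L * √n with hK
  have hK0 : 0 ≤ K := by positivity
  obtain ⟨δ, hδ0, hδ⟩ : ∃ δ : ℝ, 0 < δ ∧ 2 * K * δ * M ≤ t * ε / 3 := by
    refine ⟨t * ε / 3 / (2 * K * M + 1), by positivity, ?_⟩
    rw [show 2 * K * (t * ε / 3 / (2 * K * M + 1)) * M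
      = t * ε / 3 * (2 * K * M) / (2 * K * M + 1) by ring, div_le_iff₀ (by positivity)]
    exact mul_le_mul_of_nonneg_left (by linarith) (by positivity)
  have hbox := boxTransport (n := n) (β := β) (t := t) (δ := δ) (K := K) hn (by linarith) hβ1 ht0
    ht1 hδ0 hK0 hψ0 (fun x y hxy => by
      have h1 := hL.dist_le_mul x y
      rw [Real.dist_eq, dist_eq_norm] at h1
      have h2 : ‖x - y‖ ≤ √n * δ := norm_le_sqrt_mul_of_abs_le hδ0.le hxy
      have h3 : (L : ℝ) * ‖x - y‖ ≤ L * (√n * δ) := mul_le_mul_of_nonneg_left h2 L.2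
      rw [hK]
      linarith [le_abs_self (ψ x - ψ y)])
    (la := fun _ => -(N : ℝ)) (ua := fun _ => (N : ℝ)) (lb := fun _ => -R) (ub := fun _ => R)
    (fun _ => by linarith [(Nat.cast_nonneg N : (0:ℝ) ≤ N)]) (fun _ => by linarith)
  have hQ := measurableSet_cube n N
  obtain ⟨γ, hγ1, hγ2, hγ⟩ := hbox ((powMeasure β ψ).restrict (cube n N))
    (powMeasure β ψ (cube n N) • ρ)
    ((cube n N).indicator fun x => ENNReal.ofReal (ψ x ^ (-β)))
    (fun x => powMeasure β ψ (cube n N) * r x) inferInstance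
    ⟨by simp [hMof]⟩ (hdens.indicator hQ) (hr.const_mul _)
    (by rw [withDensity_indicator hQ, ← restrict_withDensity hQ]; rfl)
    (by
      have : (fun x => powMeasure β ψ (cube n N) * r x) = powMeasure β ψ (cube n N) • r := rfl
      rw [this, withDensity_smul _ hr]
      intro s
      simp only [Measure.smul_apply, smul_eq_mul]
      gcongr)
    (by rw [Measure.restrict_apply (measurableSet_cbox _ _).compl]
        exact measure_mono_null (fun x hx => hx.1 hx.2) measure_empty)
    (by simp only [Measure.smul_apply, smul_eq_mul]; exact mul_eq_zero_of_right _ hρ)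
    (by simp)
  have hγfin : IsFiniteMeasure γ :=
    ⟨by rw [univ_of_map_fst hγ1]; exact measure_lt_top _ _⟩
  have hae1 : ∀ᵐ z ∂γ, z.1 ∈ cube n N := ae_of_map_fst hγ1 hQ (by
    rw [Measure.restrict_apply hQ.compl, compl_inter_self, measure_empty])
  have hae2 : ∀ᵐ z ∂γ, z.2 ∈ cube n R := ae_of_map_snd hγ2 (measurableSet_cube n R) (by
    simp [hρ])
  have hN0 : (0 : ℝ) ≤ N := Nat.cast_nonneg N
  have hin : Integrable (fun z : En n × En n => ⟪p z.1, z.2 - z.1⟫) γ := by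
    refine Integrable.of_bound (C := L * (R' + √n * N))
      ((hpm.comp measurable_fst).inner (by fun_prop)).aestronglyMeasurable ?_
    filter_upwards [hae1, hae2] with z h1 h2
    refine (abs_real_inner_le_norm _ _).trans ?_
    exact mul_le_mul (hpL _) ((norm_sub_le _ _).trans
      (add_le_add (norm_le_of_mem_cube hR h2) (norm_le_of_mem_cube hN0 h1))) (norm_nonneg _) L.2
  refine ⟨N, hNN, γ, hγ1, hγ2, hin, ?_⟩
  have hψb : ∀ x : En n, ψ x ≤ ψ 0 + L * ‖x‖ := fun x => by
    have h1 := hL.dist_le_mul x 0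
    rw [Real.dist_eq, dist_zero_right] at h1
    linarith [le_abs_self (ψ x - ψ 0)]
  have hψN : Integrable (fun z : En n × En n => ψ z.1) γ := by
    refine Integrable.of_bound (C := ψ 0 + L * (√n * N))
      (hψm.comp measurable_fst).aestronglyMeasurable ?_
    filter_upwards [hae1] with z h1
    rw [Real.norm_of_nonneg (hψ0 _).le]
    refine (hψb _).trans ?_
    gcongr
    exact norm_le_of_mem_cube hN0 h1
  have heint : Integrable (fun z : En n × En n => (e z.1).toReal) γ := by
    refine Integrable.of_bound (C := 2 * L * (√n * N + R'))
      (hem.ennreal_toReal.comp measurable_fst).aestronglyMeasurable ?_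
    filter_upwards [hae1] with z h1
    rw [Real.norm_of_nonneg ENNReal.toReal_nonneg]
    refine ENNReal.toReal_le_of_le_ofReal (by positivity) ((heb _).trans ?_)
    refine ENNReal.ofReal_le_ofReal ?_
    have := norm_le_of_mem_cube hN0 h1
    gcongr
  have hZle : ∀ᵐ z ∂γ, ψ ((1 - t) • z.1 + t • z.2)
      ≤ ψ z.1 + t * ⟪p z.1, z.2 - z.1⟫ + t * (e z.1).toReal := by
    filter_upwards [hae2] with z h2
    have h3 := hesup z.1 z.2 (norm_le_of_mem_cube hR h2)
    rw [ENNReal.ofReal_le_iff_le_toReal (ne_top_of_le_ne_top ENNReal.ofReal_ne_top (heb _)),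
      sub_le_iff_le_add, div_le_iff₀ ht0] at h3
    linarith
  have hZint : Integrable (fun z : En n × En n => ψ z.1 + t * ⟪p z.1, z.2 - z.1⟫
      + t * (e z.1).toReal) γ := (hψN.add (hin.const_mul t)).add (heint.const_mul t)
  have hfst : ∀ (h : En n → ℝ), Measurable h → ∫ z, h z.1 ∂γ
      = ∫ x in cube n N, h x * ψ x ^ (-β) := by
    intro h hh
    rw [← integral_map (φ := Prod.fst) (μ := γ) (f := h) (by fun_prop) hh.aestronglyMeasurable,
      hγ1, powMeasure, setIntegral_withDensity_eq_setIntegral_toReal_smul hdens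
        (ae_of_all _ fun _ => ENNReal.ofReal_lt_top) _ hQ]
    refine setIntegral_congr_fun hQ fun x _ => ?_
    simp only [smul_eq_mul]
    rw [ENNReal.toReal_ofReal (Real.rpow_nonneg (hψ0 x).le _), mul_comm]
  have hEle : ∫ z, (e z.1).toReal ∂γ ≤ ε / 3 := by
    rw [hfst _ hem.ennreal_toReal]
    have h1 : (∫ x in cube n N, (e x).toReal * ψ x ^ (-β))
        = (∫⁻ x in cube n N, e x * ENNReal.ofReal (ψ x ^ (-β))).toReal := by
      rw [← integral_toReal (f := fun x => e x * ENNReal.ofReal (ψ x ^ (-β)))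
        (hem.mul hdens).aemeasurable (ae_of_all _ fun x =>
        ENNReal.mul_lt_top ((heb x).trans_lt ENNReal.ofReal_lt_top) ENNReal.ofReal_lt_top)]
      refine integral_congr_ae (ae_of_all _ fun x => ?_)
      simp only [ENNReal.toReal_mul]
      rw [ENNReal.toReal_ofReal (Real.rpow_nonneg (hψ0 x).le _)]
    rw [h1]
    exact ENNReal.toReal_le_of_le_ofReal (by positivity) ((setLIntegral_le_lintegral _ _).trans heI)
  have hsplit : ∫ z, (ψ z.1 + t * ⟪p z.1, z.2 - z.1⟫ + t * (e z.1).toReal) ∂γ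
      = ∫ z, ψ z.1 ∂γ + t * ∫ z, ⟪p z.1, z.2 - z.1⟫ ∂γ + t * ∫ z, (e z.1).toReal ∂γ := by
    rw [integral_add (f := fun z : En n × En n => ψ z.1 + t * ⟪p z.1, z.2 - z.1⟫)
      (hψN.add (hin.const_mul t)) (heint.const_mul t), integral_add hψN (hin.const_mul t),
      integral_const_mul, integral_const_mul]
  have hZ2 : (∫⁻ z, ENNReal.ofReal (ψ ((1 - t) • z.1 + t • z.2)) ∂γ)
      ≤ ENNReal.ofReal (WN + t * (∫ z, ⟪p z.1, z.2 - z.1⟫ ∂γ) + t * (ε / 3)) := by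
    calc _ ≤ ∫⁻ z, ENNReal.ofReal (ψ z.1 + t * ⟪p z.1, z.2 - z.1⟫ + t * (e z.1).toReal) ∂γ :=
          lintegral_mono_ae (hZle.mono fun z hz => ENNReal.ofReal_le_ofReal hz)
      _ = ENNReal.ofReal (∫ z, (ψ z.1 + t * ⟪p z.1, z.2 - z.1⟫ + t * (e z.1).toReal) ∂γ) :=
          (ofReal_integral_eq_lintegral_ofReal hZint
            (hZle.mono fun z hz => (hψ0 _).le.trans hz)).symm
      _ ≤ _ := by
          refine ENNReal.ofReal_le_ofReal ?_
          rw [hsplit]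
          gcongr
          rw [hfst ψ hψm, hWN]
          exact (setIntegral_congr_fun hQ fun x _ => hmul x).le
  have hrpow : ∀ x, ENNReal.ofReal (ψ x ^ (-β)) ^ (1 - 1 / β) = ENNReal.ofReal (ψ x ^ (1 - β)) := by
    intro x
    rw [ENNReal.ofReal_rpow_of_nonneg (Real.rpow_nonneg (hψ0 x).le _) hα.le,
      ← Real.rpow_mul (hψ0 x).le]
    congr 2
    field_simp
    ring
  have hF : ∫⁻ x, ((cube n N).indicator (fun x => ENNReal.ofReal (ψ x ^ (-β))) x) ^ (1 - 1 / β)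
      = ENNReal.ofReal WN := by
    rw [hWN, ofReal_integral_eq_lintegral_ofReal hW.integrableOn
      (ae_of_all _ fun x => Real.rpow_nonneg (hψ0 x).le _), ← lintegral_indicator hQ]
    refine lintegral_congr fun x => ?_
    by_cases hx : x ∈ cube n N
    · rw [indicator_of_mem hx, indicator_of_mem hx, hrpow]
    · rw [indicator_of_notMem hx, indicator_of_notMem hx, ENNReal.zero_rpow_of_pos hα]
  set I := (∫⁻ x, r x ^ (1 - 1 / β)).toReal with hI
  have hI0 : 0 ≤ I := ENNReal.toReal_nonneg
  have hIfin : ∫⁻ x, r x ^ (1 - 1 / β) ≠ ∞ := by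
    refine ne_top_of_le_ne_top ?_ (lintegral_rpow_le_holder hα (by
      have : 0 < 1 / β := by positivity
      linarith) hr (measurableSet_cube n R) hrρ hρ)
    refine ENNReal.mul_ne_top (ENNReal.rpow_ne_top_of_nonneg hα.le (measure_ne_top _ _)) ?_
    refine ENNReal.rpow_ne_top_of_nonneg (by simp; positivity) ?_
    rw [cube, volume_cbox _ _ (fun _ => by linarith)]
    exact ENNReal.ofReal_ne_top
  have hG : ∫⁻ x, (powMeasure β ψ (cube n N) * r x) ^ (1 - 1 / β)
      = ENNReal.ofReal (M ^ (1 - 1 / β) * I) := by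
    simp_rw [ENNReal.mul_rpow_of_nonneg _ _ hα.le]
    rw [lintegral_const_mul _ (hr.pow_const _), hMof, ENNReal.ofReal_rpow_of_nonneg hM0 hα.le,
      ENNReal.ofReal_mul (by positivity), hI, ENNReal.ofReal_toReal hIfin]
  have hVle : ∀ S : Set (En n), ∫⁻ z in S, ENNReal.ofReal ((β - 1)⁻¹ * ψ z ^ (1 - β))
      ≤ ENNReal.ofReal ((β - 1)⁻¹ * W) := by
    intro S
    have h1 : 0 ≤ (β - 1)⁻¹ := inv_nonneg.2 (by linarith)
    rw [hWdef, ← integral_const_mul, ofReal_integral_eq_lintegral_ofReal (hW.const_mul _)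
      (ae_of_all _ fun x => mul_nonneg h1 (Real.rpow_nonneg (hψ0 x).le _))]
    exact setLIntegral_le_lintegral _ _
  have hW0 : 0 ≤ W := integral_nonneg fun x => Real.rpow_nonneg (hψ0 x).le _
  have hWN0 : 0 ≤ WN := integral_nonneg fun x => Real.rpow_nonneg (hψ0 x).le _
  have hWNW : WN ≤ W := setIntegral_le_integral hW (ae_of_all _ fun x =>
    Real.rpow_nonneg (hψ0 x).le _)
  have hfinal := hγ.trans (add_le_add (add_le_add hZ2 (hVle _)) le_rfl)
  have hu : ((powMeasure β ψ).restrict (cube n N)) univ = ENNReal.ofReal M := by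
    rw [Measure.restrict_apply_univ, hMof]
  have hX0 : 0 ≤ WN + t * (∫ z, ⟪p z.1, z.2 - z.1⟫ ∂γ) + t * (ε / 3) := by
    have h1 : 0 ≤ ∫ z, (ψ z.1 + t * ⟪p z.1, z.2 - z.1⟫ + t * (e z.1).toReal) ∂γ :=
      integral_nonneg_of_ae (hZle.mono fun z hz => (hψ0 _).le.trans hz)
    rw [hsplit] at h1
    have h2 : ∫ z, ψ z.1 ∂γ = WN := by
      rw [hfst ψ hψm, hWN]
      exact (setIntegral_congr_fun hQ fun x _ => hmul x)
    rw [h2] at h1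
    nlinarith
  have hc0 : 0 < (β - 1)⁻¹ := inv_pos.2 (by linarith)
  rw [hF, hG, hu, ← ENNReal.ofReal_mul ht'.le, ← ENNReal.ofReal_mul ht0.le,
    ← ENNReal.ofReal_add (by positivity) (by positivity), ← ENNReal.ofReal_mul (by positivity),
    ← ENNReal.ofReal_mul (by positivity), ← ENNReal.ofReal_add hX0 (by positivity),
    ← ENNReal.ofReal_add (by positivity) (by positivity),
    ENNReal.ofReal_le_ofReal_iff (by positivity)] at hfinal
  have hαc : (1 - 1 / β)⁻¹ = 1 + (β - 1)⁻¹ := by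
    have : β - 1 ≠ 0 := by linarith
    field_simp
    ring
  have hαWN : (1 - 1 / β)⁻¹ * WN ≤ (1 - 1 / β)⁻¹ * W :=
    mul_le_mul_of_nonneg_left hWNW (inv_nonneg.2 hα.le)
  set A := (1 - 1 / β)⁻¹
  set B := M ^ (1 - 1 / β) * I
  set T := ∫ z, ⟪p z.1, z.2 - z.1⟫ ∂γ
  have h1 : A * ((1 - t) * WN + t * B) = A * WN + t * (A * B - A * WN) := by ring
  have h2 : A * WN = WN + (β - 1)⁻¹ * WN := by rw [hαc]; ring
  have h3 : t * (A * B - A * WN) ≤ t * (T + ε) := by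
    rw [h1] at hfinal
    linarith
  have h4 := le_of_mul_le_mul_left h3 ht0
  linarith

/-- A positive convex function with effective domain `D` and closed sublevel sets, extended by zero
outside of `D`. -/
structure ConvexPotential {n : ℕ} (D : Set (En n)) (u : En n → ℝ) : Prop where
  convexOn : ConvexOn ℝ D u
  pos : ∀ x ∈ D, 0 < u x
  zero : ∀ x, x ∉ D → u x = 0
  closed : ∀ s, IsClosed {x | x ∈ D ∧ u x ≤ s}

namespace ConvexPotential
variable {n : ℕ} {D : Set (En n)} {u : En n → ℝ}

lemma measurableSet (h : ConvexPotential D u) : MeasurableSet D := by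
  have : D = ⋃ k : ℕ, {x | x ∈ D ∧ u x ≤ k} := by
    ext x
    simp only [mem_iUnion, mem_ofPred_eq, exists_and_left, iff_self_and]
    exact fun _ => exists_nat_ge _
  rw [this]
  exact MeasurableSet.iUnion fun k => (h.closed k).measurableSet

lemma nonneg (h : ConvexPotential D u) (x : En n) : 0 ≤ u x := by
  by_cases hx : x ∈ D
  · exact (h.pos x hx).le
  · exact (h.zero x hx).ge

lemma measurable (h : ConvexPotential D u) : Measurable u := by
  refine measurable_of_Iic fun s => ?_
  rcases lt_or_ge s 0 with hs | hs
  · convert MeasurableSet.empty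
    ext x
    simpa using hs.trans_le (h.nonneg x)
  · have : u ⁻¹' Iic s = {x | x ∈ D ∧ u x ≤ s} ∪ Dᶜ := by
      ext x
      by_cases hx : x ∈ D
      · simp [hx]
      · simp [hx, h.zero x hx, hs]
    rw [this]
    exact (h.closed s).measurableSet.union h.measurableSet.compl

lemma mem_interior_of_hasGradientAt (h : ConvexPotential D u) {p x : En n} (hx : x ∈ D)
    (hp : HasGradientAt u p x) : x ∈ interior D := by
  have hc : ContinuousAt u x := hp.hasFDerivAt.continuousAt
  rw [mem_interior_iff_mem_nhds]
  filter_upwards [hc.eventually (lt_mem_nhds (h.pos x hx))] with y hy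
  by_contra hyD
  exact hy.ne' (h.zero y hyD)

end ConvexPotential

lemma ConvexOn.add_inner_gradient_le {n : ℕ} {D : Set (En n)} {u : En n → ℝ}
    (h : ConvexOn ℝ D u) {p x y : En n} (hx : x ∈ D) (hy : y ∈ D) (hp : HasGradientAt u p x) :
    u x + ⟪p, y - x⟫ ≤ u y := by
  set L : ℝ →ᵃ[ℝ] En n := AffineMap.lineMap x y
  have hL : ConvexOn ℝ (L ⁻¹' D) (u ∘ L) := h.comp_affineMap L
  have hd : HasDerivAt (u ∘ L) ⟪p, y - x⟫ 0 := by
    have h1 : HasDerivAt L (y - x) 0 := by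
      simpa [L] using (AffineMap.hasDerivAt_lineMap (a := x) (b := y) (x := (0:ℝ)))
    have h2 : HasFDerivAt u (InnerProductSpace.toDual ℝ (En n) p) (L 0) := by
      simpa [L] using hp.hasFDerivAt
    simpa using h2.comp_hasDerivAt (0:ℝ) h1
  have h0 : (0:ℝ) ∈ L ⁻¹' D := by simpa [L] using hx
  have h1 : (1:ℝ) ∈ L ⁻¹' D := by simpa [L] using hy
  have := hL.le_slope_of_hasDerivAt h0 h1 one_pos hd
  simp [slope, L] at this
  linarith

namespace ConvexPotential
variable {n : ℕ} {D : Set (En n)} {u : En n → ℝ}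

lemma isBounded_of_volume_ne_top {S : Set (En n)} (hS : Convex ℝ S)
    (hv : volume S ≠ ∞) {x₀ : En n} {r : ℝ} (hr : 0 < r) (hb : Metric.ball x₀ r ⊆ S) :
    ∃ R > 0, S ⊆ Metric.closedBall x₀ R := by
  obtain ⟨N, hN⟩ := ENNReal.exists_nat_mul_gt (a := volume (Metric.ball x₀ (r/2))) (b := volume S)
    (Metric.measure_ball_pos _ _ (by positivity)).ne' hv
  refine ⟨2 * r * N + 1, by positivity, fun x hx => ?_⟩
  rw [Metric.mem_closedBall, dist_eq_norm]
  by_contra! hd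
  set d := ‖x - x₀‖ with hddef
  have hd0 : 0 < d := lt_trans (by positivity) hd
  let c : ℕ → En n := fun i => x₀ + (i * r / d) • (x - x₀)
  have ht : ∀ i < N, (i:ℝ) * r / d ≤ 1/2 := by
    intro i hi
    rw [div_le_iff₀ hd0]
    have : (i:ℝ) ≤ N := by exact_mod_cast hi.le
    nlinarith
  have hsub : ∀ i < N, Metric.ball (c i) (r/2) ⊆ S := by
    intro i hi z hz
    set t := (i:ℝ) * r / d with htdef
    have ht1 := ht i hi
    have ht0 : 0 ≤ t := by positivity
    have hne : (1 - t) ≠ 0 := by linarith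
    have hw : x₀ + (1 - t)⁻¹ • (z - c i) ∈ S := by
      apply hb
      rw [Metric.mem_ball, dist_eq_norm, add_sub_cancel_left, norm_smul, Real.norm_eq_abs,
        abs_of_pos (by rw [inv_pos]; linarith)]
      rw [Metric.mem_ball, dist_eq_norm] at hz
      rw [inv_mul_lt_iff₀ (by linarith)]
      nlinarith
    have := hS hw hx (by linarith : 0 ≤ 1 - t) ht0 (by ring)
    convert this using 1
    rw [smul_add, smul_smul, mul_inv_cancel₀ hne]
    simp only [c, ← htdef]
    module
  have hdisj : (↑(Finset.range N) : Set ℕ).PairwiseDisjoint fun i => Metric.ball (c i) (r/2) := by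
    intro i _ j _ hij
    apply Metric.ball_disjoint_ball
    have : dist (c i) (c j) = |(i:ℝ) - j| * r := by
      rw [dist_eq_norm]
      have : c i - c j = (((i:ℝ) - j) * r / d) • (x - x₀) := by
        simp only [c]; module
      rw [this, norm_smul, ← hddef, Real.norm_eq_abs, abs_div, abs_mul, abs_of_pos hr,
        abs_of_pos hd0]
      field_simp
    rw [this]
    have h1 : (1:ℝ) ≤ |(i:ℝ) - j| := by
      have : (i:ℤ) - j ≠ 0 := by
        rw [sub_ne_zero]; exact_mod_cast hij
      exact_mod_cast Int.one_le_abs this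
    nlinarith
  have hle : volume (⋃ i ∈ Finset.range N, Metric.ball (c i) (r/2)) ≤ volume S :=
    measure_mono (iUnion₂_subset fun i hi => hsub i (Finset.mem_range.mp hi))
  rw [measure_biUnion_finset hdisj fun i _ => measurableSet_ball] at hle
  simp only [Measure.addHaar_ball_center] at hle hN
  rw [Finset.sum_const, Finset.card_range, nsmul_eq_mul] at hle
  exact absurd hle (not_le.mpr hN)

lemma convex_sublevel (h : ConvexPotential D u) (s : ℝ) : Convex ℝ {x | x ∈ D ∧ u x ≤ s} :=
  h.convexOn.convex_le s

lemma growth (h : ConvexPotential D u) {β : ℝ} (hβ : 0 < β)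
    (hfin : ∫⁻ x in D, ENNReal.ofReal (u x ^ (-β)) ≠ ∞) (hne : (interior D).Nonempty) :
    ∃ a > 0, ∀ x ∈ D, a * (1 + ‖x‖) ≤ u x := by
  obtain ⟨x₀, hx₀⟩ := hne
  have hx₀D := interior_subset hx₀
  set s₀ := u x₀ + 1 with hs₀
  have hs₀0 : 0 < s₀ := by linarith [h.pos x₀ hx₀D]
  set S := {x | x ∈ D ∧ u x ≤ s₀} with hSdef
  have hvol : volume S ≠ ∞ := by
    have h1 : ENNReal.ofReal (s₀ ^ (-β)) * volume S ≤ ∫⁻ x in D, ENNReal.ofReal (u x ^ (-β)) := by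
      calc ENNReal.ofReal (s₀ ^ (-β)) * volume S = ∫⁻ x in S, ENNReal.ofReal (s₀ ^ (-β)) := by
            rw [setLIntegral_const]
        _ ≤ ∫⁻ x in S, ENNReal.ofReal (u x ^ (-β)) := by
            apply setLIntegral_mono' (h.closed s₀).measurableSet
            intro x hx
            exact ENNReal.ofReal_le_ofReal
              (Real.rpow_le_rpow_of_nonpos (h.pos x hx.1) hx.2 (by linarith))
        _ ≤ _ := lintegral_mono_set fun x hx => hx.1
    intro htop
    rw [htop, ENNReal.mul_top (by simpa using Real.rpow_pos_of_pos hs₀0 _)] at h1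
    exact hfin (top_le_iff.mp h1)
  have hcont : ContinuousAt u x₀ :=
    h.convexOn.continuousOn_interior.continuousAt (isOpen_interior.mem_nhds hx₀)
  obtain ⟨r, hr, hball⟩ := Metric.mem_nhds_iff.mp (inter_mem (mem_interior_iff_mem_nhds.mp hx₀)
    (hcont.eventually (gt_mem_nhds (show u x₀ < s₀ by linarith))))
  obtain ⟨R, hR, hSR⟩ := isBounded_of_volume_ne_top (h.convex_sublevel s₀)
    hvol hr (fun x hx => ⟨(hball hx).1, le_of_lt (hball hx).2⟩)
  have hm : ∃ m > 0, ∀ x ∈ D, m ≤ u x := by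
    by_contra! hcon
    have hnon : (⋂ k : ℕ, {x | x ∈ D ∧ u x ≤ min s₀ (1 / ((k:ℝ) + 1))}).Nonempty := by
      apply IsCompact.nonempty_iInter_of_directed_nonempty_isCompact_isClosed
      · apply directed_of_isDirected_le
        intro i j hij x hx
        exact ⟨hx.1, hx.2.trans (min_le_min le_rfl
          (one_div_le_one_div_of_le (by positivity) (by gcongr)))⟩
      · intro k
        obtain ⟨x, hx, hxm⟩ := hcon (min s₀ (1 / ((k:ℝ) + 1))) (by positivity)
        exact ⟨x, hx, hxm.le⟩
      · intro k
        exact Metric.isCompact_of_isClosed_isBounded (h.closed _)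
          (Metric.isBounded_closedBall.subset
            (fun x hx => hSR ⟨hx.1, hx.2.trans (min_le_left _ _)⟩))
      · exact fun k => h.closed _
    obtain ⟨x, hx⟩ := hnon
    rw [mem_iInter] at hx
    obtain ⟨k, hk⟩ := exists_nat_one_div_lt (h.pos x (hx 0).1)
    exact absurd ((hx k).2.trans (min_le_right _ _)) (not_le.mpr hk)
  obtain ⟨m, hm0, hm⟩ := hm
  set R₂ := R + 1
  have hR₂ : 0 < R₂ := by positivity
  set κ := min 1 m / R₂ with hκ
  have hκ0 : 0 < κ := by positivity
  have hkey : ∀ y ∈ D, κ * ‖y - x₀‖ ≤ u y := by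
    intro y hy
    rw [hκ, div_mul_eq_mul_div, div_le_iff₀ hR₂]
    rcases lt_or_ge ‖y - x₀‖ R₂ with hd | hd
    · have h1 : min 1 m ≤ u y := (min_le_right _ _).trans (hm y hy)
      exact mul_le_mul h1 hd.le (norm_nonneg _) (h.nonneg y)
    · set d := ‖y - x₀‖ with hddef
      have hd0 : 0 < d := hR₂.trans_le hd
      set t := R₂ / d with htdef
      have ht0 : 0 < t := by positivity
      have ht1 : t ≤ 1 := by rw [htdef, div_le_one hd0]; exact hd
      have hz := h.convexOn.1 hx₀D hy (sub_nonneg.mpr ht1) ht0.le (by ring)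
      have hcv := h.convexOn.2 hx₀D hy (sub_nonneg.mpr ht1) ht0.le (by ring)
      set z := (1 - t) • x₀ + t • y with hzdef
      have hzu : s₀ < u z := by
        by_contra! hle
        have := hSR ⟨hz, hle⟩
        rw [Metric.mem_closedBall, dist_eq_norm] at this
        have hzx : z - x₀ = t • (y - x₀) := by rw [hzdef]; module
        rw [hzx, norm_smul, ← hddef, Real.norm_eq_abs, abs_of_pos ht0, htdef,
          div_mul_cancel₀ _ hd0.ne'] at this
        simp only [R₂] at this
        linarith
      simp only [smul_eq_mul] at hcv
      have htd : t * d = R₂ := by rw [htdef, div_mul_cancel₀ _ hd0.ne']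
      have h2 : 1 ≤ t * u y := by nlinarith [h.pos x₀ hx₀D]
      have h3 : min 1 m * d ≤ d := by nlinarith [min_le_left 1 m]
      nlinarith
  have hx₀n := norm_nonneg x₀
  refine ⟨min (m / (2 * (1 + ‖x₀‖))) (κ / 2), by positivity, fun y hy => ?_⟩
  set a := min (m / (2 * (1 + ‖x₀‖))) (κ / 2)
  have ha0 : 0 < a := by positivity
  have ha1 : a * (1 + ‖x₀‖) ≤ m / 2 := by
    have := min_le_left (m / (2 * (1 + ‖x₀‖))) (κ / 2)
    rw [le_div_iff₀ (by positivity)] at this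
    linarith
  have ha2 : a ≤ κ / 2 := min_le_right _ _
  have hny : ‖y‖ ≤ ‖x₀‖ + ‖y - x₀‖ := by
    simpa using norm_add_le x₀ (y - x₀)
  nlinarith [hkey y hy, hm y hy, norm_nonneg (y - x₀)]

lemma isCompact_sublevel (h : ConvexPotential D u) {a : ℝ} (ha : 0 < a)
    (hg : ∀ x ∈ D, a * (1 + ‖x‖) ≤ u x) (s : ℝ) : IsCompact {x | x ∈ D ∧ u x ≤ s} := by
  refine Metric.isCompact_of_isClosed_isBounded (h.closed s)
    (Metric.isBounded_closedBall (x := (0 : En n)) (r := s / a) |>.subset fun x hx => ?_)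
  rw [mem_closedBall_zero_iff, le_div_iff₀ ha]
  linarith [hg x hx.1, hx.2]

end ConvexPotential

/-- The Lipschitz regularization of `u` restricted to `D`. -/
def lipReg {n : ℕ} (D : Set (En n)) (u : En n → ℝ) (k : ℝ) (x : En n) : ℝ :=
  ⨅ y : D, (u y + k * ‖x - y‖)

namespace ConvexPotential
variable {n : ℕ} {D : Set (En n)} {u : En n → ℝ} {k : ℝ}

lemma lipReg_le (h : ConvexPotential D u) (hk : 0 ≤ k) {x y : En n} (hy : y ∈ D) :
    lipReg D u k x ≤ u y + k * ‖x - y‖ := by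
  refine ciInf_le (f := fun y : D => u y + k * ‖x - y‖) ⟨0, ?_⟩ ⟨y, hy⟩
  rintro _ ⟨z, rfl⟩
  have := h.nonneg z
  positivity

lemma lipReg_le_self (h : ConvexPotential D u) (hk : 0 ≤ k) {x : En n} (hx : x ∈ D) :
    lipReg D u k x ≤ u x := by
  simpa using h.lipReg_le hk (x := x) hx

lemma le_lipReg (hne : D.Nonempty) {x : En n} {s : ℝ} (hs : ∀ y ∈ D, s ≤ u y + k * ‖x - y‖) :
    s ≤ lipReg D u k x := by
  have := hne.to_subtype
  exact le_ciInf fun y => hs y y.2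

lemma exists_lt_of_lipReg_lt (hne : D.Nonempty) {x : En n} {s : ℝ} (hs : lipReg D u k x < s) :
    ∃ y ∈ D, u y + k * ‖x - y‖ < s := by
  have := hne.to_subtype
  obtain ⟨y, hy⟩ := exists_lt_of_ciInf_lt hs
  exact ⟨y, y.2, hy⟩

lemma growth_lipReg (hne : D.Nonempty) {a : ℝ}
    (hg : ∀ x ∈ D, a * (1 + ‖x‖) ≤ u x) (ha : 0 < a) (hk : a ≤ k) (x : En n) :
    a * (1 + ‖x‖) ≤ lipReg D u k x := by
  refine le_lipReg hne fun y hy => ?_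
  have h1 := hg y hy
  have h2 : ‖x‖ ≤ ‖y‖ + ‖x - y‖ := by simpa using norm_add_le y (x - y)
  have h3 : a * ‖x - y‖ ≤ k * ‖x - y‖ := by gcongr
  nlinarith

lemma lipschitzWith_lipReg (h : ConvexPotential D u) (hne : D.Nonempty) (k : NNReal) :
    LipschitzWith k (lipReg D u k) := by
  refine LipschitzWith.of_le_add_mul _ fun x x' => ?_
  rw [← sub_le_iff_le_add]
  refine le_lipReg hne fun y hy => ?_
  have h1 := h.lipReg_le k.2 (x := x) hy
  have h2 : ‖x - y‖ ≤ dist x x' + ‖x' - y‖ := by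
    rw [dist_eq_norm]; simpa using norm_add_le (x - x') (x' - y)
  have h3 : (k:ℝ) * ‖x - y‖ ≤ k * (dist x x' + ‖x' - y‖) := by gcongr
  change lipReg D u k x ≤ u y + k * ‖x - y‖ at h1
  linarith

lemma convexOn_lipReg (h : ConvexPotential D u) (hne : D.Nonempty) (hk : 0 ≤ k) :
    ConvexOn ℝ univ (lipReg D u k) := by
  refine ⟨convex_univ, fun x _ x' _ s t hs ht hst => ?_⟩
  refine le_of_forall_pos_le_add fun ε hε => ?_
  obtain ⟨y, hy, hy'⟩ := exists_lt_of_lipReg_lt hne (lt_add_of_pos_right (lipReg D u k x) hε)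
  obtain ⟨z, hz, hz'⟩ := exists_lt_of_lipReg_lt hne (lt_add_of_pos_right (lipReg D u k x') hε)
  have h1 := h.lipReg_le hk (x := s • x + t • x') (h.convexOn.1 hy hz hs ht hst)
  have h2 := h.convexOn.2 hy hz hs ht hst
  have h3 : ‖s • x + t • x' - (s • y + t • z)‖ ≤ s * ‖x - y‖ + t * ‖x' - z‖ := by
    have : s • x + t • x' - (s • y + t • z) = s • (x - y) + t • (x' - z) := by module
    rw [this]
    refine (norm_add_le _ _).trans (le_of_eq ?_)
    rw [norm_smul, norm_smul, Real.norm_of_nonneg hs, Real.norm_of_nonneg ht]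
  have h4 := mul_le_mul_of_nonneg_left h3 hk
  have h5 := mul_le_mul_of_nonneg_left hy'.le hs
  have h6 := mul_le_mul_of_nonneg_left hz'.le ht
  simp only [smul_eq_mul] at h2 ⊢
  have : ε = s * ε + t * ε := by rw [← add_mul, hst, one_mul]
  linarith

lemma lipReg_eq_self (h : ConvexPotential D u) (hk : 0 ≤ k) {p x : En n} (hx : x ∈ D)
    (hp : HasGradientAt u p x) (hpk : ‖p‖ ≤ k) : lipReg D u k x = u x := by
  refine le_antisymm (h.lipReg_le_self hk hx) (le_lipReg ⟨x, hx⟩ fun y hy => ?_)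
  have h1 := h.convexOn.add_inner_gradient_le hx hy hp
  have h2 : -(‖p‖ * ‖y - x‖) ≤ ⟪p, y - x⟫ := (abs_le.mp (abs_real_inner_le_norm p (y - x))).1
  have h3 : ‖p‖ * ‖y - x‖ ≤ k * ‖x - y‖ := by
    rw [norm_sub_rev x y]; gcongr
  linarith

lemma gradient_lipReg_eq (h : ConvexPotential D u) (hk : 0 ≤ k) {p p' x : En n} (hx : x ∈ D)
    (hp : HasGradientAt u p x) (hpk : ‖p‖ ≤ k) (hp' : HasGradientAt (lipReg D u k) p' x) :
    p' = p := by
  have hmin : IsLocalMin (fun y => u y - lipReg D u k y) x := by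
    filter_upwards [mem_interior_iff_mem_nhds.mp (h.mem_interior_of_hasGradientAt hx hp)] with y hy
    rw [h.lipReg_eq_self hk hx hp hpk, sub_self, sub_nonneg]
    exact h.lipReg_le_self hk hy
  have := hmin.hasFDerivAt_eq_zero (hp.hasFDerivAt.sub hp'.hasFDerivAt)
  rw [← map_sub, LinearIsometryEquiv.map_eq_zero_iff, sub_eq_zero] at this
  exact this.symm

lemma eventually_le_lipReg (h : ConvexPotential D u) (hne : D.Nonempty) {a : ℝ} (ha : 0 < a)
    (hg : ∀ x ∈ D, a * (1 + ‖x‖) ≤ u x) {K : Set (En n)} (hK : IsClosed K) {s : ℝ}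
    (hd : Disjoint {x | x ∈ D ∧ u x ≤ s} K) : ∀ᶠ k : ℝ in atTop, ∀ x ∈ K, s ≤ lipReg D u k x := by
  obtain ⟨δ, hδ, hdist⟩ := Metric.exists_pos_forall_lt_edist (h.isCompact_sublevel ha hg s) hK hd
  filter_upwards [eventually_ge_atTop (s / δ), eventually_ge_atTop 0] with k hk hk0 x hx
  refine le_lipReg hne fun y hy => ?_
  rcases lt_or_ge s (u y) with hs | hs
  · have : 0 ≤ k * ‖x - y‖ := by positivity
    linarith
  · have h1 := hdist y ⟨hy, hs⟩ x hx
    rw [edist_dist, ENNReal.lt_ofReal_iff_toReal_lt (by simp), dist_comm, dist_eq_norm] at h1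
    simp only [ENNReal.coe_toReal] at h1
    have h2 : s ≤ k * δ := by rwa [div_le_iff₀ (by exact_mod_cast hδ)] at hk
    have h3 : k * δ ≤ k * ‖x - y‖ := by gcongr
    linarith [h.nonneg y]

lemma tendsto_lipReg_of_mem (h : ConvexPotential D u) {a : ℝ} (ha : 0 < a)
    (hg : ∀ x ∈ D, a * (1 + ‖x‖) ≤ u x) {x : En n} (hx : x ∈ D) :
    Tendsto (fun k => lipReg D u k x) atTop (𝓝 (u x)) := by
  rw [tendsto_order]
  refine ⟨fun s hs => ?_, fun s hs => ?_⟩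
  · obtain ⟨t, hst, ht⟩ := exists_between hs
    filter_upwards [h.eventually_le_lipReg ⟨x, hx⟩ ha hg (K := {x}) isClosed_singleton (s := t)
      (by simpa [disjoint_singleton_right] using fun _ => ht)] with k hk
    exact hst.trans_le (hk x rfl)
  · filter_upwards [eventually_ge_atTop 0] with k hk
    exact (h.lipReg_le_self hk hx).trans_lt hs

lemma tendsto_lipReg_of_notMem (h : ConvexPotential D u) (hne : D.Nonempty) {a : ℝ} (ha : 0 < a)
    (hg : ∀ x ∈ D, a * (1 + ‖x‖) ≤ u x) {x : En n} (hx : x ∉ D) :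
    Tendsto (fun k => lipReg D u k x) atTop atTop := by
  rw [tendsto_atTop]
  intro s
  filter_upwards [h.eventually_le_lipReg hne ha hg (K := {x}) isClosed_singleton (s := s)
    (by simp [disjoint_singleton_right, hx])] with k hk
  exact hk x rfl

lemma tendsto_rpow_lipReg (h : ConvexPotential D u) (hne : D.Nonempty) {a : ℝ} (ha : 0 < a)
    (hg : ∀ x ∈ D, a * (1 + ‖x‖) ≤ u x) {s : ℝ} (hs : 0 < s) (x : En n) :
    Tendsto (fun k => lipReg D u k x ^ (-s)) atTop (𝓝 (D.indicator (fun x => u x ^ (-s)) x)) := by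
  by_cases hx : x ∈ D
  · rw [indicator_of_mem hx]
    exact (h.tendsto_lipReg_of_mem ha hg hx).rpow_const (Or.inl (h.pos x hx).ne')
  · rw [indicator_of_notMem hx]
    exact (tendsto_rpow_neg_atTop hs).comp (h.tendsto_lipReg_of_notMem hne ha hg hx)

lemma lipReg_rpow_le (hne : D.Nonempty) {a : ℝ} (ha : 0 < a)
    (hg : ∀ x ∈ D, a * (1 + ‖x‖) ≤ u x) (hk : a ≤ k) {s : ℝ} (hs : 0 < s) (x : En n) :
    lipReg D u k x ^ (-s) ≤ (a * (1 + ‖x‖)) ^ (-s) :=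
  Real.rpow_le_rpow_of_nonpos (by positivity) (growth_lipReg hne hg ha hk x) (by linarith)

lemma tendsto_integral_rpow_lipReg (h : ConvexPotential D u) (hne : D.Nonempty) {a : ℝ}
    (ha : 0 < a) (hg : ∀ x ∈ D, a * (1 + ‖x‖) ≤ u x) {s : ℝ} (hs : (n:ℝ) < s) :
    Tendsto (fun k : ℕ => ∫ x, lipReg D u k x ^ (-s)) atTop (𝓝 (∫ x in D, u x ^ (-s))) := by
  have hs0 : 0 < s := (Nat.cast_nonneg n).trans_lt hs
  rw [← integral_indicator h.measurableSet]
  refine tendsto_integral_filter_of_dominated_convergence (fun x => (a * (1 + ‖x‖)) ^ (-s)) ?_ ?_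
    (integrable_rpow_of_growth ha hs (by fun_prop) fun x => le_rfl)
    (ae_of_all _ fun x => (h.tendsto_rpow_lipReg hne ha hg hs0 x).comp tendsto_natCast_atTop_atTop)
  · filter_upwards with k
    have := (h.lipschitzWith_lipReg hne k).continuous.measurable
    simp only [NNReal.coe_natCast] at this
    exact (this.pow_const _).aestronglyMeasurable
  · filter_upwards [tendsto_natCast_atTop_atTop.eventually_ge_atTop a] with k hk
    refine ae_of_all _ fun x => ?_
    have h0 : 0 ≤ lipReg D u k x := by
      have := growth_lipReg hne hg ha hk x
      exact le_trans (by positivity) this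
    rw [Real.norm_of_nonneg (Real.rpow_nonneg h0 _)]
    exact lipReg_rpow_le hne ha hg hk hs0 x

end ConvexPotential

lemma LipschitzWith.ae_hasGradientAt {n : ℕ} {L : NNReal} {f : En n → ℝ} (hf : LipschitzWith L f) :
    ∀ᵐ x, HasGradientAt f (gradient f x) x := by
  filter_upwards [hf.ae_differentiableAt] with x hx using hx.hasGradientAt

lemma LipschitzWith.norm_gradient_le {n : ℕ} {L : NNReal} {f : En n → ℝ} (hf : LipschitzWith L f)
    (x : En n) : ‖gradient f x‖ ≤ L := by
  rw [gradient, LinearIsometryEquiv.norm_map]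
  exact norm_fderiv_le_of_lipschitz ℝ hf

lemma measurable_gradient {n : ℕ} (f : En n → ℝ) : Measurable (gradient f) :=
  (InnerProductSpace.toDual ℝ (En n)).symm.continuous.measurable.comp (measurable_fderiv ℝ f)

lemma MonotoneOn.lintegral_enorm_deriv_le {f : ℝ → ℝ} {a b : ℝ} (hab : a ≤ b)
    (hf : MonotoneOn f (Icc a b)) :
    ∫⁻ x in Ioc a b, ‖deriv f x‖ₑ ≤ ENNReal.ofReal (f b - f a) := by
  have hf' : MonotoneOn f (uIcc a b) := by rwa [uIcc_of_le hab]
  have hderivInt := hf'.intervalIntegrable_deriv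
  have hmem := hf'.intervalIntegral_deriv_mem_uIcc
  have hle : f a ≤ f b := hf (left_mem_Icc.mpr hab) (right_mem_Icc.mpr hab) hab
  rw [uIcc_of_le (by linarith)] at hmem
  rw [intervalIntegrable_iff_integrableOn_Ioc_of_le hab] at hderivInt
  rw [intervalIntegral.integral_of_le hab] at hmem
  have hnn : ∀ᵐ x ∂(volume.restrict (Ioc a b)), 0 ≤ deriv f x := by
    rw [← restrict_Ioo_eq_restrict_Ioc]
    refine ae_restrict_of_forall_mem measurableSet_Ioo fun x hx => ?_
    have hmono : MonotoneOn f (Ioo a b) := hf.mono Ioo_subset_Icc_self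
    rw [← derivWithin_of_mem_nhds (isOpen_Ioo.mem_nhds hx)]
    exact hmono.derivWithin_nonneg
  calc ∫⁻ x in Ioc a b, ‖deriv f x‖ₑ = ∫⁻ x in Ioc a b, ENNReal.ofReal (deriv f x) := by
        refine lintegral_congr_ae ?_
        filter_upwards [hnn] with x hx using Real.enorm_of_nonneg hx
    _ = ENNReal.ofReal (∫ x in Ioc a b, deriv f x) :=
        (ofReal_integral_eq_lintegral_ofReal hderivInt hnn).symm
    _ ≤ _ := ENNReal.ofReal_le_ofReal hmem.2

lemma AntitoneOn.lintegral_enorm_deriv_le {f : ℝ → ℝ} {a b : ℝ} (hab : a ≤ b)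
    (hf : AntitoneOn f (Icc a b)) :
    ∫⁻ x in Ioc a b, ‖deriv f x‖ₑ ≤ ENNReal.ofReal (f a - f b) := by
  have := hf.neg.lintegral_enorm_deriv_le hab
  simpa [deriv.neg, sub_eq_add_neg, add_comm] using this

lemma lintegral_enorm_deriv_le_of_unimodal {f : ℝ → ℝ} (hf0 : ∀ x, 0 ≤ f x) {s : ℝ}
    (h1 : MonotoneOn f (Iic s)) (h2 : AntitoneOn f (Ici s)) :
    ∫⁻ x, ‖deriv f x‖ₑ ≤ ENNReal.ofReal (2 * f s) := by
  have hmono : Monotone fun k : ℕ => Ioc (s - k) (s + k) := fun i j hij => by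
    have : (i:ℝ) ≤ j := by exact_mod_cast hij
    exact Ioc_subset_Ioc (by linarith) (by linarith)
  have hU : ⋃ k : ℕ, Ioc (s - k) (s + k) = univ := by
    refine eq_univ_of_forall fun x => mem_iUnion.mpr ?_
    obtain ⟨k, hk⟩ := exists_nat_gt |x - s|
    have := abs_lt.mp hk
    exact ⟨k, by constructor <;> linarith⟩
  rw [← setLIntegral_univ, ← hU,
    setLIntegral_iUnion_of_directed _ (directed_of_isDirected_le hmono)]
  refine iSup_le fun k => ?_
  have hk : (0:ℝ) ≤ k := Nat.cast_nonneg k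
  rw [← Ioc_union_Ioc_eq_Ioc (b := s) (by linarith) (by linarith)]
  refine (lintegral_union_le _ _ _).trans ?_
  have e1 := (h1.mono (Icc_subset_Iic_self : Icc (s - k) s ⊆ Iic s)).lintegral_enorm_deriv_le
    (by linarith)
  have e2 := (h2.mono (Icc_subset_Ici_self : Icc s (s + k) ⊆ Ici s)).lintegral_enorm_deriv_le
    (by linarith)
  refine (add_le_add e1 e2).trans ?_
  rw [two_mul, ENNReal.ofReal_add (hf0 s) (hf0 s)]
  gcongr
  · linarith [hf0 (s - k)]
  · linarith [hf0 (s + k)]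

lemma lipschitzOnWith_rpow_of_nonpos {δ t : ℝ} (hδ : 0 < δ) (ht : t ≤ 0) :
    LipschitzOnWith (|t| * δ ^ (t - 1)).toNNReal (fun x : ℝ => x ^ t) (Ici δ) := by
  refine (convex_Ici δ).lipschitzOnWith_of_nnnorm_deriv_le (fun x hx => ?_) fun x hx => ?_
  · exact (Real.hasDerivAt_rpow_const (Or.inl (hδ.trans_le hx).ne')).differentiableAt
  · rw [(Real.hasDerivAt_rpow_const (Or.inl (hδ.trans_le hx).ne')).deriv]
    rw [← NNReal.coe_le_coe, coe_nnnorm, Real.coe_toNNReal _ (by positivity), norm_mul,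
      Real.norm_eq_abs, Real.norm_of_nonneg (Real.rpow_nonneg (hδ.trans_le hx).le _)]
    gcongr ?_ * ?_
    exact Real.rpow_le_rpow_of_nonpos hδ hx (by linarith)

lemma enorm_sub_le_lintegral_deriv_rpow {w : ℝ → ℝ} {I : Set ℝ} (hI : IsOpen I)
    (hw : ConvexOn ℝ I w) (hpos : ∀ s ∈ I, 0 < w s) {t : ℝ} (ht : t ≤ 0) {a b : ℝ} (hab : a ≤ b)
    (hsub : Icc a b ⊆ I) :
    ‖w b ^ t - w a ^ t‖ₑ ≤ ∫⁻ s in Ioc a b, ‖deriv (fun s => w s ^ t) s‖ₑ := by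
  have hloc : LocallyLipschitzOn (Icc a b) w :=
    (hw.locallyLipschitzOn hI).mono hsub
  obtain ⟨K, hK⟩ := hloc.exists_lipschitzOnWith_of_compact isCompact_Icc
  obtain ⟨c, hc, hcmin⟩ := isCompact_Icc.exists_isMinOn (nonempty_Icc.mpr hab) hK.continuousOn
  have hδ := hpos c (hsub hc)
  have hL := (lipschitzOnWith_rpow_of_nonpos hδ ht).comp hK (fun s hs => hcmin hs)
  rw [← uIcc_of_le hab] at hL
  have hac := hL.absolutelyContinuousOnInterval
  have heq := hac.integral_deriv_eq_sub
  rw [intervalIntegral.integral_of_le hab] at heq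
  change _ = w b ^ t - w a ^ t at heq
  rw [← heq]
  exact enorm_integral_le_lintegral_enorm _

lemma exists_gt_sublevel {w : ℝ → ℝ} {I : Set ℝ} (hI : IsOpen I)
    {τ : ℝ} (hc : IsCompact {s | s ∈ I ∧ w s ≤ τ}) {s₀ : ℝ} (hs₀ : s₀ ∈ I) :
    ∃ T ∈ I, s₀ ≤ T ∧ τ < w T := by
  by_contra! hcon
  have hc' : IsCompact ({s | s ∈ I ∧ w s ≤ τ} ∩ Ici s₀) := hc.inter_right isClosed_Ici
  obtain ⟨T, ⟨⟨hTI, -⟩, hT0⟩, hmax⟩ := hc'.exists_isMaxOn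
    ⟨s₀, ⟨hs₀, hcon s₀ hs₀ le_rfl⟩, self_mem_Ici⟩ continuousOn_id
  obtain ⟨ε, hε, hb⟩ := Metric.isOpen_iff.mp hI T hTI
  have hmem : T + ε / 2 ∈ I := hb (by simp [abs_of_pos hε]; linarith)
  have hge : s₀ ≤ T + ε / 2 := by linarith [mem_Ici.mp hT0]
  have := hmax ⟨⟨hmem, hcon _ hmem hge⟩, hge⟩
  simp at this
  linarith

lemma exists_lt_sublevel {w : ℝ → ℝ} {I : Set ℝ} (hI : IsOpen I)
    {τ : ℝ} (hc : IsCompact {s | s ∈ I ∧ w s ≤ τ}) {s₀ : ℝ} (hs₀ : s₀ ∈ I) :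
    ∃ T ∈ I, T ≤ s₀ ∧ τ < w T := by
  have hc' : IsCompact {s | s ∈ Neg.neg ⁻¹' I ∧ (w ∘ Neg.neg) s ≤ τ} :=
    (Homeomorph.neg ℝ).isCompact_preimage.mpr hc
  obtain ⟨T, hT, hT0, hwT⟩ := exists_gt_sublevel (hI.preimage continuous_neg) hc'
    (s₀ := -s₀) (by simpa using hs₀)
  exact ⟨-T, hT, by linarith, hwT⟩

lemma ofReal_le_lintegral_deriv_rpow {w : ℝ → ℝ} {I : Set ℝ} (hI : IsOpen I)
    (hw : ConvexOn ℝ I w) (hpos : ∀ s ∈ I, 0 < w s) {t : ℝ} (ht : t < 0)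
    (hc : ∀ τ, IsCompact {s | s ∈ I ∧ w s ≤ τ}) {s₀ : ℝ} (hs₀ : s₀ ∈ I) :
    ENNReal.ofReal (2 * w s₀ ^ t) ≤ ∫⁻ s in I, ‖deriv (fun s => w s ^ t) s‖ₑ := by
  refine ENNReal.le_of_forall_pos_le_add fun ε hε _ => ?_
  have hlim := (tendsto_rpow_neg_atTop (show 0 < -t by linarith)).eventually
    (gt_mem_nhds (show (0:ℝ) < ε / 2 by positivity))
  obtain ⟨τ, hτ, hτ0⟩ := (hlim.and (eventually_gt_atTop 0)).exists
  rw [neg_neg] at hτ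
  obtain ⟨T, hT, hsT, hwT⟩ := exists_gt_sublevel hI (hc τ) hs₀
  obtain ⟨S, hS, hSs, hwS⟩ := exists_lt_sublevel hI (hc τ) hs₀
  have hsmall : ∀ T, τ < w T → w T ^ t < ε / 2 := fun T hwT =>
    (Real.rpow_le_rpow_of_nonpos hτ0 hwT.le ht.le).trans_lt hτ
  have hord := hw.1.ordConnected
  have e1 := enorm_sub_le_lintegral_deriv_rpow hI hw hpos ht.le hsT (hord.out hs₀ hT)
  have e2 := enorm_sub_le_lintegral_deriv_rpow hI hw hpos ht.le hSs (hord.out hS hs₀)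
  have hdisj : Disjoint (Ioc S s₀) (Ioc s₀ T) := by
    rw [disjoint_left]; intro x hx hx'; exact absurd hx'.1 (not_lt.mpr hx.2)
  have hsub : Ioc S s₀ ∪ Ioc s₀ T ⊆ I :=
    union_subset (Ioc_subset_Icc_self.trans (hord.out hS hs₀))
      (Ioc_subset_Icc_self.trans (hord.out hs₀ hT))
  have hle := (lintegral_union (f := fun s => ‖deriv (fun s => w s ^ t) s‖ₑ) (μ := volume)
    measurableSet_Ioc hdisj).symm.trans_le (lintegral_mono_set hsub)
  have hn : ∀ x y : ℝ, ENNReal.ofReal (x - y) ≤ ‖x - y‖ₑ := fun x y => by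
    rw [Real.enorm_eq_ofReal_abs]; exact ENNReal.ofReal_le_ofReal (le_abs_self _)
  have e1' : ENNReal.ofReal (w s₀ ^ t - w T ^ t) ≤ ‖w T ^ t - w s₀ ^ t‖ₑ := by
    rw [enorm_sub_rev]; exact hn _ _
  have h3 : ENNReal.ofReal (2 * w s₀ ^ t) ≤
      (ENNReal.ofReal (w s₀ ^ t - w S ^ t) + ENNReal.ofReal (w s₀ ^ t - w T ^ t)) + ε := by
    have : (ε:ℝ≥0∞) = ENNReal.ofReal ε := by simp
    rw [this]
    refine le_trans (ENNReal.ofReal_le_ofReal ?_) ((ENNReal.ofReal_add_le).trans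
      (add_le_add_left ENNReal.ofReal_add_le _))
    linarith [hsmall T hwT, hsmall S hwS]
  refine h3.trans (add_le_add_left ?_ _)
  exact (add_le_add ((hn _ _).trans e2) (e1'.trans e1)).trans hle

lemma lintegral_deriv_rpow_le {w : ℝ → ℝ} (hw : ConvexOn ℝ univ w) (hcont : Continuous w)
    (hcoer : Tendsto w (cocompact ℝ) atTop) {τ : ℝ} (hτ0 : 0 < τ) (hτ : ∀ s, τ ≤ w s) {t : ℝ}
    (ht : t ≤ 0) :
    ∫⁻ s, ‖deriv (fun s => w s ^ t) s‖ₑ ≤ ENNReal.ofReal (2 * τ ^ t) := by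
  obtain ⟨s₀, hs₀⟩ := hcont.exists_forall_le hcoer
  have hpos : ∀ s, 0 < w s := fun s => hτ0.trans_le (hτ s)
  have hm : ∀ s, ∀ r ∈ segment ℝ s₀ s, w s ^ t ≤ w r ^ t := by
    intro s r hr
    have := hw.le_max_of_mem_segment (mem_univ _) (mem_univ _) hr
    rw [max_eq_right (hs₀ s)] at this
    exact Real.rpow_le_rpow_of_nonpos (hpos r) this ht
  refine (lintegral_enorm_deriv_le_of_unimodal (s := s₀)
    (fun x => Real.rpow_nonneg (hpos x).le _) ?_ ?_).trans ?_
  · intro x hx y hy hxy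
    exact hm x y (by rw [segment_symm, segment_eq_Icc hx]; exact ⟨hxy, hy⟩)
  · intro x hx y hy hxy
    exact hm y x (by rw [segment_eq_Icc hy]; exact ⟨hx, hxy⟩)
  · exact ENNReal.ofReal_le_ofReal (by
      have := Real.rpow_le_rpow_of_nonpos hτ0 (hτ s₀) ht
      linarith)

/-- The line parallel to the `i`-th axis over the point `y` of the coordinate hyperplane. -/
def axisLine {m : ℕ} (i : Fin (m + 1)) (y : Fin m → ℝ) (s : ℝ) : En (m + 1) :=
  WithLp.toLp 2 (i.insertNth s y)

section AxisLine
variable {m : ℕ} {i : Fin (m + 1)}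

@[simp] lemma axisLine_self (y : Fin m → ℝ) (s : ℝ) : axisLine i y s i = s := by
  simp [axisLine]

@[simp] lemma axisLine_succAbove (y : Fin m → ℝ) (s : ℝ) (j : Fin m) :
    axisLine i y s (i.succAbove j) = y j := by
  simp [axisLine]

lemma eq_axisLine_iff {y : Fin m → ℝ} {s : ℝ} {x : En (m + 1)} :
    x = axisLine i y s ↔ x i = s ∧ ∀ j, x (i.succAbove j) = y j := by
  constructor
  · rintro rfl; simp
  · rintro ⟨h1, h2⟩
    ext k
    rcases Fin.eq_self_or_eq_succAbove i k with rfl | ⟨j, rfl⟩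
    · simp [h1]
    · simp [h2]

lemma axisLine_eq (y : Fin m → ℝ) (s : ℝ) :
    axisLine i y s = axisLine i y 0 + s • EuclideanSpace.single i (1:ℝ) := by
  symm
  rw [eq_axisLine_iff]
  simp

lemma abs_le_norm_axisLine (y : Fin m → ℝ) (s : ℝ) : |s| ≤ ‖axisLine i y s‖ := by
  simpa using PiLp.norm_apply_le (axisLine i y s) i

lemma norm_le_norm_axisLine (y : Fin m → ℝ) (s : ℝ) : ‖y‖ ≤ ‖axisLine i y s‖ := by
  rw [pi_norm_le_iff_of_nonneg (norm_nonneg _)]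
  intro j
  simpa using PiLp.norm_apply_le (axisLine i y s) (i.succAbove j)

lemma hasDerivAt_axisLine (y : Fin m → ℝ) (s : ℝ) :
    HasDerivAt (axisLine i y) (EuclideanSpace.single i (1:ℝ)) s := by
  have : axisLine i y = fun s => axisLine i y 0 + s • EuclideanSpace.single i (1:ℝ) :=
    funext fun s => axisLine_eq y s
  rw [this]
  simpa using ((hasDerivAt_id s).smul_const (EuclideanSpace.single i (1:ℝ))).const_add
    (axisLine i y 0)

lemma continuous_axisLine (y : Fin m → ℝ) : Continuous (axisLine i y) :=
  continuous_iff_continuousAt.mpr fun s => (hasDerivAt_axisLine y s).continuousAt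

lemma HasGradientAt.hasDerivAt_axisLine {f : En (m + 1) → ℝ} {p : En (m + 1)} {y : Fin m → ℝ}
    {s : ℝ} (h : HasGradientAt f p (axisLine i y s)) :
    HasDerivAt (fun s => f (axisLine i y s)) (p i) s := by
  have := h.hasFDerivAt.comp_hasDerivAt s (_root_.hasDerivAt_axisLine (i := i) y s)
  rw [show InnerProductSpace.toDual ℝ (En (m + 1)) p (EuclideanSpace.single i (1:ℝ)) = p i by
    simp [EuclideanSpace.inner_single_right]] at this
  exact this

lemma ConvexOn.comp_axisLine {f : En (m + 1) → ℝ} {D : Set (En (m + 1))} (h : ConvexOn ℝ D f)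
    (y : Fin m → ℝ) : ConvexOn ℝ (axisLine i y ⁻¹' D) (fun s => f (axisLine i y s)) := by
  have e : axisLine i y = AffineMap.lineMap (axisLine i y 0)
      (axisLine i y 0 + EuclideanSpace.single i (1:ℝ)) := by
    funext s
    rw [axisLine_eq, AffineMap.lineMap_apply]
    simp [add_comm]
  have := h.comp_affineMap (AffineMap.lineMap (k := ℝ) (axisLine i y 0)
      (axisLine i y 0 + EuclideanSpace.single i (1:ℝ)))
  rwa [← e] at this

lemma measurePreserving_axisLine (i : Fin (m + 1)) :
    MeasurePreserving (fun z : ℝ × (Fin m → ℝ) => axisLine i z.2 z.1) volume volume :=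
  (PiLp.volume_preserving_toLp (Fin (m + 1))).comp
    (volume_preserving_piFinSuccAbove (fun _ => ℝ) i).symm

lemma lintegral_eq_axisLine (i : Fin (m + 1)) {f : En (m + 1) → ℝ≥0∞} (hf : Measurable f) :
    ∫⁻ x, f x = ∫⁻ y, ∫⁻ s, f (axisLine i y s) := by
  rw [← (measurePreserving_axisLine i).lintegral_comp hf, Measure.volume_eq_prod]
  exact lintegral_prod_symm' (fun z => f (axisLine i z.2 z.1))
    (hf.comp (measurePreserving_axisLine i).measurable)

lemma measurable_lintegral_axisLine (i : Fin (m + 1)) {f : En (m + 1) → ℝ≥0∞}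
    (hf : Measurable f) : Measurable fun y => ∫⁻ s, f (axisLine i y s) :=
  (hf.comp (measurePreserving_axisLine i).measurable).lintegral_prod_left'

lemma ae_ae_axisLine (i : Fin (m + 1)) {p : En (m + 1) → Prop} (hp : ∀ᵐ x, p x) :
    ∀ᵐ y, ∀ᵐ s, p (axisLine i y s) := by
  have h1 := (measurePreserving_axisLine i).quasiMeasurePreserving.ae hp
  have h2 := (Measure.measurePreserving_swap (μ := (volume : Measure (Fin m → ℝ)))
    (ν := (volume : Measure ℝ))).quasiMeasurePreserving.ae h1
  exact Measure.ae_ae_of_ae_prod h2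

lemma ae_axisLine_notMem (i : Fin (m + 1)) {N : Set (En (m + 1))} (hN : μH[m] N = 0) :
    ∀ᵐ y, ∀ s, axisLine i y s ∉ N := by
  let P : En (m + 1) → (Fin m → ℝ) := fun x j => x (i.succAbove j)
  have hP : LipschitzWith 1 P := by
    refine LipschitzWith.of_dist_le_mul fun x y => ?_
    rw [NNReal.coe_one, one_mul, dist_pi_le_iff dist_nonneg]
    intro j
    rw [dist_eq_norm, dist_eq_norm]
    exact PiLp.norm_apply_le (x - y) (i.succAbove j)
  have h0 : μH[m] (P '' N) = 0 := by
    have := hP.hausdorffMeasure_image_le (d := m) (Nat.cast_nonneg m) N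
    rw [hN, mul_zero] at this
    exact le_antisymm this bot_le
  have e : (μH[m] : Measure (Fin m → ℝ)) = volume := by
    simpa using hausdorffMeasure_pi_real (ι := Fin m)
  rw [e] at h0
  filter_upwards [compl_mem_ae_iff.mpr h0] with y hy s hs
  exact hy ⟨_, hs, funext fun j => by simp [P]⟩

end AxisLine

lemma enorm_mul_rpow_eq_deriv {w : ℝ → ℝ} {p s β : ℝ} (hβ : 1 < β) (hw : 0 < w s)
    (hp : HasDerivAt w p s) :
    ‖p‖ₑ * ENNReal.ofReal (w s ^ (-β)) =
      ENNReal.ofReal ((β - 1)⁻¹) * ‖deriv (fun s => w s ^ (1 - β)) s‖ₑ := by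
  have h := hp.rpow_const (p := 1 - β) (Or.inl hw.ne')
  rw [h.deriv, Real.enorm_eq_ofReal_abs, Real.enorm_eq_ofReal_abs,
    ← ENNReal.ofReal_mul (abs_nonneg _), ← ENNReal.ofReal_mul (inv_nonneg.mpr (by linarith))]
  have e : 1 - β - 1 = -β := by ring
  rw [e, abs_mul, abs_mul, abs_of_neg (by linarith : 1 - β < 0),
    abs_of_nonneg (Real.rpow_nonneg hw.le _)]
  congr 1
  have : β - 1 ≠ 0 := by linarith
  field_simp
  ring

namespace ConvexPotential
variable {m : ℕ} {D : Set (En (m + 1))} {u : En (m + 1) → ℝ}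

lemma ofReal_le_lintegral_axisLine (h : ConvexPotential D u) {a β : ℝ} (ha : 0 < a) (hβ : 1 < β)
    (hg : ∀ x ∈ D, a * (1 + ‖x‖) ≤ u x) (hnull : μH[m] (D \ interior D) = 0)
    {G : En (m + 1) → En (m + 1)} (hG : ∀ᵐ x, x ∈ D → HasGradientAt u (G x) x) (i : Fin (m + 1)) :
    ∀ᵐ y, ∀ s₀, axisLine i y s₀ ∈ D →
      ENNReal.ofReal ((β - 1)⁻¹) * ENNReal.ofReal (2 * u (axisLine i y s₀) ^ (1 - β)) ≤
        ∫⁻ s, D.indicator (fun x => ‖G x i‖ₑ * ENNReal.ofReal (u x ^ (-β))) (axisLine i y s) := by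
  filter_upwards [ae_ae_axisLine i hG, ae_axisLine_notMem i hnull] with y hy hyN s₀ hs₀
  have hpre : axisLine i y ⁻¹' D = axisLine i y ⁻¹' interior D := by
    refine Subset.antisymm (fun s hs => ?_) (preimage_mono interior_subset)
    by_contra hcon
    exact hyN s ⟨hs, hcon⟩
  have hI : IsOpen (axisLine i y ⁻¹' D) := by
    rw [hpre]; exact isOpen_interior.preimage (continuous_axisLine y)
  have hc : ∀ τ, IsCompact {s | s ∈ axisLine i y ⁻¹' D ∧ u (axisLine i y s) ≤ τ} := by
    intro τ
    refine Metric.isCompact_of_isClosed_isBounded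
      ((h.closed τ).preimage (continuous_axisLine y))
      ((Metric.isBounded_closedBall (x := (0 : ℝ)) (r := τ / a)).subset fun s hs => ?_)
    rw [mem_closedBall_zero_iff, le_div_iff₀ ha, Real.norm_eq_abs]
    have h1 := hg _ hs.1
    have h2 := abs_le_norm_axisLine (i := i) y s
    nlinarith [hs.2]
  have key := ofReal_le_lintegral_deriv_rpow hI (h.convexOn.comp_axisLine (i := i) y)
    (fun s hs => h.pos _ hs) (t := 1 - β) (by linarith) hc hs₀
  refine (mul_le_mul_right key _).trans (le_of_eq ?_)
  rw [← lintegral_const_mul' _ _ ENNReal.ofReal_ne_top, ← lintegral_indicator hI.measurableSet]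
  refine lintegral_congr_ae ?_
  filter_upwards [hy] with s hs
  by_cases hsD : axisLine i y s ∈ D
  · rw [indicator_of_mem hsD, indicator_of_mem (by exact hsD)]
    exact (enorm_mul_rpow_eq_deriv (w := fun s => u (axisLine i y s)) hβ (h.pos _ hsD)
      (hs hsD).hasDerivAt_axisLine).symm
  · rw [indicator_of_notMem hsD, indicator_of_notMem (by exact hsD)]

lemma lintegral_axisLine_lipReg_le (h : ConvexPotential D u) (hne : D.Nonempty) {a β : ℝ}
    (ha : 0 < a) (hβ : 1 < β) (hg : ∀ x ∈ D, a * (1 + ‖x‖) ≤ u x) {k : NNReal} (hk : a ≤ k)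
    (i : Fin (m + 1)) :
    ∀ᵐ y, ∀ τ > 0, (∀ s, τ ≤ lipReg D u k (axisLine i y s)) →
      ∫⁻ s, ‖gradient (lipReg D u k) (axisLine i y s) i‖ₑ *
        ENNReal.ofReal (lipReg D u k (axisLine i y s) ^ (-β)) ≤
      ENNReal.ofReal ((β - 1)⁻¹) * ENNReal.ofReal (2 * τ ^ (1 - β)) := by
  have hlip := h.lipschitzWith_lipReg hne k
  filter_upwards [ae_ae_axisLine i hlip.ae_hasGradientAt] with y hy τ hτ0 hτ
  have hcoer : Tendsto (fun s => lipReg D u k (axisLine i y s)) (cocompact ℝ) atTop := by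
    refine tendsto_atTop_mono (f := fun s : ℝ => a * ‖s‖) (fun s => ?_)
      (tendsto_norm_cocompact_atTop.const_mul_atTop ha)
    have h1 := growth_lipReg hne hg ha hk (axisLine i y s)
    have h2 := abs_le_norm_axisLine (i := i) y s
    rw [Real.norm_eq_abs]
    nlinarith
  have key := lintegral_deriv_rpow_le (w := fun s => lipReg D u k (axisLine i y s))
    (by simpa using (h.convexOn_lipReg hne k.2).comp_axisLine (i := i) y)
    (hlip.continuous.comp (continuous_axisLine y)) hcoer hτ0 hτ (t := 1 - β) (by linarith)
  refine le_trans (le_of_eq ?_) (mul_le_mul_right key _)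
  rw [← lintegral_const_mul' _ _ ENNReal.ofReal_ne_top]
  refine lintegral_congr_ae ?_
  filter_upwards [hy] with s hs
  exact enorm_mul_rpow_eq_deriv (w := fun s => lipReg D u k (axisLine i y s)) hβ
    (hτ0.trans_le (hτ s)) hs.hasDerivAt_axisLine

end ConvexPotential

lemma isClosed_range_axisLine {m : ℕ} (i : Fin (m + 1)) (y : Fin m → ℝ) :
    IsClosed (range (axisLine i y)) := by
  have : range (axisLine i y) = ⋂ j, {x : En (m + 1) | x (i.succAbove j) = y j} := by
    ext x
    simp only [mem_range, mem_iInter, mem_ofPred_eq]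
    constructor
    · rintro ⟨s, rfl⟩ j; simp
    · intro hx; exact ⟨x i, (eq_axisLine_iff.mpr ⟨rfl, hx⟩).symm⟩
  rw [this]
  exact isClosed_iInter fun j => isClosed_eq (by fun_prop) continuous_const

lemma norm_le_sum_abs {n : ℕ} (x : En n) : ‖x‖ₑ ≤ ∑ i, ‖x i‖ₑ := by
  have := (EuclideanSpace.basisFun (Fin n) ℝ).sum_repr x
  calc ‖x‖ₑ = ‖∑ i, x i • EuclideanSpace.single i (1:ℝ)‖ₑ := by
        congr 1; simpa using this.symm
    _ ≤ ∑ i, ‖x i • EuclideanSpace.single i (1:ℝ)‖ₑ := enorm_sum_le _ _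
    _ = _ := by
        refine Finset.sum_congr rfl fun i _ => ?_
        rw [enorm_smul]
        simp [enorm_eq_nnnorm]

namespace ConvexPotential
variable {m : ℕ} {D : Set (En (m + 1))} {u : En (m + 1) → ℝ}

lemma measurable_lipReg {n : ℕ} {D : Set (En n)} {u : En n → ℝ} (h : ConvexPotential D u)
    (hne : D.Nonempty) {k : ℝ} (hk : 0 ≤ k) : Measurable (lipReg D u k) :=
  (h.lipschitzWith_lipReg hne ⟨k, hk⟩).continuous.measurable

lemma limsup_lintegral_gradient_le (h : ConvexPotential D u) (hne : D.Nonempty) {a β : ℝ}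
    (ha : 0 < a) (hβ : ((m + 1 : ℕ) : ℝ) + 1 < β) (hg : ∀ x ∈ D, a * (1 + ‖x‖) ≤ u x)
    (hnull : μH[m] (D \ interior D) = 0) {G : En (m + 1) → En (m + 1)} (hGm : Measurable G)
    (hG : ∀ᵐ x, x ∈ D → HasGradientAt u (G x) x) (i : Fin (m + 1)) :
    limsup (fun k : ℕ => ∫⁻ x, ‖gradient (lipReg D u k) x i‖ₑ *
      ENNReal.ofReal (lipReg D u k x ^ (-β))) atTop ≤
        ∫⁻ x in D, ‖G x i‖ₑ * ENNReal.ofReal (u x ^ (-β)) := by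
  have hm0 : (0:ℝ) ≤ m := Nat.cast_nonneg m
  push_cast at hβ
  have hβ1 : 1 < β := by linarith
  have hc0 : 0 < (β - 1)⁻¹ := inv_pos.mpr (by linarith)
  set F : ℕ → En (m + 1) → ℝ≥0∞ := fun k x => ‖gradient (lipReg D u k) x i‖ₑ *
      ENNReal.ofReal (lipReg D u k x ^ (-β)) with hF
  have hFm : ∀ k, Measurable (F k) := fun k =>
    ((measurable_coord i).comp (measurable_gradient _)).enorm.mul
      ((h.measurable_lipReg hne (Nat.cast_nonneg k)).pow_const _).ennreal_ofReal
  obtain ⟨K, hK⟩ := exists_nat_ge a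
  set B : En (m + 1) → ℝ≥0∞ := D.indicator fun x => ‖G x i‖ₑ * ENNReal.ofReal (u x ^ (-β))
  have hBm : Measurable B :=
    (((measurable_coord i).comp hGm).enorm.mul
      (h.measurable.pow_const _).ennreal_ofReal).indicator h.measurableSet
  rw [← lintegral_indicator h.measurableSet, lintegral_eq_axisLine i hBm,
    ← limsup_nat_add (fun k : ℕ => ∫⁻ x, F k x) K]
  simp_rw [fun k => lintegral_eq_axisLine i (hFm k)]
  have hup := fun k : ℕ => h.lintegral_axisLine_lipReg_le hne ha hβ1 hg
    (k := ((k + K : ℕ) : NNReal)) (by push_cast; linarith [(Nat.cast_nonneg k : (0:ℝ) ≤ k)]) i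
  rw [← ae_all_iff] at hup
  refine (limsup_lintegral_le (fun y => ENNReal.ofReal ((β - 1)⁻¹) *
    ENNReal.ofReal (2 * (a * (1 + ‖y‖)) ^ (1 - β)))
    (fun k => measurable_lintegral_axisLine i (hFm _)) ?_ ?_).trans ?_
  · intro k
    filter_upwards [hup] with y hy
    refine hy k _ (by positivity) fun s => ?_
    refine le_trans ?_ (growth_lipReg hne hg ha (k := ((k + K : ℕ) : NNReal)) ?_ _)
    · have := norm_le_norm_axisLine (i := i) y s
      gcongr
    · push_cast; linarith [(Nat.cast_nonneg k : (0:ℝ) ≤ k)]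
  · have hfin := finite_integral_one_add_norm (E := Fin m → ℝ) (μ := volume) (r := β - 1)
      (by simp; linarith)
    have e : ∀ y : Fin m → ℝ, ENNReal.ofReal ((β - 1)⁻¹) *
        ENNReal.ofReal (2 * (a * (1 + ‖y‖)) ^ (1 - β)) =
        ENNReal.ofReal ((β - 1)⁻¹ * (2 * a ^ (1 - β))) *
          ENNReal.ofReal ((1 + ‖y‖) ^ (-(β - 1))) := by
      intro y
      rw [← ENNReal.ofReal_mul hc0.le, ← ENNReal.ofReal_mul (by positivity),
        Real.mul_rpow ha.le (by positivity), neg_sub]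
      congr 1
      ring
    simp_rw [e]
    rw [lintegral_const_mul' _ _ ENNReal.ofReal_ne_top]
    exact (ENNReal.mul_lt_top ENNReal.ofReal_lt_top hfin).ne
  · refine lintegral_mono_ae ?_
    filter_upwards [hup, h.ofReal_le_lintegral_axisLine ha hβ1 hg hnull hG i] with y hy hlow
    refine le_of_forall_gt_imp_ge_of_dense fun b hb => ?_
    rcases eq_or_ne b ⊤ with rfl | hbtop
    · exact le_top
    have hb0 : 0 < b.toReal := ENNReal.toReal_pos (bot_le.trans_lt hb).ne' hbtop
    set τ : ℝ := (b.toReal * (β - 1) / 2) ^ (1 - β)⁻¹ with hτ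
    have hb1 : 0 < b.toReal * (β - 1) / 2 := by
      have : 0 < β - 1 := by linarith
      positivity
    have hτ0 : 0 < τ := Real.rpow_pos_of_pos hb1 _
    have hτp : τ ^ (1 - β) = b.toReal * (β - 1) / 2 := by
      rw [hτ, ← Real.rpow_mul hb1.le, inv_mul_cancel₀ (sub_ne_zero.mpr hβ1.ne), Real.rpow_one]
    have heq : ENNReal.ofReal ((β - 1)⁻¹) * ENNReal.ofReal (2 * τ ^ (1 - β)) = b := by
      rw [← ENNReal.ofReal_mul hc0.le, hτp]
      have : β - 1 ≠ 0 := by linarith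
      rw [show (β - 1)⁻¹ * (2 * (b.toReal * (β - 1) / 2)) = b.toReal by field_simp]
      exact ENNReal.ofReal_toReal hbtop
    have hdisj : Disjoint {x | x ∈ D ∧ u x ≤ τ} (range (axisLine i y)) := by
      rw [disjoint_right]
      rintro _ ⟨s, rfl⟩ ⟨hsD, hsτ⟩
      have h1 := (hlow s hsD).trans_lt hb
      rw [← heq] at h1
      refine absurd h1 (not_lt.mpr ?_)
      have h3 : τ ^ (1 - β) ≤ u (axisLine i y s) ^ (1 - β) :=
        Real.rpow_le_rpow_of_nonpos (h.pos _ hsD) hsτ (by linarith)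
      exact mul_le_mul_right (ENNReal.ofReal_le_ofReal (by linarith)) _
    have hev := ((tendsto_natCast_atTop_atTop (R := ℝ)).comp (tendsto_add_atTop_nat K)).eventually
      (h.eventually_le_lipReg hne ha hg (isClosed_range_axisLine i y) hdisj)
    refine limsup_le_of_le (by isBoundedDefault) ?_
    filter_upwards [hev] with k hk
    refine (hy k τ hτ0 fun s => hk _ ⟨s, rfl⟩).trans heq.le

lemma tendsto_lintegral_gradient_coord_compl (h : ConvexPotential D u) (hne : D.Nonempty)
    {a β : ℝ} (ha : 0 < a) (hβ : ((m + 1 : ℕ) : ℝ) + 1 < β) (hg : ∀ x ∈ D, a * (1 + ‖x‖) ≤ u x)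
    (hnull : μH[m] (D \ interior D) = 0) {G : En (m + 1) → En (m + 1)} (hGm : Measurable G)
    (hG : ∀ᵐ x, x ∈ D → HasGradientAt u (G x) x)
    (hfin : ∫⁻ x in D, ‖G x‖ₑ * ENNReal.ofReal (u x ^ (-β)) ≠ ⊤) (i : Fin (m + 1)) :
    Tendsto (fun k : ℕ => ∫⁻ x in {x | x ∈ D ∧ ‖G x‖ ≤ k}ᶜ, ‖gradient (lipReg D u k) x i‖ₑ *
      ENNReal.ofReal (lipReg D u k x ^ (-β))) atTop (𝓝 0) := by
  have hlim := h.limsup_lintegral_gradient_le hne ha hβ hg hnull hGm hG i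
  set B := ∫⁻ x in D, ‖G x i‖ₑ * ENNReal.ofReal (u x ^ (-β)) with hB
  have hBfin : B ≠ ⊤ := by
    refine ne_top_of_le_ne_top hfin (lintegral_mono fun x => ?_)
    gcongr ?_ * _
    rw [← ofReal_norm, ← ofReal_norm]
    exact ENNReal.ofReal_le_ofReal (PiLp.norm_apply_le (G x) i)
  have hSm : ∀ k : ℕ, MeasurableSet {x | x ∈ D ∧ ‖G x‖ ≤ k} := fun k =>
    h.measurableSet.inter (hGm.norm measurableSet_Iic)
  have hinner : Tendsto (fun k : ℕ => ∫⁻ x in {x | x ∈ D ∧ ‖G x‖ ≤ k},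
      ‖gradient (lipReg D u k) x i‖ₑ * ENNReal.ofReal (lipReg D u k x ^ (-β))) atTop (𝓝 B) := by
    have e : ∀ k : ℕ, (∫⁻ x in {x | x ∈ D ∧ ‖G x‖ ≤ k}, ‖gradient (lipReg D u k) x i‖ₑ *
        ENNReal.ofReal (lipReg D u k x ^ (-β))) =
        ∫⁻ x in {x | x ∈ D ∧ ‖G x‖ ≤ k}, ‖G x i‖ₑ * ENNReal.ofReal (u x ^ (-β)) := by
      intro k
      refine setLIntegral_congr_fun_ae (hSm k) ?_
      have hlip := (h.lipschitzWith_lipReg hne k).ae_hasGradientAt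
      rw [NNReal.coe_natCast] at hlip
      filter_upwards [hG, hlip] with x hx hx' hxS
      rw [h.lipReg_eq_self (Nat.cast_nonneg k) hxS.1 (hx hxS.1) hxS.2,
        h.gradient_lipReg_eq (Nat.cast_nonneg k) hxS.1 (hx hxS.1) hxS.2 hx']
    simp_rw [e]
    have hmono : Monotone fun k : ℕ => {x | x ∈ D ∧ ‖G x‖ ≤ k} := fun k l hkl x hx =>
      ⟨hx.1, hx.2.trans (by exact_mod_cast hkl)⟩
    have hU : ⋃ k : ℕ, {x | x ∈ D ∧ ‖G x‖ ≤ k} = D := by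
      ext x
      simp only [mem_iUnion, mem_ofPred_eq, exists_and_left, and_iff_left_iff_imp]
      exact fun _ => exists_nat_ge _
    rw [hB]
    nth_rewrite 2 [← hU]
    rw [setLIntegral_iUnion_of_directed _ (directed_of_isDirected_le hmono)]
    exact tendsto_atTop_iSup fun k l hkl => lintegral_mono_set (hmono hkl)
  rw [ENNReal.tendsto_nhds_zero]
  intro ε hε
  rcases eq_or_ne ε ⊤ with rfl | hεt
  · exact Eventually.of_forall fun _ => le_top
  have hε2 : ε / 2 ≠ 0 := (ENNReal.half_pos hε.ne').ne'
  have h1 := eventually_lt_of_limsup_lt (hlim.trans_lt (ENNReal.lt_add_right hBfin hε2))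
  have h2 : ∀ᶠ k : ℕ in atTop, B ≤ (∫⁻ x in {x | x ∈ D ∧ ‖G x‖ ≤ k},
      ‖gradient (lipReg D u k) x i‖ₑ * ENNReal.ofReal (lipReg D u k x ^ (-β))) + ε / 2 := by
    rcases eq_or_ne B 0 with h0 | h0
    · exact Eventually.of_forall fun _ => by rw [h0]; exact bot_le
    · filter_upwards [hinner.eventually (lt_mem_nhds (ENNReal.sub_lt_self hBfin h0 hε2))] with k hk
      exact tsub_le_iff_right.mp hk.le
  filter_upwards [h1, h2] with k hk1 hk2
  rw [← lintegral_add_compl _ (hSm k), add_comm] at hk1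
  set X := ∫⁻ x in {x | x ∈ D ∧ ‖G x‖ ≤ k}ᶜ, ‖gradient (lipReg D u k) x i‖ₑ *
      ENNReal.ofReal (lipReg D u k x ^ (-β))
  set Y := ∫⁻ x in {x | x ∈ D ∧ ‖G x‖ ≤ k},
      ‖gradient (lipReg D u k) x i‖ₑ * ENNReal.ofReal (lipReg D u k x ^ (-β))
  have hY : Y ≠ ⊤ := fun hY => by simp [hY] at hk1
  have : X + Y ≤ ε + Y := by
    calc X + Y ≤ B + ε / 2 := hk1.le
      _ ≤ Y + ε / 2 + ε / 2 := by gcongr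
      _ = ε + Y := by rw [add_assoc, ENNReal.add_halves, add_comm]
  exact (ENNReal.add_le_add_iff_right hY).mp this

/-- The gradients of the Lipschitz regularizations carry asymptotically no mass outside of the
region where they agree with the gradient of `u`. -/
theorem tendsto_lintegral_gradient_compl (h : ConvexPotential D u) (hne : D.Nonempty)
    {a β : ℝ} (ha : 0 < a) (hβ : ((m + 1 : ℕ) : ℝ) + 1 < β) (hg : ∀ x ∈ D, a * (1 + ‖x‖) ≤ u x)
    (hnull : μH[m] (D \ interior D) = 0) {G : En (m + 1) → En (m + 1)} (hGm : Measurable G)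
    (hG : ∀ᵐ x, x ∈ D → HasGradientAt u (G x) x)
    (hfin : ∫⁻ x in D, ‖G x‖ₑ * ENNReal.ofReal (u x ^ (-β)) ≠ ⊤) :
    Tendsto (fun k : ℕ => ∫⁻ x in {x | x ∈ D ∧ ‖G x‖ ≤ k}ᶜ, ‖gradient (lipReg D u k) x‖ₑ *
      ENNReal.ofReal (lipReg D u k x ^ (-β))) atTop (𝓝 0) := by
  have hsum := tendsto_finsetSum Finset.univ fun i _ =>
    h.tendsto_lintegral_gradient_coord_compl hne ha hβ hg hnull hGm hG hfin i
  rw [Finset.sum_const_zero] at hsum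
  refine tendsto_of_tendsto_of_tendsto_of_le_of_le tendsto_const_nhds hsum (fun _ => bot_le)
    fun k => ?_
  have hk : Measurable (lipReg D u (k:ℝ)) := h.measurable_lipReg hne (Nat.cast_nonneg k)
  rw [← lintegral_finsetSum (f := fun i x => ‖gradient (lipReg D u k) x i‖ₑ *
    ENNReal.ofReal (lipReg D u k x ^ (-β))) _ fun i _ => ((measurable_coord i).comp
    (measurable_gradient _)).enorm.mul (hk.pow_const _).ennreal_ofReal]
  refine lintegral_mono fun x => ?_
  rw [← Finset.sum_mul]
  gcongr
  exact norm_le_sum_abs _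

end ConvexPotential

section Fill
variable {n : ℕ} {G : En n → En n} {γ : Measure (En n × En n)} {f : Measure (En n)} {R : ℝ}

lemma integrable_norm_of_map_fst (hγ : γ.map Prod.fst = f) (hG : Integrable G f) :
    Integrable (fun z : En n × En n => ‖G z.1‖) γ := by
  have : Integrable G (γ.map Prod.fst) := by rwa [hγ]
  exact (this.comp_measurable measurable_fst).norm

lemma integrable_inner_of_bounded (hγ : γ.map Prod.fst = f) (hGm : Measurable G)
    (hG : Integrable G f) (hR : ∀ᵐ z ∂γ, ‖z.2‖ ≤ R) (x₀ : En n) :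
    Integrable (fun z : En n × En n => ⟪G z.1, z.2 - x₀⟫) γ := by
  refine ((integrable_norm_of_map_fst hγ hG).mul_const (R + ‖x₀‖)).mono' ?_ ?_
  · exact ((hGm.comp measurable_fst).inner (measurable_snd.sub_const x₀)).aestronglyMeasurable
  · filter_upwards [hR] with z hz
    refine (norm_inner_le_norm _ _).trans ?_
    gcongr
    exact (norm_sub_le _ _).trans (by linarith)

lemma neg_le_integral_inner_of_bounded (hγ : γ.map Prod.fst = f) (hGm : Measurable G)
    (hG : Integrable G f) (hR : ∀ᵐ z ∂γ, ‖z.2‖ ≤ R) (x₀ : En n) :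
    -((R + ‖x₀‖) * ∫ x, ‖G x‖ ∂f) ≤ ∫ z, ⟪G z.1, z.2 - x₀⟫ ∂γ := by
  have e : ∫ x, ‖G x‖ ∂f = ∫ z, ‖G z.1‖ ∂γ := by
    rw [← hγ, integral_map measurable_fst.aemeasurable hGm.norm.aestronglyMeasurable]
  rw [e, ← integral_const_mul, ← integral_neg]
  refine integral_mono_ae ((integrable_norm_of_map_fst hγ hG).const_mul _).neg
    (integrable_inner_of_bounded hγ hGm hG hR x₀) ?_
  filter_upwards [hR] with z hz
  have h1 := (abs_le.mp (abs_real_inner_le_norm (G z.1) (z.2 - x₀))).1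
  have h2 : ‖z.2 - x₀‖ ≤ R + ‖x₀‖ := (norm_sub_le _ _).trans (by linarith)
  have h3 := mul_le_mul_of_nonneg_left h2 (norm_nonneg (G z.1))
  linarith

/-- A partial plan can be completed to a full plan at a controlled cost. -/
lemma exists_completed_plan {ν ρ : Measure (En n)} [IsProbabilityMeasure ν]
    [IsProbabilityMeasure ρ] {A : Set (En n)} (hA : MeasurableSet A) {θ : NNReal} (hθ : θ ≤ 1)
    (h1 : γ.map Prod.fst = ν.restrict A) (h2 : θ • γ.map Prod.snd ≤ ρ)
    (hR : ρ (Metric.closedBall 0 R)ᶜ = 0) (hγR : ∀ᵐ z ∂γ, ‖z.2‖ ≤ R)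
    (hGm : Measurable G) (hG : Integrable G ν) (x₀ : En n) :
    ∃ γ' : Measure (En n × En n), γ'.map Prod.fst = ν ∧ γ'.map Prod.snd = ρ ∧
      Integrable (fun z => ⟪G z.1, z.2 - x₀⟫) γ' ∧
      θ * (∫ z, ⟪G z.1, z.2 - x₀⟫ ∂γ) -
        (R + ‖x₀‖) * ((∫ x, ‖G x‖ ∂ν) - θ * ∫ x in A, ‖G x‖ ∂ν) ≤
          ∫ z, ⟪G z.1, z.2 - x₀⟫ ∂γ' := by
  set f : Measure (En n) := ν.restrict Aᶜ + (1 - θ) • ν.restrict A with hf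
  set g : Measure (En n) := ρ - θ • γ.map Prod.snd with hg
  have hγfin : IsFiniteMeasure γ := by
    refine ⟨?_⟩
    rw [univ_of_map_fst h1]
    exact measure_lt_top _ _
  have hfν : f + θ • ν.restrict A = ν := by
    rw [hf, add_assoc, ← add_smul, tsub_add_cancel_of_le hθ, one_smul, add_comm,
      Measure.restrict_add_restrict_compl hA]
  have hgρ : g + θ • γ.map Prod.snd = ρ := Measure.sub_add_cancel_of_le h2
  have hmass : f univ = g univ := by
    have e1 : f univ + θ • (ν.restrict A) univ = 1 := by
      rw [← measure_univ (μ := ν)]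
      conv_rhs => rw [← hfν]
      simp
    have e2 : g univ + θ • (γ.map Prod.snd) univ = 1 := by
      rw [← measure_univ (μ := ρ)]
      conv_rhs => rw [← hgρ]
      simp
    have e3 : (γ.map Prod.snd) univ = (ν.restrict A) univ := by
      rw [← h1, Measure.map_apply measurable_snd .univ, Measure.map_apply measurable_fst .univ,
        preimage_univ, preimage_univ]
    rw [e3] at e2
    refine (ENNReal.add_left_inj ?_).mp (e1.trans e2.symm)
    rw [ENNReal.smul_def, smul_eq_mul]
    exact ENNReal.mul_ne_top ENNReal.coe_ne_top (measure_ne_top _ _)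
  have hgle : g ≤ ρ := Measure.sub_le
  have : IsFiniteMeasure g := isFiniteMeasure_of_le ρ hgle
  obtain ⟨κ, hκ1, hκ2⟩ := exists_coupling f g hmass
  have hfle : f ≤ ν := by
    conv_rhs => rw [← hfν]
    exact Measure.le_add_right le_rfl
  have hGf : Integrable G f := hG.mono_measure hfle
  have hκR : ∀ᵐ z ∂κ, ‖z.2‖ ≤ R := by
    filter_upwards [ae_of_map_snd hκ2 (A := Metric.closedBall (0 : En n) R)
      Metric.isClosed_closedBall.measurableSet (le_antisymm ((hgle _).trans hR.le) bot_le)]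
      with z hz
    exact mem_closedBall_zero_iff.mp hz
  have hκ := neg_le_integral_inner_of_bounded hκ1 hGm hGf hκR x₀
  have hfG : ∫ x, ‖G x‖ ∂f = (∫ x, ‖G x‖ ∂ν) - θ * ∫ x in A, ‖G x‖ ∂ν := by
    have hi : Integrable (fun x => ‖G x‖) (θ • ν.restrict A) :=
      (hG.restrict (s := A)).norm.smul_measure_nnreal
    have : ∫ x, ‖G x‖ ∂ν = (∫ x, ‖G x‖ ∂f) + θ * ∫ x in A, ‖G x‖ ∂ν := by
      conv_lhs => rw [← hfν]
      rw [integral_add_measure hGf.norm hi, integral_smul_nnreal_measure]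
      rfl
    linarith
  have hIκ := integrable_inner_of_bounded hκ1 hGm hGf hκR x₀
  have hIγ := integrable_inner_of_bounded h1 hGm (hG.restrict (s := A)) hγR x₀
  have hIγ' : Integrable (fun z => ⟪G z.1, z.2 - x₀⟫) (θ • γ) := hIγ.smul_measure_nnreal
  refine ⟨θ • γ + κ, ?_, ?_, hIγ'.add_measure hIκ, ?_⟩
  · rw [Measure.map_add _ _ measurable_fst, Measure.map_smul, h1, hκ1, add_comm, hfν]
  · rw [Measure.map_add _ _ measurable_snd, Measure.map_smul, hκ2, add_comm, hgρ]
  · rw [integral_add_measure hIγ' hIκ, integral_smul_nnreal_measure, ← hfG]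
    have : θ • (∫ z, ⟪G z.1, z.2 - x₀⟫ ∂γ) = (θ:ℝ) * ∫ z, ⟪G z.1, z.2 - x₀⟫ ∂γ := rfl
    rw [this]
    linarith

end Fill

/-- The measure with density `u ^ (-β)` on `D`. -/
def potMeasure {n : ℕ} (β : ℝ) (D : Set (En n)) (u : En n → ℝ) : Measure (En n) :=
  volume.withDensity (D.indicator fun x => ENNReal.ofReal (u x ^ (-β)))

/-- The part of `D` where the slope `G` has norm at most `k`. -/
def slopeSet {n : ℕ} (D : Set (En n)) (G : En n → En n) (k : ℝ) : Set (En n) :=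
  {x | x ∈ D ∧ ‖G x‖ ≤ k}

lemma slopeSet_mono {n : ℕ} (D : Set (En n)) (G : En n → En n) : Monotone (slopeSet D G) :=
  fun _ _ hkl _ hx => ⟨hx.1, hx.2.trans hkl⟩

namespace ConvexPotential
variable {n : ℕ} {D : Set (En n)} {u : En n → ℝ} {G : En n → En n}

lemma measurableSet_slopeSet (h : ConvexPotential D u) (hGm : Measurable G) (k : ℝ) :
    MeasurableSet (slopeSet D G k) :=
  h.measurableSet.inter (hGm.norm measurableSet_Iic)

lemma ae_lipReg_eq (h : ConvexPotential D u) (hG : ∀ᵐ x, x ∈ D → HasGradientAt u (G x) x)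
    (k : NNReal) : ∀ᵐ x, x ∈ slopeSet D G k →
      lipReg D u k x = u x ∧ gradient (lipReg D u k) x = G x := by
  rcases D.eq_empty_or_nonempty with rfl | hne
  · exact ae_of_all _ fun x hx => absurd hx.1 (notMem_empty x)
  filter_upwards [hG, (h.lipschitzWith_lipReg hne k).ae_hasGradientAt] with x hx hx' hxS
  exact ⟨h.lipReg_eq_self k.2 hxS.1 (hx hxS.1) hxS.2,
    h.gradient_lipReg_eq k.2 hxS.1 (hx hxS.1) hxS.2 hx'⟩

lemma powMeasure_lipReg_restrict (h : ConvexPotential D u)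
    (hG : ∀ᵐ x, x ∈ D → HasGradientAt u (G x) x) (k : NNReal) (β : ℝ) {A : Set (En n)}
    (hA : MeasurableSet A) (hAS : A ⊆ slopeSet D G k) :
    (powMeasure β (lipReg D u k)).restrict A = (potMeasure β D u).restrict A := by
  rw [powMeasure, potMeasure, restrict_withDensity hA, restrict_withDensity hA]
  refine withDensity_congr_ae ((ae_restrict_iff' hA).mpr ?_)
  filter_upwards [h.ae_lipReg_eq hG k] with x hx hxA
  rw [indicator_of_mem (hAS hxA).1, (hx (hAS hxA)).1]

lemma exists_partial_plan (h : ConvexPotential D u) (hne : D.Nonempty) {a β R ε : ℝ} (hn : 1 ≤ n)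
    (ha : 0 < a) (hβ : (n : ℝ) + 1 < β) (hg : ∀ x ∈ D, a * (1 + ‖x‖) ≤ u x)
    (hGm : Measurable G) (hG : ∀ᵐ x, x ∈ D → HasGradientAt u (G x) x) (hR : 0 ≤ R) (hε : 0 < ε)
    (ρ : Measure (En n)) [IsProbabilityMeasure ρ]
    (hρ : ρ (cube n R)ᶜ = 0) {r : En n → ℝ≥0∞} (hr : Measurable r)
    (hrρ : volume.withDensity r ≤ ρ) {x₀ : En n} (hx₀ : x₀ ∈ D) {k : NNReal} (hk : a ≤ k)
    (N₀ : ℕ) :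
    ∃ N ≥ N₀, ∃ γ : Measure (En n × En n),
      γ.map Prod.fst = (potMeasure β D u).restrict (slopeSet D G k ∩ cube n N) ∧
      γ.map Prod.snd ≤ powMeasure β (lipReg D u k) (cube n N) • ρ ∧
      (1 - 1 / β)⁻¹ * ((powMeasure β (lipReg D u k) (cube n N)).toReal ^ (1 - 1 / β) *
        (∫⁻ x, r x ^ (1 - 1 / β)).toReal - ∫ x, lipReg D u k x ^ (1 - β)) ≤
        (∫ z, ⟪G z.1, z.2 - x₀⟫ ∂γ) -
        (∫ x in slopeSet D G k ∩ cube n N, ⟪G x, x - x₀⟫ ∂(potMeasure β D u)) +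
        (∫ x in (slopeSet D G k)ᶜ, (‖gradient (lipReg D u k) x‖ * (√n * R + ‖x₀‖) + u x₀)
          ∂(powMeasure β (lipReg D u k))) + ε := by
  set φ := lipReg D u k with hφ
  set p := gradient φ with hp
  set ν := powMeasure β φ with hν
  have hlip : LipschitzWith k φ := h.lipschitzWith_lipReg hne k
  have hφg : ∀ x, a * (1 + ‖x‖) ≤ φ x := growth_lipReg hne hg ha hk
  have hpm : Measurable p := measurable_gradient φ
  have hpk : ∀ x, ‖p x‖ ≤ k := hlip.norm_gradient_le
  have hνfin : IsFiniteMeasure ν :=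
    isFiniteMeasure_powMeasure ha (by linarith) hlip.continuous.measurable hφg
  obtain ⟨N, hN, γ, hγ1, hγ2, hγi, hγ⟩ := lipschitz_plan hn hβ ha hR hε hlip hφg hpm
    hpk hlip.ae_hasGradientAt ρ hρ hr hrρ N₀
  set Q := cube n N with hQ
  have hQm : MeasurableSet Q := measurableSet_cube n N
  set S := slopeSet D G k with hS
  have hSm : MeasurableSet S := h.measurableSet_slopeSet hGm k
  set A := S ∩ Q with hA
  have hAm : MeasurableSet A := hSm.inter hQm
  have hpre : MeasurableSet (Prod.fst ⁻¹' A : Set (En n × En n)) := measurable_fst hAm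
  have hmap : (γ.restrict (Prod.fst ⁻¹' A)).map Prod.fst = (potMeasure β D u).restrict A := by
    rw [← Measure.restrict_map measurable_fst hAm, hγ1, Measure.restrict_restrict hAm,
      inter_eq_self_of_subset_left (inter_subset_right : A ⊆ Q)]
    exact h.powMeasure_lipReg_restrict hG k β hAm inter_subset_left
  have hγfin : IsFiniteMeasure γ := by
    refine ⟨?_⟩
    rw [univ_of_map_fst hγ1]
    exact measure_lt_top _ _
  have hγQ : ∀ᵐ z ∂γ, z.1 ∈ Q := ae_of_map_fst hγ1 hQm (by
    rw [Measure.restrict_apply hQm.compl, compl_inter_self, measure_empty])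
  have hγR : ∀ᵐ z ∂γ, ‖z.2‖ ≤ √n * R := by
    filter_upwards [ae_of_map_snd hγ2 (measurableSet_cube n R) (by simp [hρ])] with z hz
    exact norm_le_of_mem_cube hR hz
  have hpG : ∀ᵐ z ∂(γ.restrict (Prod.fst ⁻¹' A)), p z.1 = G z.1 := by
    have h1 : ∀ᵐ x ∂((potMeasure β D u).restrict A), p x = G x := by
      rw [ae_restrict_iff' hAm]
      refine (withDensity_absolutelyContinuous _ _).ae_le ?_
      filter_upwards [h.ae_lipReg_eq hG k] with x hx hxA using (hx hxA.1).2
    rw [← hmap] at h1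
    exact ae_of_ae_map measurable_fst.aemeasurable h1
  have hGA : ∀ᵐ z ∂(γ.restrict (Prod.fst ⁻¹' A)), z.1 ∈ A := ae_restrict_mem hpre
  refine ⟨N, hN, γ.restrict (Prod.fst ⁻¹' A), hmap, ?_, hγ.trans ?_⟩
  · rw [← hγ2]
    exact Measure.map_mono Measure.restrict_le_self measurable_snd
  rw [← integral_add_compl hpre hγi]
  have hin : ∫ z in Prod.fst ⁻¹' A, ⟪p z.1, z.2 - z.1⟫ ∂γ =
      (∫ z in Prod.fst ⁻¹' A, ⟪G z.1, z.2 - x₀⟫ ∂γ) -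
        ∫ x in A, ⟪G x, x - x₀⟫ ∂(potMeasure β D u) := by
    have e1 : ∫ x in A, ⟪G x, x - x₀⟫ ∂(potMeasure β D u) =
        ∫ z in Prod.fst ⁻¹' A, ⟪G z.1, z.1 - x₀⟫ ∂γ := by
      rw [← hmap, integral_map (f := fun x => ⟪G x, x - x₀⟫) measurable_fst.aemeasurable
        (hGm.inner (measurable_id.sub_const x₀)).aestronglyMeasurable]
    rw [e1, ← integral_sub]
    · refine integral_congr_ae ?_
      filter_upwards [hpG] with z hz
      rw [hz, ← inner_sub_right]
      congr 1
      abel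
    · refine Integrable.mono' (integrable_const ((k:ℝ) * (√n * R + ‖x₀‖)))
        ((hGm.comp measurable_fst).inner (measurable_snd.sub_const x₀)).aestronglyMeasurable ?_
      filter_upwards [hGA, ae_restrict_of_ae hγR] with z hz hzR
      refine (norm_inner_le_norm _ _).trans ?_
      have := (norm_sub_le z.2 x₀).trans (add_le_add_left hzR _)
      have := hz.1.2
      gcongr
    · refine Integrable.mono' (integrable_const ((k:ℝ) * (√n * N + ‖x₀‖)))
        ((hGm.comp measurable_fst).inner (measurable_fst.sub_const x₀)).aestronglyMeasurable ?_
      filter_upwards [hGA] with z hz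
      refine (norm_inner_le_norm _ _).trans ?_
      have := (norm_sub_le z.1 x₀).trans
        (add_le_add_left (norm_le_of_mem_cube (Nat.cast_nonneg N) hz.2) _)
      have := hz.1.2
      gcongr
  set B : En n → ℝ := fun x => ‖p x‖ * (√n * R + ‖x₀‖) + u x₀ with hB
  have hBm : Measurable B := (hpm.norm.mul_const _).add_const _
  have hB0 : ∀ x, 0 ≤ B x := fun x => by
    have := h.nonneg x₀
    simp only [hB]; positivity
  have hBk : ∀ x, ‖B x‖ ≤ k * (√n * R + ‖x₀‖) + u x₀ := fun x => by
    rw [Real.norm_of_nonneg (hB0 x)]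
    have := hpk x
    simp only [hB]
    gcongr
  have hBi : Integrable B ν :=
    Integrable.mono' (integrable_const _) hBm.aestronglyMeasurable (ae_of_all _ hBk)
  have hout : ∫ z in (Prod.fst ⁻¹' A)ᶜ, ⟪p z.1, z.2 - z.1⟫ ∂γ ≤ ∫ x in Sᶜ, B x ∂ν := by
    have hmapc : (γ.restrict (Prod.fst ⁻¹' A)ᶜ).map Prod.fst = ν.restrict (Aᶜ ∩ Q) := by
      rw [← preimage_compl, ← Measure.restrict_map measurable_fst hAm.compl, hγ1,
        Measure.restrict_restrict hAm.compl]
    have e1 : ∫ z in (Prod.fst ⁻¹' A)ᶜ, B z.1 ∂γ = ∫ x in Aᶜ ∩ Q, B x ∂ν := by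
      rw [← hmapc, integral_map measurable_fst.aemeasurable hBm.aestronglyMeasurable]
    have e2 : ∫ x in Aᶜ ∩ Q, B x ∂ν ≤ ∫ x in Sᶜ, B x ∂ν := by
      refine setIntegral_mono_set hBi.integrableOn (ae_of_all _ hB0)
        (LE.le.eventuallyLE fun x hx hxS => hx.1 ⟨hxS, hx.2⟩)
    refine le_trans ?_ (e1.trans_le e2)
    refine integral_mono_ae hγi.integrableOn
      (Integrable.mono' (integrable_const _) (hBm.comp measurable_fst).aestronglyMeasurable
        (ae_of_all _ fun z => hBk z.1)) ?_
    have hgr : ∀ᵐ z ∂γ, HasGradientAt φ (p z.1) z.1 := by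
      have h1 : ∀ᵐ x ∂(ν.restrict Q), HasGradientAt φ (p x) x :=
        ae_restrict_of_ae ((withDensity_absolutelyContinuous _ _).ae_le hlip.ae_hasGradientAt)
      rw [← hγ1] at h1
      exact ae_of_ae_map measurable_fst.aemeasurable h1
    filter_upwards [ae_restrict_of_ae hgr, ae_restrict_of_ae hγR] with z hz hzR
    have h1 := (h.convexOn_lipReg hne k.2).add_inner_gradient_le (mem_univ z.1) (mem_univ x₀) hz
    have h2 : φ x₀ ≤ u x₀ := h.lipReg_le_self k.2 hx₀
    have h3 : 0 ≤ φ z.1 := le_trans (by positivity) (hφg z.1)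
    have h4 : ⟪p z.1, z.2 - z.1⟫ = ⟪p z.1, z.2 - x₀⟫ + ⟪p z.1, x₀ - z.1⟫ := by
      rw [← inner_add_right]; congr 1; abel
    have h5 : ⟪p z.1, z.2 - x₀⟫ ≤ ‖p z.1‖ * (√n * R + ‖x₀‖) := by
      refine (real_inner_le_norm _ _).trans ?_
      have := (norm_sub_le z.2 x₀).trans (add_le_add_left hzR _)
      gcongr
    simp only [hB]
    change φ z.1 + _ ≤ φ x₀ at h1
    linarith
  rw [hin]
  linarith

end ConvexPotential

lemma measurable_powDensity {n : ℕ} {ψ : En n → ℝ} (hψ : Measurable ψ) (β : ℝ) :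
    Measurable fun x => ENNReal.ofReal (ψ x ^ (-β)) :=
  (hψ.pow_const _).ennreal_ofReal

namespace ConvexPotential
variable {n : ℕ} {D : Set (En n)} {u : En n → ℝ} {G : En n → En n} {β : ℝ}

lemma potMeasure_eq (h : ConvexPotential D u) :
    potMeasure β D u = (volume.restrict D).withDensity fun x => ENNReal.ofReal (u x ^ (-β)) := by
  rw [potMeasure, withDensity_indicator h.measurableSet]

lemma ae_mem_potMeasure (h : ConvexPotential D u) : ∀ᵐ x ∂(potMeasure β D u), x ∈ D := by
  rw [h.potMeasure_eq]
  exact (withDensity_absolutelyContinuous _ _).ae_le (ae_restrict_mem h.measurableSet)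

lemma tendsto_potMeasure_slopeSet (h : ConvexPotential D u)
    [IsProbabilityMeasure (potMeasure β D u)] :
    Tendsto (fun k : ℕ => potMeasure β D u (slopeSet D G k ∩ cube n k)) atTop (𝓝 1) := by
  have hmono : Monotone fun k : ℕ => slopeSet D G k ∩ cube n k := fun k l hkl =>
    inter_subset_inter (slopeSet_mono D G (Nat.cast_le.mpr hkl))
      (monotone_cube n (Nat.cast_le.mpr hkl))
  have hU : ⋃ k : ℕ, slopeSet D G k ∩ cube n k = D := by
    refine subset_antisymm (iUnion_subset fun k x hx => hx.1.1) fun x hx => ?_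
    obtain ⟨k, hk⟩ := exists_nat_ge ‖G x‖
    have hx' : x ∈ ⋃ k : ℕ, cube n k := by rw [iUnion_cube]; exact mem_univ x
    obtain ⟨l, hl⟩ := mem_iUnion.mp hx'
    refine mem_iUnion.mpr ⟨max k l, ⟨hx, hk.trans ?_⟩, monotone_cube n ?_ hl⟩
    · exact Nat.cast_le.mpr (le_max_left k l)
    · exact Nat.cast_le.mpr (le_max_right k l)
  have := tendsto_measure_iUnion_atTop (μ := potMeasure β D u) hmono
  rwa [hU, (prob_compl_eq_zero_iff h.measurableSet).mp (mem_ae_iff.mp h.ae_mem_potMeasure)] at this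

lemma potMeasure_univ_toReal (h : ConvexPotential D u) :
    (potMeasure β D u univ).toReal = ∫ x in D, u x ^ (-β) := by
  rw [h.potMeasure_eq, withDensity_apply _ MeasurableSet.univ, Measure.restrict_univ,
    integral_eq_lintegral_of_nonneg_ae (ae_of_all _ fun x => Real.rpow_nonneg (h.nonneg x) _)
      (h.measurable.pow_const _).aestronglyMeasurable]

lemma powMeasure_univ_toReal {ψ : En n → ℝ} (hψ : Measurable ψ) (hψ0 : ∀ x, 0 ≤ ψ x) :
    (powMeasure β ψ univ).toReal = ∫ x, ψ x ^ (-β) := by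
  rw [powMeasure, withDensity_apply _ MeasurableSet.univ, Measure.restrict_univ,
    integral_eq_lintegral_of_nonneg_ae (ae_of_all _ fun x => Real.rpow_nonneg (hψ0 x) _)
      (hψ.pow_const _).aestronglyMeasurable]

lemma tendsto_powMeasure_univ (h : ConvexPotential D u)
    [IsProbabilityMeasure (potMeasure β D u)]
    (hne : D.Nonempty) {a : ℝ} (ha : 0 < a) (hβ : (n : ℝ) < β)
    (hg : ∀ x ∈ D, a * (1 + ‖x‖) ≤ u x) :
    Tendsto (fun k : ℕ => powMeasure β (lipReg D u k) univ) atTop (𝓝 1) := by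
  have h1 := h.tendsto_integral_rpow_lipReg hne ha hg hβ
  rw [← h.potMeasure_univ_toReal, measure_univ, ENNReal.toReal_one] at h1
  have hev : ∀ᶠ k : ℕ in atTop, a ≤ k := tendsto_natCast_atTop_atTop.eventually_ge_atTop a
  have h2 := (ENNReal.tendsto_ofReal h1)
  rw [ENNReal.ofReal_one] at h2
  refine h2.congr' ?_
  filter_upwards [hev] with k hk
  have hgk := growth_lipReg (k := (k : ℝ)) hne hg ha hk
  have hm := h.measurable_lipReg hne (Nat.cast_nonneg k)
  have := isFiniteMeasure_powMeasure ha hβ hm hgk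
  rw [← powMeasure_univ_toReal hm fun x => le_trans (by positivity) (hgk x),
    ENNReal.ofReal_toReal (measure_ne_top _ _)]

lemma tendsto_powMeasure_cube (h : ConvexPotential D u)
    [IsProbabilityMeasure (potMeasure β D u)]
    (hne : D.Nonempty) {a : ℝ} (ha : 0 < a) (hβ : (n : ℝ) < β)
    (hg : ∀ x ∈ D, a * (1 + ‖x‖) ≤ u x) (hGm : Measurable G)
    (hG : ∀ᵐ x, x ∈ D → HasGradientAt u (G x) x) {N : ℕ → ℕ} (hN : ∀ k, k ≤ N k) :
    Tendsto (fun k : ℕ => powMeasure β (lipReg D u k) (cube n (N k))) atTop (𝓝 1) := by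
  refine tendsto_of_tendsto_of_tendsto_of_le_of_le
    (h.tendsto_potMeasure_slopeSet (G := G) (β := β)) (h.tendsto_powMeasure_univ hne ha hβ hg)
    (fun k => ?_) fun k => measure_mono (subset_univ _)
  have hm : MeasurableSet (slopeSet D G k ∩ cube n k) :=
    (h.measurableSet_slopeSet hGm k).inter (measurableSet_cube n k)
  have h1 := h.powMeasure_lipReg_restrict hG k β hm (by simp)
  have h2 := congrArg (fun ν : Measure (En n) => ν univ) h1
  simp only [Measure.restrict_apply_univ, NNReal.coe_natCast] at h2
  change potMeasure β D u _ ≤ _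
  rw [← h2]
  exact measure_mono (inter_subset_right.trans (monotone_cube n (Nat.cast_le.mpr (hN k))))

lemma tendsto_powMeasure_slopeSet_compl (h : ConvexPotential D u)
    [IsProbabilityMeasure (potMeasure β D u)]
    (hne : D.Nonempty) {a : ℝ} (ha : 0 < a) (hβ : (n : ℝ) < β)
    (hg : ∀ x ∈ D, a * (1 + ‖x‖) ≤ u x) (hGm : Measurable G)
    (hG : ∀ᵐ x, x ∈ D → HasGradientAt u (G x) x) :
    Tendsto (fun k : ℕ => powMeasure β (lipReg D u k) (slopeSet D G k)ᶜ) atTop (𝓝 0) := by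
  have h1 := ENNReal.Tendsto.sub (h.tendsto_powMeasure_univ hne ha hβ hg)
    (h.tendsto_potMeasure_slopeSet (G := G) (β := β)) (Or.inl ENNReal.one_ne_top)
  rw [tsub_self] at h1
  refine tendsto_of_tendsto_of_tendsto_of_le_of_le' tendsto_const_nhds h1
    (Eventually.of_forall fun _ => zero_le) ?_
  have hev : ∀ᶠ k : ℕ in atTop, a ≤ k := tendsto_natCast_atTop_atTop.eventually_ge_atTop a
  filter_upwards [hev] with k hk
  have hgk := growth_lipReg (k := (k : ℝ)) hne hg ha hk
  have := isFiniteMeasure_powMeasure ha hβ (h.measurable_lipReg hne (Nat.cast_nonneg k)) hgk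
  have hS := h.measurableSet_slopeSet hGm k
  have h1 := h.powMeasure_lipReg_restrict hG k β hS (by simp)
  have h2 := congrArg (fun ν : Measure (En n) => ν univ) h1
  simp only [Measure.restrict_apply_univ, NNReal.coe_natCast] at h2
  rw [measure_compl hS (measure_ne_top _ _), h2]
  exact tsub_le_tsub_left (measure_mono inter_subset_left) _

lemma lintegral_norm_potMeasure (h : ConvexPotential D u) (hGm : Measurable G) :
    ∫⁻ x, ‖G x‖ₑ ∂(potMeasure β D u) = ∫⁻ x in D, ‖G x‖ₑ * ENNReal.ofReal (u x ^ (-β)) := by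
  rw [h.potMeasure_eq, lintegral_withDensity_eq_lintegral_mul _
    (measurable_powDensity h.measurable β) hGm.enorm]
  simp only [Pi.mul_apply, mul_comm]

end ConvexPotential

lemma ConvexPotential.tendsto_integral_gradient_compl {m : ℕ} {D : Set (En (m + 1))}
    {u : En (m + 1) → ℝ} {G : En (m + 1) → En (m + 1)} {β : ℝ} (h : ConvexPotential D u)
    [IsProbabilityMeasure (potMeasure β D u)] (hne : D.Nonempty)
    {a : ℝ} (ha : 0 < a) (hβ : ((m + 1 : ℕ) : ℝ) + 1 < β) (hg : ∀ x ∈ D, a * (1 + ‖x‖) ≤ u x)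
    (hnull : μH[m] (D \ interior D) = 0) (hGm : Measurable G)
    (hG : ∀ᵐ x, x ∈ D → HasGradientAt u (G x) x)
    (hGi : Integrable G (potMeasure β D u)) (C C' : ℝ) :
    Tendsto (fun k : ℕ => ∫ x in (slopeSet D G k)ᶜ, (‖gradient (lipReg D u k) x‖ * C + C')
      ∂(powMeasure β (lipReg D u k))) atTop (𝓝 0) := by
  have hfin : ∫⁻ x in D, ‖G x‖ₑ * ENNReal.ofReal (u x ^ (-β)) ≠ ⊤ := by
    rw [← h.lintegral_norm_potMeasure hGm]
    exact hGi.2.ne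
  have h1 := h.tendsto_lintegral_gradient_compl hne ha hβ hg hnull hGm hG hfin
  have h2 := h.tendsto_powMeasure_slopeSet_compl hne ha (by linarith) hg hGm hG
  have h1' := (ENNReal.tendsto_toReal ENNReal.zero_ne_top).comp h1
  have h2' := (ENNReal.tendsto_toReal ENNReal.zero_ne_top).comp h2
  have h3 := (h1'.mul_const C).add (h2'.mul_const C')
  simp only [ENNReal.toReal_zero, zero_mul, add_zero] at h3
  refine h3.congr' ?_
  have hev : ∀ᶠ k : ℕ in atTop, a ≤ k := tendsto_natCast_atTop_atTop.eventually_ge_atTop a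
  filter_upwards [hev] with k hk
  have hgk := growth_lipReg (k := (k : ℝ)) hne hg ha hk
  have hm := h.measurable_lipReg hne (Nat.cast_nonneg k)
  have := isFiniteMeasure_powMeasure (β := β) ha (by linarith) hm hgk
  have hS := h.measurableSet_slopeSet hGm k
  have hlip : LipschitzWith (k : NNReal) (lipReg D u k) := by
    simpa using h.lipschitzWith_lipReg hne (k : NNReal)
  have hgm := measurable_gradient (lipReg D u k)
  have hi : Integrable (fun x => ‖gradient (lipReg D u k) x‖) (powMeasure β (lipReg D u k)) :=
    Integrable.mono' (integrable_const (k : ℝ)) hgm.norm.aestronglyMeasurable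
      (ae_of_all _ fun x => by simpa using hlip.norm_gradient_le x)
  rw [integral_add (hi.mul_const C).integrableOn (integrable_const _), integral_mul_const,
    setIntegral_const, smul_eq_mul]
  congr 2
  rw [integral_norm_eq_lintegral_enorm hgm.aestronglyMeasurable.restrict, powMeasure,
    restrict_withDensity hS.compl, lintegral_withDensity_eq_lintegral_mul _
    (measurable_powDensity hm β) hgm.enorm]
  simp only [Function.comp, Pi.mul_apply, mul_comm]
  rfl

namespace ConvexPotential
variable {n : ℕ} {D : Set (En n)} {u : En n → ℝ} {G : En n → En n} {β : ℝ}

lemma ae_potMeasure_hasGradientAt (h : ConvexPotential D u)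
    (hG : ∀ᵐ x, x ∈ D → HasGradientAt u (G x) x) :
    ∀ᵐ x ∂(potMeasure β D u), HasGradientAt u (G x) x := by
  filter_upwards [h.ae_mem_potMeasure, (withDensity_absolutelyContinuous volume _).ae_le hG]
    with x hx hx' using hx' hx

lemma ae_potMeasure_le_inner (h : ConvexPotential D u)
    (hG : ∀ᵐ x, x ∈ D → HasGradientAt u (G x) x) {x₀ : En n} (hx₀ : x₀ ∈ D) :
    ∀ᵐ x ∂(potMeasure β D u), u x - u x₀ ≤ ⟪G x, x - x₀⟫ := by
  filter_upwards [h.ae_mem_potMeasure, h.ae_potMeasure_hasGradientAt hG] with x hx hx'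
  have := h.convexOn.add_inner_gradient_le hx hx₀ hx'
  rw [← neg_sub x x₀, inner_neg_right] at this
  linarith

lemma integrableOn_slopeSet_cube (h : ConvexPotential D u) [IsProbabilityMeasure (potMeasure β D u)]
    (hGm : Measurable G) (x₀ : En n) (k : ℝ) (N : ℕ) :
    IntegrableOn (fun x => ⟪G x, x - x₀⟫) (slopeSet D G k ∩ cube n N) (potMeasure β D u) := by
  refine Integrable.mono' (integrable_const (k * (√n * N + ‖x₀‖)))
    (hGm.inner (measurable_id.sub_const x₀)).aestronglyMeasurable ?_
  filter_upwards [ae_restrict_mem ((h.measurableSet_slopeSet hGm k).inter (measurableSet_cube n N))]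
    with x hx
  refine (norm_inner_le_norm _ _).trans ?_
  have h1 := (norm_sub_le x x₀).trans
    (add_le_add_left (norm_le_of_mem_cube (Nat.cast_nonneg N) hx.2) _)
  have h2 := hx.1.2
  have h3 : 0 ≤ k := (norm_nonneg _).trans h2
  change ‖G x‖ * ‖x - x₀‖ ≤ _
  gcongr

lemma setIntegral_slopeSet_cube_le (h : ConvexPotential D u)
    [IsProbabilityMeasure (potMeasure β D u)] (hGm : Measurable G)
    (hG : ∀ᵐ x, x ∈ D → HasGradientAt u (G x) x) {x₀ : En n} (hx₀ : x₀ ∈ D)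
    {j k : ℝ} {N N' : ℕ} (hjk : j ≤ k) (hN : N ≤ N') :
    (∫ x in slopeSet D G j ∩ cube n N, ⟪G x, x - x₀⟫ ∂(potMeasure β D u)) -
      u x₀ * (potMeasure β D u).real (slopeSet D G j ∩ cube n N)ᶜ ≤
    ∫ x in slopeSet D G k ∩ cube n N', ⟪G x, x - x₀⟫ ∂(potMeasure β D u) := by
  set H := slopeSet D G j ∩ cube n N with hH
  set A := slopeSet D G k ∩ cube n N' with hA
  have hHm : MeasurableSet H := (h.measurableSet_slopeSet hGm j).inter (measurableSet_cube n N)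
  have hAm : MeasurableSet A := (h.measurableSet_slopeSet hGm k).inter (measurableSet_cube n N')
  have hHA : H ⊆ A := inter_subset_inter (slopeSet_mono D G hjk)
    (monotone_cube n (Nat.cast_le.mpr hN))
  have hi := h.integrableOn_slopeSet_cube (β := β) hGm x₀ k N'
  rw [← union_sdiff_cancel hHA, setIntegral_union disjoint_sdiff_right (hAm.diff hHm)
    (hi.mono_set hHA) (hi.mono_set sdiff_subset)]
  have h1 : -(u x₀ * (potMeasure β D u).real (A \ H)) ≤
      ∫ x in A \ H, ⟪G x, x - x₀⟫ ∂(potMeasure β D u) := by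
    have : -(u x₀ * (potMeasure β D u).real (A \ H)) =
        ∫ x in A \ H, -u x₀ ∂(potMeasure β D u) := by
      rw [setIntegral_const, smul_eq_mul]; ring
    rw [this]
    refine setIntegral_mono_ae (integrable_const _).integrableOn (hi.mono_set sdiff_subset) ?_
    filter_upwards [h.ae_potMeasure_le_inner hG hx₀] with x hx
    have := h.nonneg x
    linarith
  have h2 : (potMeasure β D u).real (A \ H) ≤ (potMeasure β D u).real Hᶜ :=
    measureReal_mono fun x hx => hx.2
  have h3 := mul_le_mul_of_nonneg_left h2 (h.nonneg x₀)
  linarith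

lemma tendsto_setIntegral_norm_slopeSet (h : ConvexPotential D u)
    [IsProbabilityMeasure (potMeasure β D u)] (hGm : Measurable G)
    (hGi : Integrable G (potMeasure β D u)) {N : ℕ → ℕ} (hN : ∀ k, k ≤ N k) :
    Tendsto (fun k : ℕ => ∫ x in slopeSet D G k ∩ cube n (N k), ‖G x‖ ∂(potMeasure β D u)) atTop
      (𝓝 (∫ x, ‖G x‖ ∂(potMeasure β D u))) := by
  have hmono : Monotone fun k : ℕ => slopeSet D G k ∩ cube n k := fun k l hkl =>
    inter_subset_inter (slopeSet_mono D G (Nat.cast_le.mpr hkl))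
      (monotone_cube n (Nat.cast_le.mpr hkl))
  have hm : ∀ k : ℕ, MeasurableSet (slopeSet D G k ∩ cube n k) := fun k =>
    (h.measurableSet_slopeSet hGm k).inter (measurableSet_cube n k)
  have h1 := tendsto_setIntegral_of_monotone hm hmono (f := fun x => ‖G x‖) (μ := potMeasure β D u)
    hGi.norm.integrableOn
  have hfull : (⋃ k : ℕ, slopeSet D G k ∩ cube n k : Set (En n)) =ᵐ[potMeasure β D u] univ := by
    rw [ae_eq_univ, prob_compl_eq_zero_iff (MeasurableSet.iUnion hm)]
    exact tendsto_nhds_unique (tendsto_measure_iUnion_atTop hmono) h.tendsto_potMeasure_slopeSet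
  rw [setIntegral_congr_set hfull, setIntegral_univ] at h1
  refine tendsto_of_tendsto_of_tendsto_of_le_of_le h1 tendsto_const_nhds (fun k => ?_) fun k => ?_
  · exact setIntegral_mono_set hGi.norm.integrableOn (ae_of_all _ fun x => norm_nonneg _)
      (LE.le.eventuallyLE (inter_subset_inter_right _ (monotone_cube n (Nat.cast_le.mpr (hN k)))))
  · exact setIntegral_le_integral hGi.norm (ae_of_all _ fun x => norm_nonneg _)

end ConvexPotential

theorem ConvexPotential.exists_plan_of_bounded {m : ℕ} {D : Set (En (m + 1))}
    {u : En (m + 1) → ℝ} {G : En (m + 1) → En (m + 1)} {β : ℝ} (h : ConvexPotential D u)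
    [IsProbabilityMeasure (potMeasure β D u)] (hne : D.Nonempty)
    {a : ℝ} (ha : 0 < a) (hβ : ((m + 1 : ℕ) : ℝ) + 1 < β) (hg : ∀ x ∈ D, a * (1 + ‖x‖) ≤ u x)
    (hnull : μH[m] (D \ interior D) = 0) (hGm : Measurable G)
    (hG : ∀ᵐ x, x ∈ D → HasGradientAt u (G x) x)
    (hGi : Integrable G (potMeasure β D u))
    (ρ : Measure (En (m + 1))) [IsProbabilityMeasure ρ] {R : ℝ} (hR : 0 ≤ R)
    (hρ : ρ (cube (m + 1) R)ᶜ = 0) {r : En (m + 1) → ℝ≥0∞} (hr : Measurable r)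
    (hrρ : volume.withDensity r ≤ ρ) {x₀ : En (m + 1)} (hx₀ : x₀ ∈ D) (j : ℕ) {ε : ℝ}
    (hε : 0 < ε) :
    ∃ γ : Measure (En (m + 1) × En (m + 1)), γ.map Prod.fst = potMeasure β D u ∧
      γ.map Prod.snd = ρ ∧ Integrable (fun z => ⟪G z.1, z.2 - x₀⟫) γ ∧
      (1 - 1 / β)⁻¹ * ((∫⁻ x, r x ^ (1 - 1 / β)).toReal - ∫ x in D, u x ^ (1 - β)) +
        (∫ x in slopeSet D G j ∩ cube (m + 1) j, ⟪G x, x - x₀⟫ ∂(potMeasure β D u)) -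
        u x₀ * (potMeasure β D u).real (slopeSet D G j ∩ cube (m + 1) j)ᶜ - ε ≤
      ∫ z, ⟪G z.1, z.2 - x₀⟫ ∂γ := by
  set ν := potMeasure β D u with hν
  set R' := √(m + 1 : ℕ) * R with hR'
  set C := R' + ‖x₀‖ with hC
  set W := (∫ x in slopeSet D G j ∩ cube (m + 1) j, ⟪G x, x - x₀⟫ ∂ν) -
        u x₀ * ν.real (slopeSet D G j ∩ cube (m + 1) j)ᶜ with hW
  set I := (∫⁻ x, r x ^ (1 - 1 / β)).toReal with hI
  let E : ℕ → ℝ := fun k => ∫ x in (slopeSet D G k)ᶜ, (‖gradient (lipReg D u k) x‖ * C + u x₀)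
      ∂(powMeasure β (lipReg D u k))
  have key : ∀ k : ℕ, ∃ N ≥ k, a ≤ k → ∃ γ : Measure (En (m + 1) × En (m + 1)),
      γ.map Prod.fst = ν.restrict (slopeSet D G k ∩ cube (m + 1) N) ∧
      γ.map Prod.snd ≤ powMeasure β (lipReg D u k) (cube (m + 1) N) • ρ ∧
      (1 - 1 / β)⁻¹ * ((powMeasure β (lipReg D u k) (cube (m + 1) N)).toReal ^ (1 - 1 / β) *
        I - ∫ x, lipReg D u k x ^ (1 - β)) ≤
        (∫ z, ⟪G z.1, z.2 - x₀⟫ ∂γ) -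
        (∫ x in slopeSet D G k ∩ cube (m + 1) N, ⟪G x, x - x₀⟫ ∂ν) + E k + 1 / ((k : ℝ) + 1) := by
    intro k
    by_cases hk : a ≤ k
    · obtain ⟨N, hN, hγ⟩ := h.exists_partial_plan hne (Nat.le_add_left 1 m) ha hβ hg hGm hG hR
        (ε := 1 / ((k : ℝ) + 1)) (by positivity) ρ hρ hr hrρ hx₀ (k := (k : NNReal))
        (by simpa using hk) k
      refine ⟨N, hN, fun _ => ?_⟩
      simpa only [NNReal.coe_natCast] using hγ
    · exact ⟨k, le_rfl, fun h => absurd h hk⟩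
  choose N hN hγ using key
  let M : ℕ → ℝ≥0∞ := fun k => powMeasure β (lipReg D u k) (cube (m + 1) (N k))
  let θ : ℕ → NNReal := fun k => min 1 (M k).toNNReal⁻¹
  have hM : Tendsto M atTop (𝓝 1) := h.tendsto_powMeasure_cube hne ha (by linarith) hg hGm hG hN
  have hMr : Tendsto (fun k => (M k).toReal) atTop (𝓝 1) := 
    (ENNReal.tendsto_toReal ENNReal.one_ne_top).comp hM
  have hMn : Tendsto (fun k => (M k).toNNReal) atTop (𝓝 1) := 
    (ENNReal.tendsto_toNNReal ENNReal.one_ne_top).comp hM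
  have hθ : Tendsto (fun k => (θ k : ℝ)) atTop (𝓝 1) := by
    have h1 : Tendsto θ atTop (𝓝 (min 1 (1 : NNReal)⁻¹)) :=
      tendsto_const_nhds.min (hMn.inv₀ one_ne_zero)
    rw [inv_one, min_self] at h1
    exact (NNReal.tendsto_coe.mpr h1)
  have hE : Tendsto E atTop (𝓝 0) :=
    h.tendsto_integral_gradient_compl hne ha hβ hg hnull hGm hG hGi C (u x₀)
  have hΦ := h.tendsto_integral_rpow_lipReg hne ha hg (s := β - 1) (by linarith)
  simp only [neg_sub] at hΦ
  have hGA := h.tendsto_setIntegral_norm_slopeSet hGm hGi hN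
  have hlow : Tendsto (fun k : ℕ => (θ k : ℝ) * ((1 - 1 / β)⁻¹ * ((M k).toReal ^ (1 - 1 / β) *
        I - ∫ x, lipReg D u k x ^ (1 - β)) + W - E k - 1 / ((k : ℝ) + 1)) -
      C * ((∫ x, ‖G x‖ ∂ν) - θ k * ∫ x in slopeSet D G k ∩ cube (m + 1) (N k), ‖G x‖ ∂ν)) atTop
      (𝓝 (1 * ((1 - 1 / β)⁻¹ * (1 ^ (1 - 1 / β) * I - ∫ x in D, u x ^ (1 - β)) + W - 0 - 0) -
        C * ((∫ x, ‖G x‖ ∂ν) - 1 * ∫ x, ‖G x‖ ∂ν))) := by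
    refine (hθ.mul ((((((hMr.rpow_const (Or.inl one_ne_zero)).mul_const I).sub hΦ).const_mul
      _).add_const W |>.sub hE).sub tendsto_one_div_add_atTop_nhds_zero_nat)).sub
      (tendsto_const_nhds.mul (tendsto_const_nhds.sub (hθ.mul hGA)))
  simp only [Real.one_rpow, one_mul, sub_zero, sub_self, mul_zero] at hlow
  have hev : ∀ᶠ k : ℕ in atTop, a ≤ k := tendsto_natCast_atTop_atTop.eventually_ge_atTop a
  obtain ⟨k, hk1, hk2, hk3, hk4⟩ := ((hlow.eventually (lt_mem_nhds (sub_lt_self _ hε))).and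
    (hev.and ((eventually_ge_atTop j).and (hM.eventually (gt_mem_nhds ENNReal.one_lt_top))))).exists
  obtain ⟨γ, hγ1, hγ2, hγ3⟩ := hγ k hk2
  have hAm : MeasurableSet (slopeSet D G k ∩ cube (m + 1) (N k)) :=
    (h.measurableSet_slopeSet hGm k).inter (measurableSet_cube _ _)
  have hball : ρ (Metric.closedBall 0 R')ᶜ = 0 := by
    refine measure_mono_null (compl_subset_compl.mpr fun x hx => ?_) hρ
    exact mem_closedBall_zero_iff.mpr (norm_le_of_mem_cube hR hx)
  have hθ2 : θ k • γ.map Prod.snd ≤ ρ := by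
    have hθM : (θ k : ℝ≥0∞) * M k ≤ 1 := by
      rw [← ENNReal.coe_toNNReal hk4.ne, ← ENNReal.coe_mul, ENNReal.coe_le_one_iff]
      refine (mul_le_mul_left (min_le_right _ _) _).trans ?_
      exact inv_mul_le_one
    refine Measure.le_iff.mpr fun s hs => ?_
    have h1 := hγ2 s
    rw [Measure.smul_apply, smul_eq_mul] at h1
    rw [Measure.smul_apply, ENNReal.smul_def, smul_eq_mul]
    calc (θ k : ℝ≥0∞) * γ.map Prod.snd s ≤ θ k * (M k * ρ s) := by gcongr
      _ = (θ k * M k) * ρ s := (mul_assoc _ _ _).symm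
      _ ≤ 1 * ρ s := by gcongr
      _ = ρ s := one_mul _
  have hγR : ∀ᵐ z ∂γ, ‖z.2‖ ≤ R' := by
    filter_upwards [ae_of_map_snd (γ := γ) rfl (measurableSet_cube _ R)
      (le_antisymm ((hγ2 _).trans (by simp [hρ])) zero_le)] with z hz
    exact norm_le_of_mem_cube hR hz
  obtain ⟨γ', h1, h2, h3, h4⟩ := exists_completed_plan hAm (θ := θ k) (min_le_left _ _) hγ1 hθ2
    hball hγR hGm hGi x₀
  refine ⟨γ', h1, h2, h3, le_trans ?_ h4⟩
  have hWA := h.setIntegral_slopeSet_cube_le (β := β) hGm hG hx₀ (j := j) (k := k) (N := j)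
    (N' := N k) (Nat.cast_le.mpr hk3) (hk3.trans (hN k))
  have h5 := mul_le_mul_of_nonneg_left (a := (θ k : ℝ)) (show (1 - 1 / β)⁻¹ *
    ((M k).toReal ^ (1 - 1 / β) * I - ∫ x, lipReg D u k x ^ (1 - β)) + W - E k - 1 / ((k : ℝ) + 1) ≤
      ∫ z, ⟪G z.1, z.2 - x₀⟫ ∂γ by linarith) (θ k).2
  linarith

lemma tendsto_measure_cube {n : ℕ} (μ : Measure (En n)) :
    Tendsto (fun k : ℕ => μ (cube n k)) atTop (𝓝 (μ univ)) := by
  have hmono : Monotone fun k : ℕ => cube n k := fun k l hkl =>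
    monotone_cube n (Nat.cast_le.mpr hkl)
  have := tendsto_measure_iUnion_atTop (μ := μ) hmono
  rwa [iUnion_cube] at this

lemma tendsto_setIntegral_cube_compl {n : ℕ} {μ : Measure (En n)} {f : En n → ℝ}
    (hf : Integrable f μ) : Tendsto (fun k : ℕ => ∫ x in (cube n k)ᶜ, f x ∂μ) atTop (𝓝 0) := by
  have hmono : Monotone fun k : ℕ => cube n k := fun k l hkl =>
    monotone_cube n (Nat.cast_le.mpr hkl)
  have h1 := tendsto_setIntegral_of_monotone (fun k => measurableSet_cube n (k : ℕ)) hmono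
    (f := f) (μ := μ) hf.integrableOn
  rw [iUnion_cube, setIntegral_univ] at h1
  have h2 := (tendsto_const_nhds (x := ∫ x, f x ∂μ)).sub h1
  rw [sub_self] at h2
  refine h2.congr fun k => ?_
  rw [← integral_add_compl (measurableSet_cube n k) hf]
  ring

lemma exists_plan_of_truncation {n : ℕ} {ν ρ : Measure (En n)} [IsProbabilityMeasure ν]
    [IsProbabilityMeasure ρ] {G : En n → En n} (hGi : Integrable G ν)
    (hρ : P1 ρ) {r : En n → ℝ≥0∞} (hr : Measurable r) (hrρ : volume.withDensity r ≤ ρ) {α c κ : ℝ}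
    (hα : 0 < α) (hfin : ∫⁻ x, r x ^ α ≠ ⊤) (hc : 0 ≤ c) {x₀ : En n}
    (H : ∀ R : ℝ, 0 ≤ R → ∀ ρ' : Measure (En n), IsProbabilityMeasure ρ' →
      ρ' (cube n R)ᶜ = 0 → ∀ r' : En n → ℝ≥0∞, Measurable r' → volume.withDensity r' ≤ ρ' →
      ∃ γ : Measure (En n × En n), γ.map Prod.fst = ν ∧ γ.map Prod.snd = ρ' ∧
        Integrable (fun z => ⟪G z.1, z.2 - x₀⟫) γ ∧
        c * (∫⁻ x, r' x ^ α).toReal + κ ≤ ∫ z, ⟪G z.1, z.2 - x₀⟫ ∂γ) {ε : ℝ} (hε : 0 < ε) :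
    ∃ γ : Measure (En n × En n), γ.map Prod.fst = ν ∧ γ.map Prod.snd = ρ ∧
      Integrable (fun z => ⟪G z.1, z.2 - x₀⟫) γ ∧
      c * (∫⁻ x, r x ^ α).toReal + κ - ε ≤ ∫ z, ⟪G z.1, z.2 - x₀⟫ ∂γ := by
  have hm : Tendsto (fun k : ℕ => ρ (cube n k)) atTop (𝓝 1) := by
    simpa using tendsto_measure_cube ρ
  have hmr : Tendsto (fun k : ℕ => (ρ (cube n k)).toReal) atTop (𝓝 1) :=
    (ENNReal.tendsto_toReal ENNReal.one_ne_top).comp hm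
  have hI : Tendsto (fun k : ℕ => (∫⁻ x in cube n k, r x ^ α).toReal) atTop
      (𝓝 (∫⁻ x, r x ^ α).toReal) := by
    have h1 := tendsto_measure_cube (n := n) (volume.withDensity fun x => r x ^ α)
    rw [withDensity_apply _ MeasurableSet.univ, Measure.restrict_univ] at h1
    refine (ENNReal.tendsto_toReal hfin).comp (h1.congr fun k => ?_)
    rw [withDensity_apply _ (measurableSet_cube n k)]
  have hρi : Integrable (fun y : En n => ‖y‖ + ‖x₀‖) ρ := Integrable.add hρ (integrable_const _)
  have htail := tendsto_setIntegral_cube_compl hρi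
  have hlow : Tendsto (fun k : ℕ => (ρ (cube n k)).toReal *
      (c * (∫⁻ x in cube n k, r x ^ α).toReal + κ) -
      (∫ x, ‖G x‖ ∂ν) * ∫ y in (cube n k)ᶜ, (‖y‖ + ‖x₀‖) ∂ρ) atTop
      (𝓝 (1 * (c * (∫⁻ x, r x ^ α).toReal + κ) - (∫ x, ‖G x‖ ∂ν) * 0)) :=
    (hmr.mul ((hI.const_mul c).add_const κ)).sub (htail.const_mul _)
  rw [one_mul, mul_zero, sub_zero] at hlow
  obtain ⟨k, hk1, hk2⟩ := ((hlow.eventually (lt_mem_nhds (sub_lt_self _ hε))).and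
    (hm.eventually (lt_mem_nhds zero_lt_one))).exists
  set Q := cube n k with hQ
  have hQm : MeasurableSet Q := measurableSet_cube n k
  set t := ρ Q with ht
  have ht1 : t ≤ 1 := prob_le_one
  have htt : t ≠ ⊤ := measure_ne_top _ _
  have hi1 : 1 ≤ t⁻¹ := ENNReal.one_le_inv.mpr ht1
  have hit : t⁻¹ ≠ ⊤ := ENNReal.inv_ne_top.mpr hk2.ne'
  have hprob : IsProbabilityMeasure (t⁻¹ • ρ.restrict Q) := ⟨by
    rw [Measure.smul_apply, Measure.restrict_apply_univ, smul_eq_mul,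
      ENNReal.inv_mul_cancel hk2.ne' htt]⟩
  obtain ⟨γ, hγ1, hγ2, hγi, hγ⟩ := H k (Nat.cast_nonneg k) (t⁻¹ • ρ.restrict Q) hprob
    (by rw [Measure.smul_apply, Measure.restrict_apply hQm.compl, compl_inter_self,
      measure_empty, smul_zero])
    (fun x => t⁻¹ * Q.indicator r x) ((hr.indicator hQm).const_mul _) (by
      change volume.withDensity (t⁻¹ • Q.indicator r) ≤ _
      rw [withDensity_smul _ (hr.indicator hQm), withDensity_indicator hQm,
        ← restrict_withDensity hQm]
      refine Measure.le_iff.mpr fun s hs => ?_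
      rw [Measure.smul_apply, Measure.smul_apply]
      exact mul_le_mul_right (Measure.restrict_mono_measure hrρ Q s) _)
  have hmono : (∫⁻ x in Q, r x ^ α).toReal ≤ (∫⁻ x, (t⁻¹ * Q.indicator r x) ^ α).toReal := by
    have e : ∫⁻ x, (t⁻¹ * Q.indicator r x) ^ α = (t⁻¹) ^ α * ∫⁻ x in Q, r x ^ α := by
      rw [← lintegral_indicator hQm, ← lintegral_const_mul _ ((hr.pow_const α).indicator hQm)]
      refine lintegral_congr fun x => ?_
      rw [ENNReal.mul_rpow_of_nonneg _ _ hα.le]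
      by_cases hx : x ∈ Q
      · rw [indicator_of_mem hx, indicator_of_mem hx]
      · rw [indicator_of_notMem hx, indicator_of_notMem hx, ENNReal.zero_rpow_of_pos hα]
    rw [e]
    refine ENNReal.toReal_mono (ENNReal.mul_ne_top (ENNReal.rpow_ne_top_of_nonneg hα.le hit)
      (ne_top_of_le_ne_top hfin (setLIntegral_le_lintegral _ _))) ?_
    calc ∫⁻ x in Q, r x ^ α = 1 * ∫⁻ x in Q, r x ^ α := (one_mul _).symm
      _ ≤ _ := mul_le_mul_left (ENNReal.one_le_rpow hi1 hα) _
  have hprodi : Integrable (fun z : En n × En n => ‖G z.1‖ * (‖z.2‖ + ‖x₀‖))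
      (ν.prod (ρ.restrict Qᶜ)) := hGi.norm.mul_prod hρi.restrict
  have hbd : ∀ z : En n × En n, ‖⟪G z.1, z.2 - x₀⟫‖ ≤ ‖G z.1‖ * (‖z.2‖ + ‖x₀‖) := fun z =>
    (norm_inner_le_norm _ _).trans (mul_le_mul_of_nonneg_left (norm_sub_le _ _) (norm_nonneg _))
  have hprodi' : Integrable (fun z : En n × En n => ⟪G z.1, z.2 - x₀⟫)
      (ν.prod (ρ.restrict Qᶜ)) :=
    hprodi.mono' ((hGi.aestronglyMeasurable.comp_fst).inner
      (measurable_snd.sub_const x₀).aestronglyMeasurable) (ae_of_all _ hbd)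
  refine ⟨t • γ + ν.prod (ρ.restrict Qᶜ), ?_, ?_, ?_, ?_⟩
  · rw [Measure.map_add _ _ measurable_fst, Measure.map_smul, hγ1, Measure.map_fst_prod,
      Measure.restrict_apply_univ, ← add_smul, prob_add_prob_compl hQm, one_smul]
  · rw [Measure.map_add _ _ measurable_snd, Measure.map_smul, hγ2, Measure.map_snd_prod,
      measure_univ, one_smul, smul_smul, ENNReal.mul_inv_cancel hk2.ne' htt, one_smul,
      Measure.restrict_add_restrict_compl hQm]
  · exact (hγi.smul_measure htt).add_measure hprodi'
  · rw [integral_add_measure (hγi.smul_measure htt) hprodi', integral_smul_measure, smul_eq_mul]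
    have h1 : -((∫ x, ‖G x‖ ∂ν) * ∫ y in Qᶜ, (‖y‖ + ‖x₀‖) ∂ρ) ≤
        ∫ z, ⟪G z.1, z.2 - x₀⟫ ∂(ν.prod (ρ.restrict Qᶜ)) := by
      rw [← integral_prod_mul, ← integral_neg]
      exact integral_mono hprodi.neg hprodi' fun z => (abs_le.mp (hbd z)).1
    have h2 := mul_le_mul_of_nonneg_left (a := t.toReal) (show c * (∫⁻ x in Q, r x ^ α).toReal + κ ≤
      ∫ z, ⟪G z.1, z.2 - x₀⟫ ∂γ from le_trans (by gcongr) hγ) ENNReal.toReal_nonneg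
    linarith

lemma lintegral_rpow_ne_top {n : ℕ} {ρ : Measure (En n)} [IsFiniteMeasure ρ] (hρ : P1 ρ)
    {r : En n → ℝ≥0∞} (hr : Measurable r) (hrρ : volume.withDensity r ≤ ρ) {β : ℝ} (hβ : 1 < β)
    (hnβ : (n : ℝ) < β - 1) : ∫⁻ x, r x ^ (1 - 1 / β) ≠ ⊤ := by
  have hα : 0 < 1 - 1 / β := by
    rw [sub_pos, div_lt_one (by linarith)]; exact hβ
  have hsm : Measurable fun x : En n => 1 + ‖x‖ := measurable_norm.const_add 1
  have hi1 : Integrable (fun x : En n => 1 + ‖x‖) ρ := Integrable.add (integrable_const 1) hρ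
  have hi2 : Integrable (fun x : En n => (1 + ‖x‖) ^ (-(β - 1))) :=
    integrable_rpow_of_growth one_pos hnβ hsm fun x => by rw [one_mul]
  have hpt : ∀ x, r x ^ (1 - 1 / β) ≤ ENNReal.ofReal (1 - 1 / β) *
      (r x * ENNReal.ofReal (1 + ‖x‖) + ENNReal.ofReal (β - 1)⁻¹ *
        ENNReal.ofReal ((1 + ‖x‖) ^ (-(β - 1)))) := by
    intro x
    have hs : 0 < 1 + ‖x‖ := by positivity
    by_cases hx : r x = ⊤
    · rw [hx, ENNReal.top_mul (by simpa using hs), top_add, ENNReal.mul_top (by simpa using hα)]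
      exact le_top
    lift r x to NNReal using hx with m
    have := young_power hβ hs m.coe_nonneg zero_le_one
    rw [Real.one_rpow, mul_one, mul_one, inv_mul_le_iff₀ hα] at this
    have h2 := ENNReal.ofReal_le_ofReal this
    rw [ENNReal.ofReal_mul hα.le, ENNReal.ofReal_add (by positivity) (by
      have : 0 < β - 1 := by linarith
      positivity), ENNReal.ofReal_mul hs.le, ENNReal.ofReal_mul (inv_nonneg.mpr (by linarith)),
      ← ENNReal.ofReal_rpow_of_nonneg m.coe_nonneg hα.le] at h2
    simp only [ENNReal.ofReal_coe_nnreal] at h2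
    rw [neg_sub, mul_comm (m : ℝ≥0∞)]
    exact h2
  refine ne_top_of_le_ne_top ?_ (lintegral_mono hpt)
  have hm1 : Measurable fun x : En n => ENNReal.ofReal (1 + ‖x‖) := hsm.ennreal_ofReal
  have hm2 : Measurable fun x : En n => ENNReal.ofReal ((1 + ‖x‖) ^ (-(β - 1))) :=
    (hsm.pow_const _).ennreal_ofReal
  have hm3 : Measurable fun x => r x * ENNReal.ofReal (1 + ‖x‖) := hr.mul hm1
  rw [lintegral_const_mul' _ _ ENNReal.ofReal_ne_top, lintegral_add_left hm3,
    lintegral_const_mul _ hm2]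
  refine ENNReal.mul_ne_top ENNReal.ofReal_ne_top (ENNReal.add_ne_top.mpr ⟨?_,
    ENNReal.mul_ne_top ENNReal.ofReal_ne_top ?_⟩)
  · have h1 := lintegral_withDensity_eq_lintegral_mul volume hr hm1
    simp only [Pi.mul_apply] at h1
    rw [← h1]
    exact ne_top_of_le_ne_top hi1.lintegral_lt_top.ne (lintegral_mono' hrρ le_rfl)
  · exact hi2.lintegral_lt_top.ne

lemma posPartNN_coe (a : ℝ) : posPartNN (a : EReal) = ENNReal.ofReal a := by
  rw [posPartNN, if_neg (EReal.coe_ne_top a), EReal.toReal_coe]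

section
variable {X : Type*} [MeasurableSpace X] {γ : Measure X} {f b : X → ℝ}

lemma eInt_coe : eInt γ (fun x => (f x : EReal)) =
    ((∫⁻ x, ENNReal.ofReal (f x) ∂γ : ℝ≥0∞) : EReal) -
      ((∫⁻ x, ENNReal.ofReal (-f x) ∂γ : ℝ≥0∞) : EReal) := by
  simp only [eInt, ← EReal.coe_neg, posPartNN_coe]

lemma eInt_coe_of_integrable (hf : Integrable f γ) :
    eInt γ (fun x => (f x : EReal)) = ((∫ x, f x ∂γ : ℝ) : EReal) := by
  rw [eInt_coe, integral_eq_lintegral_pos_part_sub_lintegral_neg_part hf, EReal.coe_sub,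
    EReal.coe_ennreal_toReal hf.lintegral_lt_top.ne,
    EReal.coe_ennreal_toReal (x := ∫⁻ x, ENNReal.ofReal (-f x) ∂γ) hf.neg.lintegral_lt_top.ne]

lemma eInt_coe_le_integral (hb : Integrable b γ) (hfb : f ≤ᵐ[γ] b) :
    eInt γ (fun x => (f x : EReal)) ≤ ((∫ x, b x ∂γ : ℝ) : EReal) := by
  rw [← eInt_coe_of_integrable hb, eInt_coe, eInt_coe]
  refine EReal.sub_le_sub (EReal.coe_ennreal_le_coe_ennreal_iff.mpr (lintegral_mono_ae ?_))
    (EReal.coe_ennreal_le_coe_ennreal_iff.mpr (lintegral_mono_ae ?_))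
  · filter_upwards [hfb] with x hx using ENNReal.ofReal_le_ofReal hx
  · filter_upwards [hfb] with x hx using ENNReal.ofReal_le_ofReal (neg_le_neg hx)
end

lemma Ffun_eq {n : ℕ} {q : ℝ} (hq : 1 < (n : ℝ) + q) (ρ : Measure (En n)) [SigmaFinite ρ]
    (hfin : ∫⁻ x, ρ.rnDeriv volume x ^ (1 - 1 / ((n : ℝ) + q)) ≠ ⊤) :
    Ffun n q ρ = ((-((1 - 1 / ((n : ℝ) + q))⁻¹ *
      (∫⁻ x, ρ.rnDeriv volume x ^ (1 - 1 / ((n : ℝ) + q))).toReal) : ℝ) : EReal) := by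
  have hα : 0 < 1 - 1 / ((n : ℝ) + q) := by
    rw [sub_pos, div_lt_one (by linarith)]; exact hq
  set α := 1 - 1 / ((n : ℝ) + q)
  have e : ∫⁻ x, ENNReal.ofReal ((ρ.rnDeriv volume x).toReal ^ α / α) =
      ENNReal.ofReal α⁻¹ * ∫⁻ x, ρ.rnDeriv volume x ^ α := by
    rw [← lintegral_const_mul' _ _ ENNReal.ofReal_ne_top]
    refine lintegral_congr_ae ?_
    filter_upwards [ρ.rnDeriv_lt_top volume] with x hx
    rw [div_eq_inv_mul, ENNReal.ofReal_mul (inv_nonneg.mpr hα.le),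
      ← ENNReal.ofReal_rpow_of_nonneg ENNReal.toReal_nonneg hα.le, ENNReal.ofReal_toReal hx.ne]
  rw [Ffun, e, EReal.coe_neg, EReal.coe_mul, EReal.coe_ennreal_mul, EReal.coe_ennreal_ofReal,
    max_eq_left (inv_nonneg.mpr hα.le), EReal.coe_ennreal_toReal hfin]

lemma le_Tcorr_map {n : ℕ} {ν ρ : Measure (En n)} [IsProbabilityMeasure ν]
    {G : En n → En n} (hGm : Measurable G) (hGi : Integrable G ν) (x₀ : En n)
    {γ : Measure (En n × En n)} (h1 : γ.map Prod.fst = ν) (h2 : γ.map Prod.snd = ρ)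
    (hi : Integrable (fun z => ⟪G z.1, z.2 - x₀⟫) γ) :
    (((∫ z, ⟪G z.1, z.2 - x₀⟫ ∂γ) + ∫ x, ⟪G x, x₀⟫ ∂ν : ℝ) : EReal) ≤ Tcorr ρ (ν.map G) := by
  have hΨ : Measurable fun z : En n × En n => (z.2, G z.1) :=
    measurable_snd.prodMk (hGm.comp measurable_fst)
  have hγ : IsProbabilityMeasure γ := ⟨by rw [univ_of_map_fst h1, measure_univ]⟩
  have hmem : γ.map (fun z => (z.2, G z.1)) ∈ Plans ρ (ν.map G) := by
    refine ⟨Measure.isProbabilityMeasure_map hΨ.aemeasurable, ?_, ?_⟩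
    · rw [Measure.map_map measurable_fst hΨ]; exact h2
    · rw [Measure.map_map measurable_snd hΨ, ← h1, Measure.map_map hGm measurable_fst]; rfl
  refine le_trans (le_of_eq ?_) (le_iSup₂_of_le _ hmem le_rfl)
  have hm : Measurable fun p : En n × En n => ⟪p.1, p.2⟫ := measurable_fst.inner measurable_snd
  have hb : Integrable (fun x => ⟪G x, x₀⟫) ν := hGi.inner_const x₀
  have hb' : Integrable (fun z : En n × En n => ⟪G z.1, x₀⟫) γ := by
    rw [← h1] at hb
    exact hb.comp_measurable measurable_fst
  have hsum : Integrable (fun z : En n × En n => ⟪z.2, G z.1⟫) γ := by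
    refine (hi.add hb').congr (ae_of_all _ fun z => ?_)
    change ⟪G z.1, z.2 - x₀⟫ + ⟪G z.1, x₀⟫ = _
    rw [← inner_add_right, sub_add_cancel, real_inner_comm]
  rw [eInt_coe_of_integrable ((integrable_map_measure hm.aestronglyMeasurable
    hΨ.aemeasurable).mpr hsum), integral_map (f := fun p : En n × En n => ⟪p.1, p.2⟫)
    hΨ.aemeasurable hm.aestronglyMeasurable]
  congr 1
  have e : ∫ x, ⟪G x, x₀⟫ ∂ν = ∫ z, ⟪G z.1, x₀⟫ ∂γ := by
    rw [← h1, integral_map (f := fun x => ⟪G x, x₀⟫) measurable_fst.aemeasurable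
      (hGm.inner measurable_const).aestronglyMeasurable]
  rw [e, ← integral_add hi hb']
  refine integral_congr_ae (ae_of_all _ fun z => ?_)
  change ⟪G z.1, z.2 - x₀⟫ + ⟪G z.1, x₀⟫ = ⟪z.2, G z.1⟫
  rw [← inner_add_right, sub_add_cancel, real_inner_comm]

theorem ConvexPotential.le_Jfun {m : ℕ} {D : Set (En (m + 1))}
    {u : En (m + 1) → ℝ} {G : En (m + 1) → En (m + 1)} {q : ℝ} (hq : 1 < q)
    (h : ConvexPotential D u) [IsProbabilityMeasure (potMeasure (((m + 1 : ℕ) : ℝ) + q) D u)]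
    {a : ℝ} (ha : 0 < a) (hg : ∀ x ∈ D, a * (1 + ‖x‖) ≤ u x)
    (hnull : μH[m] (D \ interior D) = 0) (hGm : Measurable G)
    (hG : ∀ᵐ x, x ∈ D → HasGradientAt u (G x) x)
    (hGi : Integrable G (potMeasure (((m + 1 : ℕ) : ℝ) + q) D u))
    (ρ : Measure (En (m + 1))) [IsProbabilityMeasure ρ] (hρ : P1 ρ)
    {x₀ : En (m + 1)} (hx₀ : x₀ ∈ D) (j : ℕ) {ε : ℝ} (hε : 0 < ε) :
    (((∫ x in slopeSet D G j ∩ cube (m + 1) j, ⟪G x, x - x₀⟫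
        ∂(potMeasure (((m + 1 : ℕ) : ℝ) + q) D u)) -
      u x₀ * (potMeasure (((m + 1 : ℕ) : ℝ) + q) D u).real (slopeSet D G j ∩ cube (m + 1) j)ᶜ +
      (∫ x, ⟪G x, x₀⟫ ∂(potMeasure (((m + 1 : ℕ) : ℝ) + q) D u)) -
      (1 - 1 / (((m + 1 : ℕ) : ℝ) + q))⁻¹ * (∫ x in D, u x ^ (1 - (((m + 1 : ℕ) : ℝ) + q))) - ε :
        ℝ) : EReal) ≤ Jfun (m + 1) q ((potMeasure (((m + 1 : ℕ) : ℝ) + q) D u).map G) ρ := by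
  have hm0 : (0 : ℝ) ≤ ((m + 1 : ℕ) : ℝ) := Nat.cast_nonneg _
  set β : ℝ := ((m + 1 : ℕ) : ℝ) + q with hβ
  have hβ1 : 1 < β := by linarith
  have hα : 0 < 1 - 1 / β := by
    rw [sub_pos, div_lt_one (by linarith)]; exact hβ1
  have hrm := ρ.measurable_rnDeriv volume
  have hrρ : volume.withDensity (ρ.rnDeriv volume) ≤ ρ := Measure.withDensity_rnDeriv_le _ _
  have hfin : ∫⁻ x, ρ.rnDeriv volume x ^ (1 - 1 / β) ≠ ⊤ :=
    lintegral_rpow_ne_top hρ hrm hrρ hβ1 (by linarith)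
  obtain ⟨γ, h1, h2, hi, h3⟩ := exists_plan_of_truncation (ν := potMeasure β D u) hGi hρ hrm hrρ hα
    hfin (inv_nonneg.mpr hα.le) (x₀ := x₀) (κ := -((1 - 1 / β)⁻¹ * ∫ x in D, u x ^ (1 - β)) +
      (∫ x in slopeSet D G j ∩ cube (m + 1) j, ⟪G x, x - x₀⟫ ∂(potMeasure β D u)) -
        u x₀ * (potMeasure β D u).real (slopeSet D G j ∩ cube (m + 1) j)ᶜ - ε / 2)
    (fun R hR ρ' _ hρR r' hr' hrρ' => by
      obtain ⟨γ, h1, h2, hi, h3⟩ := h.exists_plan_of_bounded ⟨x₀, hx₀⟩ ha (by linarith) hg hnull hGm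
        hG hGi ρ' hR hρR hr' hrρ' hx₀ j (half_pos hε)
      refine ⟨γ, h1, h2, hi, le_trans (le_of_eq ?_) h3⟩
      ring) (half_pos hε)
  have h4 := le_Tcorr_map hGm hGi x₀ h1 h2 hi
  rw [Jfun, Ffun_eq hβ1 ρ hfin]
  refine le_trans ?_ (add_le_add_right h4 _)
  rw [← EReal.coe_add, EReal.coe_le_coe_iff]
  linarith

namespace ConvexPotential
variable {n : ℕ} {D : Set (En n)} {u : En n → ℝ} {G : En n → En n}

lemma integrable_of_integrable_inner (h : ConvexPotential D u) {β : ℝ}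
    [IsProbabilityMeasure (potMeasure β D u)]
    (hG : ∀ᵐ x, x ∈ D → HasGradientAt u (G x) x) {x₀ : En n} (hx₀ : x₀ ∈ D)
    (hi : Integrable (fun x => ⟪G x, x - x₀⟫ + u x₀) (potMeasure β D u)) :
    Integrable u (potMeasure β D u) := by
  refine hi.mono' h.measurable.aestronglyMeasurable ?_
  filter_upwards [h.ae_potMeasure_le_inner hG hx₀] with x hx
  rw [Real.norm_of_nonneg (h.nonneg x)]
  linarith

lemma Tcorr_le (h : ConvexPotential D u) {β : ℝ} [IsProbabilityMeasure (potMeasure β D u)]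
    (hGm : Measurable G) (hG : ∀ᵐ x, x ∈ D → HasGradientAt u (G x) x)
    (hGi : Integrable G (potMeasure β D u)) {x₀ : En n} (hx₀ : x₀ ∈ D)
    (hi : Integrable (fun x => ⟪G x, x - x₀⟫ + u x₀) (potMeasure β D u)) :
    Tcorr (potMeasure β D u) ((potMeasure β D u).map G) ≤
      (((∫ x, (⟪G x, x - x₀⟫ + u x₀) ∂(potMeasure β D u)) - u x₀ +
        ∫ x, ⟪G x, x₀⟫ ∂(potMeasure β D u) : ℝ) : EReal) := by
  set ν := potMeasure β D u with hν
  have hui : Integrable u ν := h.integrable_of_integrable_inner hG hx₀ hi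
  let A : En n → ℝ≥0∞ := fun y => ⨆ x ∈ D, ENNReal.ofReal (⟪x - x₀, y⟫ - u x + u x₀)
  have hAm : Measurable A := by
    refine LowerSemicontinuous.measurable (lowerSemicontinuous_biSup fun x _ => ?_)
    refine Continuous.lowerSemicontinuous (ENNReal.continuous_ofReal.comp ?_)
    exact ((continuous_const.inner continuous_id).sub continuous_const).add continuous_const
  have hAG : ∀ᵐ x ∂ν, A (G x) = ENNReal.ofReal (⟪G x, x - x₀⟫ + u x₀ - u x) := by
    filter_upwards [h.ae_mem_potMeasure, h.ae_potMeasure_hasGradientAt hG] with x hx hx'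
    refine le_antisymm (iSup₂_le fun y hy => ENNReal.ofReal_le_ofReal ?_)
      (le_iSup₂_of_le x hx (le_of_eq ?_))
    · have h1 := h.convexOn.add_inner_gradient_le hx hy hx'
      have h2 : ⟪y - x₀, G x⟫ = ⟪G x, y - x⟫ + ⟪G x, x - x₀⟫ := by
        rw [← inner_add_right, sub_add_sub_cancel, real_inner_comm]
      linarith
    · rw [real_inner_comm]; congr 1; ring
  have hAr : (fun x => (A (G x)).toReal) =ᵐ[ν] fun x => ⟪G x, x - x₀⟫ + u x₀ - u x := by
    filter_upwards [hAG, h.ae_potMeasure_le_inner hG hx₀] with x hx hx'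
    rw [hx, ENNReal.toReal_ofReal (by linarith)]
  have hAi : Integrable (fun y => (A y).toReal) (ν.map G) := by
    rw [integrable_map_measure hAm.ennreal_toReal.aestronglyMeasurable hGm.aemeasurable]
    exact (hi.sub hui).congr hAr.symm
  have hmi : Measurable fun y : En n => ⟪y, x₀⟫ := measurable_id.inner measurable_const
  have hbi : Integrable (fun y => ⟪y, x₀⟫) (ν.map G) := by
    rw [integrable_map_measure hmi.aestronglyMeasurable hGm.aemeasurable]
    exact hGi.inner_const x₀
  have hAfin : ∀ᵐ y ∂(ν.map G), A y ≠ ⊤ := by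
    rw [ae_map_iff (p := fun y => A y ≠ ⊤) hGm.aemeasurable (hAm (measurableSet_singleton ⊤)).compl]
    filter_upwards [hAG] with x hx
    rw [hx]
    exact ENNReal.ofReal_ne_top
  refine iSup₂_le fun γ hγ => ?_
  obtain ⟨hγp, hγ1, hγ2⟩ := hγ
  have hi1 : Integrable (fun z : En n × En n => u z.1) γ := by
    rw [← hγ1] at hui
    exact hui.comp_measurable measurable_fst
  have hi2 : Integrable (fun z : En n × En n => (A z.2).toReal) γ := by
    rw [← hγ2] at hAi
    exact hAi.comp_measurable measurable_snd
  have hi3 : Integrable (fun z : En n × En n => ⟪z.2, x₀⟫) γ := by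
    rw [← hγ2] at hbi
    exact hbi.comp_measurable measurable_snd
  have hle : (fun z : En n × En n => ⟪z.1, z.2⟫) ≤ᵐ[γ]
      fun z => (A z.2).toReal + (u z.1 - u x₀) + ⟪z.2, x₀⟫ := by
    have h1 : ∀ᵐ z ∂γ, z.1 ∈ D := by
      have := h.ae_mem_potMeasure (β := β)
      rw [← hν, ← hγ1] at this
      exact ae_of_ae_map measurable_fst.aemeasurable this
    have h2 : ∀ᵐ z ∂γ, A z.2 ≠ ⊤ := by
      rw [← hγ2] at hAfin
      exact ae_of_ae_map measurable_snd.aemeasurable hAfin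
    filter_upwards [h1, h2] with z hz hz'
    have h3 : ENNReal.ofReal (⟪z.1 - x₀, z.2⟫ - u z.1 + u x₀) ≤ A z.2 :=
      le_iSup₂_of_le z.1 hz le_rfl
    have h4 := (ENNReal.ofReal_le_iff_le_toReal hz').mp h3
    have h5 : ⟪z.1, z.2⟫ = ⟪z.1 - x₀, z.2⟫ + ⟪z.2, x₀⟫ := by
      rw [real_inner_comm x₀ z.2, ← inner_add_left, sub_add_cancel]
    linarith
  have hi1' : Integrable (fun z : En n × En n => u z.1 - u x₀) γ := hi1.sub (integrable_const _)
  refine (eInt_coe_le_integral ((hi2.add hi1').add hi3) hle).trans ?_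
  rw [EReal.coe_le_coe_iff]
  have e1 : ∫ z, u z.1 ∂γ = ∫ x, u x ∂ν := by
    rw [← hγ1, integral_map measurable_fst.aemeasurable h.measurable.aestronglyMeasurable]
  have e2 : ∫ z, (A z.2).toReal ∂γ = ∫ x, (⟪G x, x - x₀⟫ + u x₀ - u x) ∂ν := by
    rw [← integral_congr_ae hAr, ← integral_map (f := fun y => (A y).toReal) hGm.aemeasurable
      hAm.ennreal_toReal.aestronglyMeasurable, ← hγ2,
      integral_map (f := fun y => (A y).toReal) measurable_snd.aemeasurable
      hAm.ennreal_toReal.aestronglyMeasurable]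
  have e3 : ∫ z, ⟪z.2, x₀⟫ ∂γ = ∫ x, ⟪G x, x₀⟫ ∂ν := by
    rw [← integral_map (f := fun y => ⟪y, x₀⟫) hGm.aemeasurable hmi.aestronglyMeasurable, ← hγ2,
      integral_map (f := fun y => ⟪y, x₀⟫) measurable_snd.aemeasurable hmi.aestronglyMeasurable]
  rw [integral_add' (hi2.add hi1') hi3, integral_add' hi2 hi1',
    integral_sub hi1 (integrable_const _), e1, e2, e3, integral_sub hi hui, integral_const,
    probReal_univ, one_smul]
  linarith

end ConvexPotential

namespace ConvexPotential
section
variable {n : ℕ} {D : Set (En n)} {u : En n → ℝ} {G : En n → En n} {β : ℝ}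

lemma lintegral_rpow_one_sub_ne_top (h : ConvexPotential D u) {a : ℝ} (ha : 0 < a)
    (hg : ∀ x ∈ D, a * (1 + ‖x‖) ≤ u x) (hβ : (n : ℝ) + 1 < β) :
    ∫⁻ x in D, ENNReal.ofReal (u x ^ (1 - β)) ≠ ⊤ := by
  have hi : Integrable (fun x : En n => (a * (1 + ‖x‖)) ^ (-(β - 1))) :=
    integrable_rpow_of_growth (s := β - 1) ha (by linarith)
      ((measurable_norm.const_add 1).const_mul a) fun x => le_rfl
  refine ne_top_of_le_ne_top hi.lintegral_lt_top.ne
    ((setLIntegral_mono' h.measurableSet fun x hx => ENNReal.ofReal_le_ofReal ?_).trans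
      (setLIntegral_le_lintegral D _))
  rw [neg_sub]
  have hn : (0 : ℝ) ≤ n := Nat.cast_nonneg n
  exact Real.rpow_le_rpow_of_nonpos (by positivity) (hg x hx) (by linarith)

lemma lintegral_rpow_one_sub_eq (h : ConvexPotential D u) :
    ∫⁻ x, ENNReal.ofReal (u x) ∂(potMeasure β D u) =
      ∫⁻ x in D, ENNReal.ofReal (u x ^ (1 - β)) := by
  rw [h.potMeasure_eq, lintegral_withDensity_eq_lintegral_mul _
    (measurable_powDensity h.measurable β) h.measurable.ennreal_ofReal]
  refine setLIntegral_congr_fun h.measurableSet fun x hx => ?_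
  have hx0 := h.pos x hx
  simp only [Pi.mul_apply]
  rw [← ENNReal.ofReal_mul (Real.rpow_nonneg hx0.le _), sub_eq_neg_add, Real.rpow_add_one hx0.ne']

lemma integrable_potMeasure (h : ConvexPotential D u) {a : ℝ} (ha : 0 < a)
    (hg : ∀ x ∈ D, a * (1 + ‖x‖) ≤ u x) (hβ : (n : ℝ) + 1 < β) :
    Integrable u (potMeasure β D u) := by
  refine ⟨h.measurable.aestronglyMeasurable, ?_⟩
  rw [hasFiniteIntegral_iff_ofReal (ae_of_all _ h.nonneg), h.lintegral_rpow_one_sub_eq]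
  exact (h.lintegral_rpow_one_sub_ne_top ha hg hβ).lt_top

lemma p1_potMeasure (h : ConvexPotential D u) {a : ℝ} (ha : 0 < a)
    (hg : ∀ x ∈ D, a * (1 + ‖x‖) ≤ u x) (hβ : (n : ℝ) + 1 < β) : P1 (potMeasure β D u) := by
  refine ((h.integrable_potMeasure ha hg hβ).const_mul a⁻¹).mono'
    measurable_norm.aestronglyMeasurable ?_
  filter_upwards [h.ae_mem_potMeasure] with x hx
  rw [norm_norm, ← div_eq_inv_mul, le_div_iff₀ ha]
  nlinarith [hg x hx]

lemma Ffun_potMeasure (h : ConvexPotential D u) {q : ℝ} (hq : 1 < q)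
    [IsProbabilityMeasure (potMeasure ((n : ℝ) + q) D u)] {a : ℝ} (ha : 0 < a)
    (hg : ∀ x ∈ D, a * (1 + ‖x‖) ≤ u x) :
    Ffun n q (potMeasure ((n : ℝ) + q) D u) =
      ((-((1 - 1 / ((n : ℝ) + q))⁻¹ * ∫ x in D, u x ^ (1 - ((n : ℝ) + q))) : ℝ) : EReal) := by
  have hn : (0 : ℝ) ≤ n := Nat.cast_nonneg n
  set β := (n : ℝ) + q with hβ
  have hβ1 : 1 < β := by linarith
  have hα : 0 < 1 - 1 / β := by
    rw [sub_pos, div_lt_one (by linarith)]; exact hβ1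
  have e : ∫⁻ x, (potMeasure β D u).rnDeriv volume x ^ (1 - 1 / β) =
      ∫⁻ x in D, ENNReal.ofReal (u x ^ (1 - β)) := by
    rw [← lintegral_indicator h.measurableSet]
    refine lintegral_congr_ae ?_
    filter_upwards [Measure.rnDeriv_withDensity volume
      ((measurable_powDensity h.measurable β).indicator h.measurableSet)] with x hx
    rw [potMeasure, hx]
    by_cases hxD : x ∈ D
    · rw [indicator_of_mem hxD, indicator_of_mem hxD,
        ENNReal.ofReal_rpow_of_nonneg (Real.rpow_nonneg (h.nonneg x) _) hα.le,
        ← Real.rpow_mul (h.nonneg x)]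
      congr 2
      have : β ≠ 0 := by linarith
      field_simp
      ring
    · rw [indicator_of_notMem hxD, indicator_of_notMem hxD, ENNReal.zero_rpow_of_pos hα]
  rw [Ffun_eq hβ1 _ (by
    rw [← hβ, e]; exact h.lintegral_rpow_one_sub_ne_top ha hg (by linarith)), ← hβ, e,
    integral_eq_lintegral_of_nonneg_ae (ae_of_all _ fun x => Real.rpow_nonneg (h.nonneg x) _)
      (h.measurable.pow_const _).aestronglyMeasurable]

lemma tendsto_setIntegral_slopeSet (h : ConvexPotential D u)
    [IsProbabilityMeasure (potMeasure β D u)] (hGm : Measurable G)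
    (hG : ∀ᵐ x, x ∈ D → HasGradientAt u (G x) x) {x₀ : En n} (hx₀ : x₀ ∈ D) :
    Tendsto (fun j : ℕ =>
      (((∫ x in slopeSet D G j ∩ cube n j, ⟪G x, x - x₀⟫ ∂(potMeasure β D u)) -
        u x₀ * (potMeasure β D u).real (slopeSet D G j ∩ cube n j)ᶜ + u x₀ : ℝ) : EReal)) atTop
      (𝓝 ((∫⁻ x, ENNReal.ofReal (⟪G x, x - x₀⟫ + u x₀) ∂(potMeasure β D u) : ℝ≥0∞) : EReal)) := by
  set ν := potMeasure β D u
  have hmono : Monotone fun k : ℕ => slopeSet D G k ∩ cube n k := fun k l hkl =>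
    inter_subset_inter (slopeSet_mono D G (Nat.cast_le.mpr hkl))
      (monotone_cube n (Nat.cast_le.mpr hkl))
  have hm : ∀ k : ℕ, MeasurableSet (slopeSet D G k ∩ cube n k) := fun k =>
    (h.measurableSet_slopeSet hGm k).inter (measurableSet_cube n k)
  have hfull : (⋃ k : ℕ, slopeSet D G k ∩ cube n k : Set (En n)) =ᵐ[ν] univ := by
    rw [ae_eq_univ, prob_compl_eq_zero_iff (MeasurableSet.iUnion hm)]
    exact tendsto_nhds_unique (tendsto_measure_iUnion_atTop hmono) h.tendsto_potMeasure_slopeSet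
  have h1 := tendsto_measure_iUnion_atTop
    (μ := ν.withDensity fun x => ENNReal.ofReal (⟪G x, x - x₀⟫ + u x₀)) hmono
  rw [withDensity_apply _ (MeasurableSet.iUnion hm), setLIntegral_congr hfull,
    setLIntegral_univ] at h1
  refine ((continuous_coe_ennreal_ereal.tendsto _).comp h1).congr fun j => ?_
  have hi := h.integrableOn_slopeSet_cube (β := β) hGm x₀ j j
  have hi' : Integrable (fun x => ⟪G x, x - x₀⟫ + u x₀)
      (ν.restrict (slopeSet D G j ∩ cube n j)) := hi.add (integrable_const _)
  have hnn : 0 ≤ᵐ[ν.restrict (slopeSet D G j ∩ cube n j)] fun x => ⟪G x, x - x₀⟫ + u x₀ := by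
    filter_upwards [ae_restrict_of_ae (h.ae_potMeasure_le_inner hG hx₀)] with x hx
    have := h.nonneg x
    change 0 ≤ ⟪G x, x - x₀⟫ + u x₀
    linarith
  have e : ∫ x in slopeSet D G j ∩ cube n j, (⟪G x, x - x₀⟫ + u x₀) ∂ν =
      (∫ x in slopeSet D G j ∩ cube n j, ⟪G x, x - x₀⟫ ∂ν) -
        u x₀ * ν.real (slopeSet D G j ∩ cube n j)ᶜ + u x₀ := by
    rw [integral_add hi (integrable_const _), setIntegral_const, smul_eq_mul,
      probReal_compl_eq_one_sub (hm j)]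
    ring
  rw [Function.comp_apply, Function.comp_apply, withDensity_apply _ (hm j), ← e,
    integral_eq_lintegral_of_nonneg_ae hnn hi'.aestronglyMeasurable,
    EReal.coe_ennreal_toReal hi'.lintegral_lt_top.ne]

end

theorem Jfun_potMeasure_le {m : ℕ} {D : Set (En (m + 1))}
    {u : En (m + 1) → ℝ} {G : En (m + 1) → En (m + 1)} {q : ℝ} (hq : 1 < q)
    (h : ConvexPotential D u) [IsProbabilityMeasure (potMeasure (((m + 1 : ℕ) : ℝ) + q) D u)]
    {a : ℝ} (ha : 0 < a) (hg : ∀ x ∈ D, a * (1 + ‖x‖) ≤ u x) (hne : D.Nonempty)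
    (hnull : μH[m] (D \ interior D) = 0) (hGm : Measurable G)
    (hG : ∀ᵐ x, x ∈ D → HasGradientAt u (G x) x)
    (hGi : Integrable G (potMeasure (((m + 1 : ℕ) : ℝ) + q) D u))
    (ρ : Measure (En (m + 1))) [IsProbabilityMeasure ρ] (hρ : P1 ρ) :
    Jfun (m + 1) q ((potMeasure (((m + 1 : ℕ) : ℝ) + q) D u).map G)
        (potMeasure (((m + 1 : ℕ) : ℝ) + q) D u) ≤
      Jfun (m + 1) q ((potMeasure (((m + 1 : ℕ) : ℝ) + q) D u).map G) ρ := by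
  obtain ⟨x₀, hx₀⟩ := hne
  have hlow := fun j : ℕ => h.le_Jfun hq ha hg hnull hGm hG hGi ρ hρ hx₀ j
    (ε := 1 / ((j : ℝ) + 1)) (by positivity)
  have hF := h.Ffun_potMeasure hq ha hg
  set ν := potMeasure (((m + 1 : ℕ) : ℝ) + q) D u with hν
  have hlim := h.tendsto_setIntegral_slopeSet (β := ((m + 1 : ℕ) : ℝ) + q) hGm hG hx₀
  rw [← hν] at hlim
  set b := ∫ x, ⟪G x, x₀⟫ ∂ν with hb
  set Φ := (1 - 1 / (((m + 1 : ℕ) : ℝ) + q))⁻¹ *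
    (∫ x in D, u x ^ (1 - (((m + 1 : ℕ) : ℝ) + q))) with hΦ
  set W : ℕ → ℝ := fun j =>
    (∫ x in slopeSet D G j ∩ cube (m + 1) j, ⟪G x, x - x₀⟫ ∂ν) -
        u x₀ * ν.real (slopeSet D G j ∩ cube (m + 1) j)ᶜ + u x₀ with hW
  have hlow' : ∀ j : ℕ, ((W j + (b - Φ - u x₀ - 1 / ((j : ℝ) + 1)) : ℝ) : EReal) ≤
      Jfun (m + 1) q (ν.map G) ρ := fun j => by
    refine le_trans (le_of_eq ?_) (hlow j)
    congr 1
    simp only [hW]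
    ring
  have hc : Tendsto (fun j : ℕ => b - Φ - u x₀ - 1 / ((j : ℝ) + 1)) atTop (𝓝 (b - Φ - u x₀ - 0)) :=
    tendsto_const_nhds.sub tendsto_one_div_add_atTop_nhds_zero_nat
  by_cases hH : ∫⁻ x, ENNReal.ofReal (⟪G x, x - x₀⟫ + u x₀) ∂ν = ⊤
  · rw [hH, EReal.coe_ennreal_top] at hlim
    have h1 : Tendsto W atTop atTop := EReal.tendsto_coe_nhds_top_iff.mp hlim
    have h2 := EReal.tendsto_coe_nhds_top_iff.mpr (h1.atTop_add hc)
    exact le_top.trans (le_of_tendsto' h2 hlow')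
  · have hnn : 0 ≤ᵐ[ν] fun x => ⟪G x, x - x₀⟫ + u x₀ := by
      filter_upwards [h.ae_potMeasure_le_inner hG hx₀] with x hx
      have := h.nonneg x
      change 0 ≤ ⟪G x, x - x₀⟫ + u x₀
      linarith
    have hi : Integrable (fun x => ⟪G x, x - x₀⟫ + u x₀) ν := by
      refine ⟨((hGm.inner (measurable_id.sub_const x₀)).add_const _).aestronglyMeasurable, ?_⟩
      rw [hasFiniteIntegral_iff_ofReal hnn]
      exact lt_top_iff_ne_top.mpr hH
    have e : ((∫ x, (⟪G x, x - x₀⟫ + u x₀) ∂ν : ℝ) : EReal) =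
        ((∫⁻ x, ENNReal.ofReal (⟪G x, x - x₀⟫ + u x₀) ∂ν : ℝ≥0∞) : EReal) := by
      rw [integral_eq_lintegral_of_nonneg_ae hnn hi.aestronglyMeasurable,
        EReal.coe_ennreal_toReal hH]
    rw [← e] at hlim
    have h1 : Tendsto W atTop (𝓝 (∫ x, (⟪G x, x - x₀⟫ + u x₀) ∂ν)) := EReal.tendsto_coe.mp hlim
    have h2 := le_of_tendsto' (EReal.tendsto_coe.mpr (h1.add hc)) hlow'
    refine le_trans ?_ h2
    rw [Jfun, hF]
    refine (add_le_add_right (h.Tcorr_le hGm hG hGi hx₀ hi) _).trans ?_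
    rw [← EReal.coe_add, EReal.coe_le_coe_iff]
    linarith

end ConvexPotential

lemma coe_toReal_of_pos {x : EReal} (hx : 0 < x) (hx' : x ≠ ⊤) : (x.toReal : EReal) = x :=
  EReal.coe_toReal hx' (lt_of_le_of_lt bot_le hx).ne'

lemma ConvexLSC.convexPotential {n : ℕ} {φ : En n → EReal} (hφ : ConvexLSC φ)
    (hφpos : ∀ x, 0 < φ x) : ConvexPotential {x | φ x ≠ ⊤} fun x => (φ x).toReal := by
  have key : ∀ x, φ x ≠ ⊤ → ∀ y, φ y ≠ ⊤ → ∀ a b : ℝ, 0 ≤ a → 0 ≤ b → a + b = 1 →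
      φ (a • x + b • y) ≤ ((a * (φ x).toReal + b * (φ y).toReal : ℝ) : EReal) := by
    intro x hx y hy a b ha hb hab
    have hxe : (x, (φ x).toReal) ∈ {p : En n × ℝ | φ p.1 ≤ (p.2 : EReal)} :=
      (coe_toReal_of_pos (hφpos x) hx).ge
    have hye : (y, (φ y).toReal) ∈ {p : En n × ℝ | φ p.1 ≤ (p.2 : EReal)} :=
      (coe_toReal_of_pos (hφpos y) hy).ge
    exact hφ.2 hxe hye ha hb hab
  have key' : ∀ x, φ x ≠ ⊤ → ∀ y, φ y ≠ ⊤ → ∀ a b : ℝ, 0 ≤ a → 0 ≤ b → a + b = 1 →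
      φ (a • x + b • y) ≠ ⊤ := fun x hx y hy a b ha hb hab =>
    ((key x hx y hy a b ha hb hab).trans_lt (EReal.coe_lt_top _)).ne
  refine ⟨⟨fun x hx y hy a b ha hb hab => key' x hx y hy a b ha hb hab,
    fun x hx y hy a b ha hb hab => ?_⟩, fun x hx => EReal.toReal_pos (hφpos x) hx,
    fun x hx => ?_, fun s => ?_⟩
  · rw [← EReal.coe_le_coe_iff,
      coe_toReal_of_pos (hφpos _) (key' x hx y hy a b ha hb hab)]
    exact key x hx y hy a b ha hb hab
  · have : φ x = ⊤ := not_not.mp hx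
    change (φ x).toReal = 0
    rw [this, EReal.toReal_top]
  · have : {x | x ∈ {x | φ x ≠ ⊤} ∧ (φ x).toReal ≤ s} = φ ⁻¹' Iic (s : EReal) := by
      ext x
      refine ⟨fun hx => ?_, fun hx => ?_⟩
      · rw [mem_preimage, mem_Iic, ← coe_toReal_of_pos (hφpos x) hx.1]
        exact EReal.coe_le_coe_iff.mpr hx.2
      · have hx' : φ x ≠ ⊤ := (lt_of_le_of_lt hx (EReal.coe_lt_top s)).ne
        refine ⟨hx', ?_⟩
        rw [← EReal.coe_le_coe_iff, coe_toReal_of_pos (hφpos x) hx']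
        exact hx
    rw [this]
    exact hφ.1.isClosed_preimage _

lemma withDensity_posPartNN_eq {n : ℕ} {φ : En n → EReal} (hφpos : ∀ x, 0 < φ x) {β : ℝ}
    (hβ : 0 < β) : volume.withDensity (fun x => posPartNN (φ x) ^ (-β)) =
      potMeasure β {x | φ x ≠ ⊤} fun x => (φ x).toReal := by
  rw [potMeasure]
  congr 1
  ext x
  by_cases hx : φ x = ⊤
  · rw [indicator_of_notMem (show x ∉ {x | φ x ≠ ⊤} from fun h => h hx), posPartNN, if_pos hx,
      ENNReal.top_rpow_of_neg (neg_lt_zero.mpr hβ)]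
  · rw [indicator_of_mem (show x ∈ {x | φ x ≠ ⊤} from hx), posPartNN, if_neg hx,
      ENNReal.ofReal_rpow_of_pos (EReal.toReal_pos (hφpos x) hx)]

lemma EssCont.hausdorffMeasure_diff_interior {m : ℕ} {φ : En (m + 1) → EReal} (hφ : EssCont φ) :
    μH[m] ({x | φ x ≠ ⊤} \ interior {x | φ x ≠ ⊤}) = 0 := by
  have h : ((m + 1 : ℕ) : ℝ) - 1 = m := by push_cast; ring
  rw [EssCont, h] at hφ
  refine measure_mono_null (fun x hx => ?_) hφ
  refine fun hc : ContinuousAt φ x => hx.2 ?_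
  rw [mem_interior_iff_mem_nhds]
  filter_upwards [hc.eventually (gt_mem_nhds (lt_top_iff_ne_top.mpr hx.1))] with y hy using hy.ne

/-- Sufficient optimality condition: if `ρ̄ = φ^{-(n+q)} dx` with
`φ` essentially continuous convex and `μ = (∇φ)_# ρ̄`, then `ρ̄` minimizes `J`. -/
theorem qMomentMeasures_sufficient_condition
    (n : ℕ) (hn : 1 ≤ n) (q : ℝ) (hq : 1 < q)
    (φ : En n → EReal) (hφpos : ∀ x, 0 < φ x) (hφ : ConvexLSC φ) (hφec : EssCont φ)
    (ρbar : Measure (En n))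
    (hρdef : ρbar = volume.withDensity (fun x => posPartNN (φ x) ^ (-((n : ℝ) + q))))
    [IsProbabilityMeasure ρbar]
    (g : En n → En n) (hg_meas : AEMeasurable g ρbar)
    (hg : ∀ᵐ x ∂ρbar, HasGradientAt (fun y => (φ y).toReal) (g x) x)
    (μ : Measure (En n)) (hμdef : μ = ρbar.map g)
    (hμ1 : P1 μ) (hplane : NotHyperplane μ) :
    P1 ρbar ∧
      ∀ ρ : Measure (En n), IsProbabilityMeasure ρ → P1 ρ →
        Jfun n q μ ρbar ≤ Jfun n q μ ρ := by
  obtain ⟨m, rfl⟩ : ∃ m, n = m + 1 := ⟨n - 1, by omega⟩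
  have hm : (0 : ℝ) ≤ ((m + 1 : ℕ) : ℝ) := Nat.cast_nonneg _
  have h := hφ.convexPotential hφpos
  have hnull := hφec.hausdorffMeasure_diff_interior
  rw [withDensity_posPartNN_eq hφpos (by linarith)] at hρdef
  set D := {x | φ x ≠ ⊤}
  set u : En (m + 1) → ℝ := fun x => (φ x).toReal
  set β : ℝ := ((m + 1 : ℕ) : ℝ) + q with hβ
  subst hρdef
  obtain ⟨G, hGm, hgG⟩ := hg_meas
  have hGν : ∀ᵐ x ∂(potMeasure β D u), HasGradientAt u (G x) x := by
    filter_upwards [hg, hgG] with x hx hx'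
    rwa [← hx']
  have hG : ∀ᵐ x, x ∈ D → HasGradientAt u (G x) x := by
    rw [potMeasure, ae_withDensity_iff
      ((measurable_powDensity h.measurable β).indicator h.measurableSet)] at hGν
    filter_upwards [hGν] with x hx hxD
    refine hx ?_
    rw [indicator_of_mem hxD]
    exact (ENNReal.ofReal_pos.mpr (Real.rpow_pos_of_pos (h.pos x hxD) _)).ne'
  have hne : (interior D).Nonempty := by
    obtain ⟨x, hx, hxD⟩ := (hGν.and h.ae_mem_potMeasure).exists
    exact ⟨x, h.mem_interior_of_hasGradientAt hxD hx⟩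
  have hmass : ∫⁻ x in D, ENNReal.ofReal (u x ^ (-β)) ≠ ⊤ := by
    have h1 := measure_ne_top (potMeasure β D u) univ
    rwa [h.potMeasure_eq, withDensity_apply _ MeasurableSet.univ, Measure.restrict_univ] at h1
  obtain ⟨a, ha, hgr⟩ := h.growth (by linarith) hmass hne
  rw [Measure.map_congr hgG] at hμdef
  subst hμdef
  have hGi : Integrable G (potMeasure β D u) := by
    rw [P1, integrable_map_measure measurable_norm.aestronglyMeasurable hGm.aemeasurable] at hμ1
    exact (integrable_norm_iff hGm.aestronglyMeasurable).mp hμ1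
  exact ⟨h.p1_potMeasure ha hgr (by linarith), fun ρ _ hρ =>
    h.Jfun_potMeasure_le hq ha hgr (hne.mono interior_subset) hnull hGm hG hGi ρ hρ⟩

end
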